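/- Let 𝕀_{3,6} := { In_{M_S}(𝓘_{3,6}) : S an iterated sequence for Gr(3,6) }, and let G ≤ Aut(𝓘_{3,6}) be the group generated by the sign-twisted simple-transposition automorphisms. Under the equivalence relation on 𝕀_{3,6} given by J ∼ J' iff J' = g(J) for some g ∈ G, the set 𝕀_{3,6} decomposes into exactly 4 equivalence classes, of cardinalities 48, 48, 48 and 96. -/

import Mathlib

/-!
Common framework: iterated sequences for Gr(3,n), the matrix `A_S`, pullbacks of
Plücker coordinates, the weighted reverse lexicographic order, lowest-term
valuations, Plücker relations, weighting matrices and initial ideals.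
-/

open MvPolynomial

noncomputable section

/-- Height of a positive root `(i,j) ↦ j - i`. -/
def Ht (β : ℕ × ℕ) : ℕ := β.2 - β.1

/-- `IsIter n S` : `S` is an iterated sequence for `Gr(3,n)`: it starts (as base of the
iteration) from a PBW sequence for `Gr(3,4)`, i.e. an ordering of `((1,4),(2,4),(3,4))`,
and for each `r = 5, …, n` a triple `((i₁,r),(i₂,r),(i₃,r))` with `i₁,i₂,i₃ ∈ [r-1]`
pairwise distinct is prepended. -/
inductive IsIter : ℕ → List (ℕ × ℕ) → Prop
  | base (L : List (ℕ × ℕ)) : L.Perm [(1,4),(2,4),(3,4)] → IsIter 4 L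
  | step (r : ℕ) (L : List (ℕ × ℕ)) (i₁ i₂ i₃ : ℕ) :
      4 ≤ r → IsIter r L →
      1 ≤ i₁ → i₁ ≤ r → 1 ≤ i₂ → i₂ ≤ r → 1 ≤ i₃ → i₃ ≤ r →
      i₁ ≠ i₂ → i₁ ≠ i₃ → i₂ ≠ i₃ →
      IsIter (r+1) ((i₁, r+1) :: (i₂, r+1) :: (i₃, r+1) :: L)

/-- `Sorted k n I` : `I ∈ I_{k,n}`, a strictly increasing `k`-tuple in `{1,…,n}`. -/
def Sorted (k n : ℕ) (I : Fin k → ℕ) : Prop :=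
  StrictMono I ∧ ∀ a, 1 ≤ I a ∧ I a ≤ n

/-- `ℕ`-indexed square "matrices" (1-based indexing, size given by a parameter `n`). -/
abbrev NMat := ℕ → ℕ → MvPolynomial (ℕ × ℕ) ℂ

/-- Product of two `n × n` matrices, 1-based indexing. -/
def matMul (n : ℕ) (A B : NMat) : NMat := fun i j => ∑ k ∈ Finset.Icc 1 n, A i k * B k j

/-- Identity matrix. -/
def idN : NMat := fun i j => if i = j then 1 else 0

/-- The factor `1 + x_β f_β`, where `f_β` is the matrix unit in entry `β = (i,j)`. -/
def factor (β : ℕ × ℕ) : NMat := fun i j =>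
  (if i = j then (1 : MvPolynomial (ℕ × ℕ) ℂ) else 0) +
    (if i = β.1 ∧ j = β.2 then (MvPolynomial.X β : MvPolynomial (ℕ × ℕ) ℂ) else 0)

/-- `A_S := (1 + x_{β_N} f_{β_N}) ⋯ (1 + x_{β_1} f_{β_1})` for `S = (β_1, …, β_N)`. -/
def ASmat (n : ℕ) : List (ℕ × ℕ) → NMat
  | [] => idN
  | β :: L => matMul n (ASmat n L) (factor β)

/-- `φ_S^*(p̄_I)` : the determinant of the `3×3` submatrix of `A_S` on rows `(1,2,3)`
and columns `I = (i₁,i₂,i₃)`. -/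
def phiStar (n : ℕ) (S : List (ℕ × ℕ)) (I : Fin 3 → ℕ) : MvPolynomial (ℕ × ℕ) ℂ :=
  Matrix.det (Matrix.of fun a b : Fin 3 => ASmat n S (a.val + 1) (I b))

/-- `Ψ_S(a) = Σ_l a_l Ht(β_l)`, the height-weighted function (written on exponents). -/
def Psi (d : (ℕ × ℕ) →₀ ℕ) : ℕ := d.sum fun β c => c * Ht β

/-- `a <_lex b` : lexicographic comparison of exponent vectors, the coordinates being
read in the order `β_1, …, β_N` of the sequence `S`. -/
def lexLT (S : List (ℕ × ℕ)) (a b : (ℕ × ℕ) →₀ ℕ) : Prop :=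
  ∃ k < S.length, (∀ m < k, a (S.getD m (0,0)) = b (S.getD m (0,0))) ∧
    a (S.getD k (0,0)) < b (S.getD k (0,0))

/-- `a ≤_lex b` on coordinates indexed by `S`. -/
def lexLE (S : List (ℕ × ℕ)) (a b : (ℕ × ℕ) →₀ ℕ) : Prop :=
  lexLT S a b ∨ ∀ k < S.length, a (S.getD k (0,0)) = b (S.getD k (0,0))

/-- `a ≺_{Ψ_S} b` : the strict `Ψ_S`-weighted reverse lexicographic order:
`Ψ_S(a) < Ψ_S(b)`, or `Ψ_S(a) = Ψ_S(b)` and `a >_lex b`. -/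
def psiLT (S : List (ℕ × ℕ)) (a b : (ℕ × ℕ) →₀ ℕ) : Prop :=
  Psi a < Psi b ∨ (Psi a = Psi b ∧ lexLT S b a)

/-- `a ⪯_{Ψ_S} b`. -/
def psiLE (S : List (ℕ × ℕ)) (a b : (ℕ × ℕ) →₀ ℕ) : Prop :=
  Psi a < Psi b ∨ (Psi a = Psi b ∧ lexLE S b a)

open scoped Classical in
/-- The `⪯_{Ψ_S}`-minimum of the support of a polynomial (defaulting to `0` if no
minimum exists). -/
def minSupp (S : List (ℕ × ℕ)) (f : MvPolynomial (ℕ × ℕ) ℂ) : (ℕ × ℕ) →₀ ℕ :=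
  if h : ∃ m ∈ f.support, ∀ m' ∈ f.support, psiLE S m m' then h.choose else 0

/-- The lowest-term valuation `v_S(p̄_I)` : the `⪯_{Ψ_S}`-minimum of the support of
`φ_S^*(p̄_I)`. -/
def valS (n : ℕ) (S : List (ℕ × ℕ)) (I : Fin 3 → ℕ) : (ℕ × ℕ) →₀ ℕ :=
  minSupp S (phiStar n S I)

/-- The index set `I_{3,n}` of Plücker variables. -/
abbrev MI (n : ℕ) := {v : Fin 3 → ℕ // Sorted 3 n v}

/-- The Plücker polynomial ring `ℂ[p_K : K ∈ I_{3,n}]`. -/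
abbrev PRing (n : ℕ) := MvPolynomial (MI n) ℂ

open scoped Classical in
/-- The Plücker variable `p_K`, defined to be `0` if `K` is not strictly increasing
(in particular `p_{I ∪ j} = 0` if `j ∈ I`). -/
def pvar (n : ℕ) (K : Fin 3 → ℕ) : PRing n :=
  if h : Sorted 3 n K then MvPolynomial.X (⟨K, h⟩ : MI n) else 0

/-- `I ∪ j` : the sorted triple obtained by adjoining `j` to the pair `I`. -/
def insert3 (I : Fin 2 → ℕ) (j : ℕ) : Fin 3 → ℕ :=
  fun a => (List.insertionSort (· ≤ ·) [I 0, I 1, j]).getD a 0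

/-- `J ∖ j` : the sorted triple obtained by removing `j` from the 4-tuple `J`. -/
def erase4 (J : Fin 4 → ℕ) (j : ℕ) : Fin 3 → ℕ :=
  fun a => (([J 0, J 1, J 2, J 3]).erase j).getD a 0

/-- The Plücker relation
`R_{I,J} = Σ_{j ∈ J} (−1)^{#{i∈I : i<j} + #{j'∈J : j<j'}} p_{I∪j} p_{J∖j}`. -/
def Rrel (n : ℕ) (I : Fin 2 → ℕ) (J : Fin 4 → ℕ) : PRing n :=
  ∑ a : Fin 4,
    (-1 : PRing n) ^ ((Finset.univ.filter fun b : Fin 2 => I b < J a).card +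
        (Finset.univ.filter fun b : Fin 4 => J a < J b).card) *
      (pvar n (insert3 I (J a)) * pvar n (erase4 J (J a)))

/-- The Plücker ideal `𝓘_{3,n}`, generated by all Plücker relations. -/
def PluckerIdeal (n : ℕ) : Ideal (PRing n) :=
  Ideal.span {f | ∃ I J, Sorted 2 n I ∧ Sorted 4 n J ∧ f = Rrel n I J}

/-- `M_S · m = Σ_K m_K v_S(p̄_K)` : the weighting matrix applied to an exponent. -/
def MSdot (n : ℕ) (S : List (ℕ × ℕ)) (m : MI n →₀ ℕ) : (ℕ × ℕ) →₀ ℕ :=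
  m.sum fun K c => c • valS n S K.val

open scoped Classical in
/-- The initial form `In_{M_S}(f)` : the sum of the terms of `f` whose `M_S`-weight is
`⪯_{Ψ_S}`-minimal. -/
def inM (n : ℕ) (S : List (ℕ × ℕ)) (f : PRing n) : PRing n :=
  ∑ m ∈ f.support.filter fun m => ∀ m' ∈ f.support, psiLE S (MSdot n S m) (MSdot n S m'),
    MvPolynomial.monomial m (f.coeff m)

/-- The initial ideal `In_{M_S}(𝓘_{3,n}) = ⟨In_{M_S}(g) : g ∈ 𝓘_{3,n}, g ≠ 0⟩`. -/
def InIdeal (n : ℕ) (S : List (ℕ × ℕ)) : Ideal (PRing n) :=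
  Ideal.span {g | ∃ f, f ∈ PluckerIdeal n ∧ f ≠ 0 ∧ g = inM n S f}

/-- Evaluation of the `ℤ`-linear functional with coefficients `c` on an exponent
vector (i.e. an element `e ∈ (ℤ^{3(n-3)})^*` given by its coefficients). -/
def evalF (c : ℕ × ℕ → ℤ) (d : (ℕ × ℕ) →₀ ℕ) : ℤ := d.sum fun β m => c β * (m : ℤ)

/-- `v_S(p̄_{I∪j}) + v_S(p̄_{J∖j})`, the `M_S`-weight of the term of `R_{I,J}`
corresponding to `j = J a`. -/
def wvec (n : ℕ) (S : List (ℕ × ℕ)) (I : Fin 2 → ℕ) (J : Fin 4 → ℕ) (a : Fin 4) :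
    (ℕ × ℕ) →₀ ℕ :=
  valS n S (insert3 I (J a)) + valS n S (erase4 J (J a))

/-- A `ℤ`-linear functional `e` (given by its coefficients `c`) *preserves inequalities*
with respect to `S` if for every nonzero Plücker relation `R_{I,J}` and all
`s₁, s₂ ∈ J ∖ I`, `v_S(p̄_{I∪s₁}) + v_S(p̄_{J∖s₁}) ≺_{Ψ_S} v_S(p̄_{I∪s₂}) + v_S(p̄_{J∖s₂})`
implies the corresponding strict inequality of the values of `e`. -/
def PreservesIneq (n : ℕ) (S : List (ℕ × ℕ)) (c : ℕ × ℕ → ℤ) : Prop :=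
  ∀ (I : Fin 2 → ℕ) (J : Fin 4 → ℕ), Sorted 2 n I → Sorted 4 n J → Rrel n I J ≠ 0 →
    ∀ a b : Fin 4, (∀ t : Fin 2, I t ≠ J a) → (∀ t : Fin 2, I t ≠ J b) →
      psiLT S (wvec n S I J a) (wvec n S I J b) →
      evalF c (wvec n S I J a) < evalF c (wvec n S I J b)

end

noncomputable section

/-- The transposition `(i, i+1)` acting on `ℕ`. -/
def tr (i x : ℕ) : ℕ := if x = i then i + 1 else if x = i + 1 then i else x

/-- Sorting a triple. -/
def sort3 (v : Fin 3 → ℕ) : Fin 3 → ℕ :=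
  fun a => (List.insertionSort (· ≤ ·) [v 0, v 1, v 2]).getD a 0

/-- The sign-twisted simple-transposition automorphism of `ℂ[p_K : K ∈ I_{3,6}]`
induced by `s_i = (i, i+1) ∈ S_6` : it sends `p_{(i₁,i₂,i₃)}` to `-p_{(i₁,i₂,i₃)}` if
`(i₁,i₂) = (i,i+1)` or `(i₂,i₃) = (i,i+1)`, and to the Plücker variable indexed by the
sorted tuple `(s_i(i₁), s_i(i₂), s_i(i₃))` otherwise. -/
def sAuto (i : ℕ) : PRing 6 →ₐ[ℂ] PRing 6 :=
  MvPolynomial.aeval fun K : MI 6 =>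
    if (K.val 0 = i ∧ K.val 1 = i + 1) ∨ (K.val 1 = i ∧ K.val 2 = i + 1)
    then -(MvPolynomial.X K)
    else pvar 6 (sort3 fun a => tr i (K.val a))

/-- One step of the action of the generators `s_1, …, s_5` of `G ≤ Aut(𝓘_{3,6})` on
ideals. Its equivalence closure is the orbit equivalence relation of `G`. -/
def StepRel (A B : Ideal (PRing 6)) : Prop :=
  ∃ i, 1 ≤ i ∧ i ≤ 5 ∧ B = Ideal.map (sAuto i).toRingHom A

/-- `𝕀_{3,6}`, the set of initial ideals arising from iterated sequences. -/
def II36 : Set (Ideal (PRing 6)) := {X | ∃ S, IsIter 6 S ∧ X = InIdeal 6 S}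

end

section InitialIdeals

variable {σ : Type*}

open scoped Classical in
/-- The sum of the terms of `f` whose exponent is `le`-below all exponents of `f`. -/
noncomputable def topPart (le : (σ →₀ ℕ) → (σ →₀ ℕ) → Prop) (f : MvPolynomial σ ℂ) :
    MvPolynomial σ ℂ :=
  ∑ m ∈ f.support.filter fun m => ∀ m' ∈ f.support, le m m',
    MvPolynomial.monomial m (f.coeff m)

/-- The initial ideal of `I` with respect to the relation `le` on exponents. -/
noncomputable def InI (le : (σ →₀ ℕ) → (σ →₀ ℕ) → Prop) (I : Ideal (MvPolynomial σ ℂ)) :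
    Ideal (MvPolynomial σ ℂ) :=
  Ideal.span {g | ∃ f, f ∈ I ∧ f ≠ 0 ∧ g = topPart le f}

theorem topPart_mem {le : (σ →₀ ℕ) → (σ →₀ ℕ) → Prop} {I : Ideal (MvPolynomial σ ℂ)}
    {f : MvPolynomial σ ℂ} (hf : f ∈ I) : topPart le f ∈ InI le I := by
  by_cases h : f = 0
  · subst h; simp [topPart]
  · exact Ideal.subset_span ⟨f, hf, h, rfl⟩

open scoped Classical in
theorem coeff_topPart (le : (σ →₀ ℕ) → (σ →₀ ℕ) → Prop) (f : MvPolynomial σ ℂ) (m : σ →₀ ℕ) :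
    (topPart le f).coeff m =
      if m ∈ f.support ∧ ∀ m' ∈ f.support, le m m' then f.coeff m else 0 := by
  rw [topPart, coeff_sum]
  simp only [coeff_monomial]
  rw [Finset.sum_ite_eq']
  simp only [Finset.mem_filter]

variable {M : Type*} [AddCommMonoid M] (d : σ → M)

/-- Homogeneity with respect to the grading by weights `d`. -/
def IsHom (f : MvPolynomial σ ℂ) : Prop :=
  ∀ m ∈ f.support, ∀ m' ∈ f.support, Finsupp.weight d m = Finsupp.weight d m'

theorem component_mem_span {s : Set (MvPolynomial σ ℂ)} (hs : ∀ f ∈ s, IsHom d f)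
    {F : MvPolynomial σ ℂ} (hF : F ∈ Ideal.span s) (δ : M) :
    weightedHomogeneousComponent d δ F ∈ Ideal.span s := by
  classical
  let := weightedGradedAlgebra ℂ d
  have hom : (Ideal.span s).IsHomogeneous (weightedHomogeneousSubmodule ℂ d) := by
    apply Ideal.homogeneous_span
    intro f hf
    by_cases h0 : f = 0
    · exact ⟨0, h0 ▸ Submodule.zero_mem _⟩
    obtain ⟨m, hm⟩ := (support_nonempty (p := f)).2 h0
    refine ⟨Finsupp.weight d m, ?_⟩
    rw [mem_weightedHomogeneousSubmodule]
    intro m' hm'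
    exact hs f hf m' (mem_support_iff.2 hm') m hm
  have := hom δ hF
  rwa [← weightedDecomposition.decompose'_apply]

/-- Initial ideals of homogeneous ideals only see the restriction of the order to exponents
of equal degree. -/
theorem InI_eq_span_hom {le : (σ →₀ ℕ) → (σ →₀ ℕ) → Prop}
    (htrans : ∀ a b c, le a b → le b c → le a c) {s : Set (MvPolynomial σ ℂ)}
    (hs : ∀ f ∈ s, IsHom d f) :
    InI le (Ideal.span s) =
      Ideal.span {g | ∃ f, f ∈ Ideal.span s ∧ IsHom d f ∧ g = topPart le f} := by
  classical
  apply le_antisymm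
  · apply Ideal.span_le.2
    rintro _ ⟨f, hf, -, rfl⟩
    have hc : ∀ δ m, coeff m (weightedHomogeneousComponent d δ f) =
        if Finsupp.weight d m = δ then coeff m f else 0 :=
      fun δ m => coeff_weightedHomogeneousComponent _ _ _
    set top := f.support.filter fun m => ∀ m' ∈ f.support, le m m'
    have key : topPart le f = ∑ δ ∈ top.image (Finsupp.weight d),
        topPart le (weightedHomogeneousComponent d δ f) := by
      ext m
      rw [coeff_sum]
      by_cases hm : m ∈ top
      · have hm' := Finset.mem_filter.1 hm
        rw [Finset.sum_eq_single (Finsupp.weight d m)]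
        · simp only [coeff_topPart, mem_support_iff, hc, if_true]
          rw [if_pos, if_pos]
          · refine ⟨mem_support_iff.1 hm'.1, fun m' h => ?_⟩
            split_ifs at h with h1
            · exact hm'.2 m' (mem_support_iff.2 h)
            · exact absurd rfl h
          · exact ⟨mem_support_iff.1 hm'.1, fun m' h => hm'.2 m' (mem_support_iff.2 h)⟩
        · intro δ _ hδ
          rw [coeff_topPart, if_neg]
          simp [hc, hδ.symm]
        · intro h
          exact absurd (Finset.mem_image_of_mem _ hm) h
      · rw [coeff_topPart, if_neg (by simpa [top] using hm), Finset.sum_eq_zero]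
        intro δ hδ
        obtain ⟨m0, hm0, rfl⟩ := Finset.mem_image.1 hδ
        rw [coeff_topPart, if_neg]
        rintro ⟨h1, h2⟩
        have hm0' := Finset.mem_filter.1 hm0
        apply hm
        rw [mem_support_iff, hc] at h1
        split_ifs at h1 with h3
        · refine Finset.mem_filter.2 ⟨mem_support_iff.2 h1, fun m' h => ?_⟩
          refine htrans _ m0 _ (h2 m0 ?_) (hm0'.2 m' h)
          rw [mem_support_iff, hc, if_pos rfl]
          exact mem_support_iff.1 hm0'.1
        · exact absurd rfl h1
    rw [key]
    refine Ideal.sum_mem _ fun δ _ => Ideal.subset_span ⟨_, component_mem_span d hs hf δ, ?_, rfl⟩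
    intro m hm m' hm'
    rw [mem_support_iff, hc] at hm hm'
    split_ifs at hm hm' with h1 h2
    · rw [h1, h2]
    all_goals exact absurd rfl (by assumption)
  · apply Ideal.span_le.2
    rintro _ ⟨f, hf, -, rfl⟩
    exact topPart_mem hf

theorem topPart_congr {le le' : (σ →₀ ℕ) → (σ →₀ ℕ) → Prop}
    (h : ∀ m m', Finsupp.weight d m = Finsupp.weight d m' → (le m m' ↔ le' m m'))
    {f : MvPolynomial σ ℂ} (hf : IsHom d f) : topPart le f = topPart le' f := by
  classical
  ext m
  rw [coeff_topPart, coeff_topPart]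
  congr 1
  refine propext (and_congr_right fun hm => forall₂_congr fun m' hm' => h m m' (hf m hm m' hm'))

theorem InI_congr {le le' : (σ →₀ ℕ) → (σ →₀ ℕ) → Prop}
    (htrans : ∀ a b c, le a b → le b c → le a c)
    (htrans' : ∀ a b c, le' a b → le' b c → le' a c) {s : Set (MvPolynomial σ ℂ)}
    (hs : ∀ f ∈ s, IsHom d f)
    (h : ∀ m m', Finsupp.weight d m = Finsupp.weight d m' → (le m m' ↔ le' m m')) :
    InI le (Ideal.span s) = InI le' (Ideal.span s) := by
  rw [InI_eq_span_hom d htrans hs, InI_eq_span_hom d htrans' hs]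
  congr 1
  ext g
  constructor
  · rintro ⟨f, hf, hh, rfl⟩
    exact ⟨f, hf, hh, topPart_congr d h hh⟩
  · rintro ⟨f, hf, hh, rfl⟩
    exact ⟨f, hf, hh, (topPart_congr d h hh).symm⟩

end InitialIdeals

theorem InIdeal_eq_InI (S : List (ℕ × ℕ)) :
    InIdeal 6 S = InI (fun m m' => psiLE S (MSdot 6 S m) (MSdot 6 S m')) (PluckerIdeal 6) := rfl

section Alternating

/-- The sign of `y - x`. -/
def sg (x y : ℕ) : ℤ := if x < y then 1 else if y < x then -1 else 0

theorem sg_swap (x y : ℕ) : sg y x = -sg x y := by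
  unfold sg; split_ifs <;> omega

theorem sg_of_lt {x y : ℕ} (h : x < y) : sg x y = 1 := by simp [sg, h]

theorem sg_of_gt {x y : ℕ} (h : y < x) : sg x y = -1 := by simp [sg, h, h.not_gt]

theorem sg_self (x : ℕ) : sg x x = 0 := by simp [sg]

theorem sg_sq {x y : ℕ} (h : x ≠ y) : sg x y * sg x y = 1 := by
  unfold sg; split_ifs <;> omega

theorem sort3_perm {v w : Fin 3 → ℕ} (h : [v 0, v 1, v 2].Perm [w 0, w 1, w 2]) :
    sort3 v = sort3 w := by
  have : List.insertionSort (· ≤ ·) [v 0, v 1, v 2] = List.insertionSort (· ≤ ·) [w 0, w 1, w 2] :=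
    List.Perm.eq_of_pairwise' (List.pairwise_insertionSort _ _) (List.pairwise_insertionSort _ _)
      ((List.perm_insertionSort _ _).trans (h.trans (List.perm_insertionSort _ _).symm))
  funext a
  simp only [sort3, this]

theorem sort3_of_lt {a b c : ℕ} (h1 : a < b) (h2 : b < c) : sort3 ![a, b, c] = ![a, b, c] := by
  have : List.insertionSort (· ≤ ·) [a, b, c] = [a, b, c] := by
    apply List.Pairwise.insertionSort_eq
    simp; omega
  funext i
  simp only [sort3]
  change (List.insertionSort (· ≤ ·) [a, b, c]).getD i 0 = _
  rw [this]
  fin_cases i <;> rfl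

theorem sorted3_iff (n a b c : ℕ) : Sorted 3 n ![a, b, c] ↔ a < b ∧ b < c ∧ 1 ≤ a ∧ c ≤ n := by
  unfold Sorted
  rw [Fin.strictMono_iff_lt_succ]
  simp [Fin.forall_fin_succ]
  omega

theorem eq_vec3 (K : Fin 3 → ℕ) : K = ![K 0, K 1, K 2] := by
  funext i; fin_cases i <;> rfl

/-- The alternating Plücker coordinate with arbitrary indices. -/
noncomputable def P (a b c : ℕ) : PRing 6 :=
  ((sg a b * sg a c * sg b c : ℤ) : PRing 6) * pvar 6 (sort3 ![a, b, c])

theorem P_swap12 (a b c : ℕ) : P b a c = -P a b c := by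
  have : sort3 ![b, a, c] = sort3 ![a, b, c] := sort3_perm (List.Perm.swap _ _ _)
  simp only [P, this, sg_swap a b]
  push_cast; ring

theorem P_swap23 (a b c : ℕ) : P a c b = -P a b c := by
  have : sort3 ![a, c, b] = sort3 ![a, b, c] := sort3_perm ((List.Perm.swap _ _ _).cons _)
  simp only [P, this, sg_swap b c]
  push_cast; ring

theorem P_self12 (a c : ℕ) : P a a c = 0 := by simp [P, sg_self]
theorem P_self13 (a c : ℕ) : P a c a = 0 := by simp [P, sg_self]
theorem P_self23 (a c : ℕ) : P c a a = 0 := by simp [P, sg_self]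

theorem P_of_lt {a b c : ℕ} (h1 : a < b) (h2 : b < c) : P a b c = pvar 6 ![a, b, c] := by
  simp [P, sg_of_lt h1, sg_of_lt h2, sg_of_lt (h1.trans h2), sort3_of_lt h1 h2]

theorem pvar_coe {n : ℕ} (K : MI n) : pvar n K.val = X K := by
  simp only [pvar, dif_pos K.2]

theorem MI.lt01 {n : ℕ} (K : MI n) : K.val 0 < K.val 1 := K.2.1 (by decide)
theorem MI.lt12 {n : ℕ} (K : MI n) : K.val 1 < K.val 2 := K.2.1 (by decide)

theorem P_MI (K : MI 6) : P (K.val 0) (K.val 1) (K.val 2) = X K := by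
  rw [P_of_lt K.lt01 K.lt12, ← pvar_coe, ← eq_vec3]

theorem pvar_not_sorted {n : ℕ} {K : Fin 3 → ℕ} (h : ¬ Sorted 3 n K) : pvar n K = 0 := by
  simp only [pvar, dif_neg h]

theorem pvar_sort3 (a b c : ℕ) :
    pvar 6 (sort3 ![a, b, c]) = ((sg a b * sg a c * sg b c : ℤ) : PRing 6) * P a b c := by
  by_cases hd : a ≠ b ∧ a ≠ c ∧ b ≠ c
  · obtain ⟨h1, h2, h3⟩ := hd
    rw [P, ← mul_assoc, ← Int.cast_mul]
    have : sg a b * sg a c * sg b c * (sg a b * sg a c * sg b c) =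
        (sg a b * sg a b) * (sg a c * sg a c) * (sg b c * sg b c) := by ring
    rw [this, sg_sq h1, sg_sq h2, sg_sq h3]
    simp
  · rw [pvar_not_sorted]
    · have : sg a b * sg a c * sg b c = 0 := by
        by_contra h
        apply hd
        refine ⟨?_, ?_, ?_⟩ <;> rintro rfl <;> simp [sg_self] at h
      rw [this]; simp
    · rintro ⟨h1, -⟩
      have hp := List.perm_insertionSort (· ≤ ·) [a, b, c]
      have hnd : (List.insertionSort (· ≤ ·) [a, b, c]).Nodup := by
        have hlen : (List.insertionSort (· ≤ ·) [a, b, c]).length = 3 := by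
          rw [List.length_insertionSort]; rfl
        rw [List.nodup_iff_injective_get]
        intro i j hij
        have e : ∀ i : Fin (List.insertionSort (· ≤ ·) [a, b, c]).length,
            (List.insertionSort (· ≤ ·) [a, b, c]).get i =
              sort3 ![a, b, c] (Fin.cast hlen i) := by
          intro i
          change _ = (List.insertionSort (· ≤ ·) [a, b, c]).getD i 0
          rw [List.getD_eq_getElem _ _ i.2]; rfl
        rw [e, e] at hij
        exact Fin.cast_injective _ (h1.injective hij)
      rw [hp.nodup_iff] at hnd
      simp at hnd
      tauto

/-- The quadratic Plücker relation with arbitrary indices. -/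
noncomputable def Ralt (b c d e f g : ℕ) : PRing 6 :=
  P b c d * P e f g - P b c e * P d f g + P b c f * P d e g - P b c g * P d e f

theorem Rrel_eq_neg_Ralt {I : Fin 2 → ℕ} {J : Fin 4 → ℕ} (hI : Sorted 2 6 I) (hJ : Sorted 4 6 J) :
    Rrel 6 I J = -Ralt (I 0) (I 1) (J 0) (J 1) (J 2) (J 3) := by
  have hI' : I 0 < I 1 := hI.1 (by decide)
  have h01 : J 0 < J 1 := hJ.1 (by decide)
  have h12 : J 1 < J 2 := hJ.1 (by decide)
  have h23 : J 2 < J 3 := hJ.1 (by decide)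
  have key : ∀ j, (-1 : PRing 6) ^ (Finset.univ.filter fun b : Fin 2 => I b < j).card *
      pvar 6 (insert3 I j) = P (I 0) (I 1) j := by
    intro j
    change _ * pvar 6 (sort3 ![I 0, I 1, j]) = _
    rw [pvar_sort3, sg_of_lt hI']
    by_cases h0 : I 0 = j
    · subst h0; simp [P_self13]
    by_cases h1 : I 1 = j
    · subst h1; simp [P_self23]
    have hc : (Finset.univ.filter fun b : Fin 2 => I b < j).card =
        (if I 0 < j then 1 else 0) + (if I 1 < j then 1 else 0) := by
      rw [Finset.card_filter, Fin.sum_univ_two]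
    rw [hc]
    rcases lt_or_gt_of_ne h0 with a0 | a0 <;> rcases lt_or_gt_of_ne h1 with a1 | a1
    · simp [a0, a1, sg_of_lt]
    · simp [a0, a1.not_gt, sg_of_lt, sg_of_gt a1]
    · omega
    · simp [a0.not_gt, a1.not_gt, sg_of_gt a1, sg_of_gt a0]
  have hcard : ∀ a : Fin 4, (Finset.univ.filter fun b : Fin 4 => J a < J b).card = 3 - a.val := by
    intro a
    have : (Finset.univ.filter fun b : Fin 4 => J a < J b) = Finset.univ.filter fun b => a < b := by
      ext b; simp [hJ.1.lt_iff_lt]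
    rw [this]; clear this; revert a; decide
  have he0 : erase4 J (J 0) = ![J 1, J 2, J 3] := by
    funext i; simp only [erase4]
    rw [List.erase_cons_head]; fin_cases i <;> rfl
  have he1 : erase4 J (J 1) = ![J 0, J 2, J 3] := by
    funext i; simp only [erase4]
    rw [List.erase_cons_tail (by simp; omega), List.erase_cons_head]; fin_cases i <;> rfl
  have he2 : erase4 J (J 2) = ![J 0, J 1, J 3] := by
    funext i; simp only [erase4]
    rw [List.erase_cons_tail (by simp; omega), List.erase_cons_tail (by simp; omega),
      List.erase_cons_head]; fin_cases i <;> rfl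
  have he3 : erase4 J (J 3) = ![J 0, J 1, J 2] := by
    funext i; simp only [erase4]
    rw [List.erase_cons_tail (by simp; omega), List.erase_cons_tail (by simp; omega),
      List.erase_cons_tail (by simp; omega), List.erase_cons_head]; fin_cases i <;> rfl
  have expand : ∀ a : Fin 4,
      (-1 : PRing 6) ^ ((Finset.univ.filter fun b : Fin 2 => I b < J a).card +
        (Finset.univ.filter fun b : Fin 4 => J a < J b).card) *
      (pvar 6 (insert3 I (J a)) * pvar 6 (erase4 J (J a))) =
      (-1) ^ (3 - a.val) * (P (I 0) (I 1) (J a) * pvar 6 (erase4 J (J a))) := by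
    intro a
    rw [← key, hcard, pow_add]; ring
  unfold Rrel
  simp only [expand, Fin.sum_univ_four, he0, he1, he2, he3, Ralt]
  rw [P_of_lt h01 h12, P_of_lt h12 h23, P_of_lt h01 (h12.trans h23), P_of_lt (h01.trans h12) h23]
  norm_num
  ring

theorem Ralt_swap_bc (b c d e f g : ℕ) : Ralt c b d e f g = -Ralt b c d e f g := by
  simp only [Ralt, P_swap12 b c]; ring
theorem Ralt_swap_de (b c d e f g : ℕ) : Ralt b c e d f g = -Ralt b c d e f g := by
  simp only [Ralt, P_swap12 d e]; ring
theorem Ralt_swap_ef (b c d e f g : ℕ) : Ralt b c d f e g = -Ralt b c d e f g := by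
  simp only [Ralt, P_swap12 e f, P_swap23 d e f]; ring
theorem Ralt_swap_fg (b c d e f g : ℕ) : Ralt b c d e g f = -Ralt b c d e f g := by
  simp only [Ralt, P_swap23 _ f g]; ring

theorem forall_distinct_of_sorted {Q : ℕ → ℕ → ℕ → ℕ → Prop}
    (s1 : ∀ a b c d, Q b a c d → Q a b c d) (s2 : ∀ a b c d, Q a c b d → Q a b c d)
    (s3 : ∀ a b c d, Q a b d c → Q a b c d) {r : ℕ → Prop}
    (h : ∀ a b c d, r a → r b → r c → r d → a < b → b < c → c < d → Q a b c d) :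
    ∀ a b c d, r a → r b → r c → r d → a ≠ b → a ≠ c → a ≠ d → b ≠ c → b ≠ d → c ≠ d →
      Q a b c d := by
  have h3 : ∀ a b c d, r a → r b → r c → r d → a < b → b < c → a ≠ d → b ≠ d → c ≠ d →
      Q a b c d := by
    intro a b c d ra rb rc rd h1 h2 n1 n2 n3
    rcases lt_or_gt_of_ne n3 with l3 | l3
    · exact h _ _ _ _ ra rb rc rd h1 h2 l3
    apply s3
    rcases lt_or_gt_of_ne n2 with l2 | l2
    · exact h _ _ _ _ ra rb rd rc h1 l2 l3
    apply s2
    rcases lt_or_gt_of_ne n1 with l1 | l1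
    · exact h _ _ _ _ ra rd rb rc l1 l2 h2
    apply s1
    exact h _ _ _ _ rd ra rb rc l1 h1 h2
  have h2 : ∀ a b c d, r a → r b → r c → r d → a < b → a ≠ c → b ≠ c → a ≠ d → b ≠ d → c ≠ d →
      Q a b c d := by
    intro a b c d ra rb rc rd h1 n1 n2 n3 n4 n5
    rcases lt_or_gt_of_ne n2 with l2 | l2
    · exact h3 _ _ _ _ ra rb rc rd h1 l2 n3 n4 n5
    apply s2
    rcases lt_or_gt_of_ne n1 with l1 | l1
    · exact h3 _ _ _ _ ra rc rb rd l1 l2 n3 n5 n4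
    apply s1
    exact h3 _ _ _ _ rc ra rb rd l1 h1 n5 n3 n4
  intro a b c d ra rb rc rd n1 n2 n3 n4 n5 n6
  rcases lt_or_gt_of_ne n1 with l1 | l1
  · exact h2 _ _ _ _ ra rb rc rd l1 n2 n4 n3 n5 n6
  · apply s1; exact h2 _ _ _ _ rb ra rc rd l1 n4 n2 n5 n3 n6

theorem Ralt_mem {b c d e f g : ℕ} (hb : 1 ≤ b ∧ b ≤ 6) (hc : 1 ≤ c ∧ c ≤ 6) (hd : 1 ≤ d ∧ d ≤ 6)
    (he : 1 ≤ e ∧ e ≤ 6) (hf : 1 ≤ f ∧ f ≤ 6) (hg : 1 ≤ g ∧ g ≤ 6) (hbc : b ≠ c)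
    (h1 : d ≠ e) (h2 : d ≠ f) (h3 : d ≠ g) (h4 : e ≠ f) (h5 : e ≠ g) (h6 : f ≠ g) :
    Ralt b c d e f g ∈ PluckerIdeal 6 := by
  have base : ∀ b c, b < c → (1 ≤ b ∧ b ≤ 6) → (1 ≤ c ∧ c ≤ 6) →
      Ralt b c d e f g ∈ PluckerIdeal 6 := by
    intro b c hlt hb hc
    refine forall_distinct_of_sorted (Q := fun d e f g => Ralt b c d e f g ∈ PluckerIdeal 6)
      (r := fun x => 1 ≤ x ∧ x ≤ 6) ?_ ?_ ?_ ?_ d e f g hd he hf hg h1 h2 h3 h4 h5 h6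
    · intro x y z w h; rw [Ralt_swap_de]; exact neg_mem h
    · intro x y z w h; rw [Ralt_swap_ef]; exact neg_mem h
    · intro x y z w h; rw [Ralt_swap_fg]; exact neg_mem h
    · intro x y z w hx hy hz hw l1 l2 l3
      rw [← neg_mem_iff]
      refine Ideal.subset_span ⟨![b, c], ![x, y, z, w], ?_, ?_, ?_⟩
      · refine ⟨Fin.strictMono_iff_lt_succ.2 ?_, ?_⟩ <;> simp [Fin.forall_fin_succ] <;> omega
      · refine ⟨Fin.strictMono_iff_lt_succ.2 ?_, ?_⟩ <;> simp [Fin.forall_fin_succ] <;> omega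
      · rw [Rrel_eq_neg_Ralt]
        · rfl
        · refine ⟨Fin.strictMono_iff_lt_succ.2 ?_, ?_⟩ <;> simp [Fin.forall_fin_succ] <;> omega
        · refine ⟨Fin.strictMono_iff_lt_succ.2 ?_, ?_⟩ <;> simp [Fin.forall_fin_succ] <;> omega
  rcases lt_or_gt_of_ne hbc with h | h
  · exact base _ _ h hb hc
  · rw [Ralt_swap_bc]; exact neg_mem (base _ _ h hc hb)

end Alternating

section Transport

variable {σ : Type*}

theorem coeff_of_monomial_map {φ : MvPolynomial σ ℂ →ₐ[ℂ] MvPolynomial σ ℂ}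
    {π : (σ →₀ ℕ) → (σ →₀ ℕ)} (hπ : Function.Injective π) {u : (σ →₀ ℕ) → ℂ}
    (hφ : ∀ m c, φ (monomial m c) = monomial (π m) (u m * c)) (f : MvPolynomial σ ℂ)
    (m : σ →₀ ℕ) : coeff (π m) (φ f) = u m * coeff m f := by
  classical
  induction f using MvPolynomial.induction_on' with
  | monomial m' c =>
    rw [hφ, coeff_monomial, coeff_monomial]
    by_cases h : m' = m
    · subst h; simp
    · rw [if_neg h, if_neg fun e => h (hπ e), mul_zero]
  | add p q hp hq => rw [map_add, coeff_add, coeff_add, hp, hq, mul_add]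

theorem map_topPart {φ : MvPolynomial σ ℂ →ₐ[ℂ] MvPolynomial σ ℂ}
    {π : (σ →₀ ℕ) → (σ →₀ ℕ)} (hπ : Function.Bijective π) {u : (σ →₀ ℕ) → ℂ}
    (hu : ∀ m, u m ≠ 0) (hφ : ∀ m c, φ (monomial m c) = monomial (π m) (u m * c))
    {le le' : (σ →₀ ℕ) → (σ →₀ ℕ) → Prop} (hle : ∀ m m', le m m' ↔ le' (π m) (π m'))
    (f : MvPolynomial σ ℂ) : φ (topPart le f) = topPart le' (φ f) := by
  classical
  have hs : ∀ m, π m ∈ (φ f).support ↔ m ∈ f.support := by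
    intro m
    rw [mem_support_iff, mem_support_iff, coeff_of_monomial_map hπ.1 hφ, mul_ne_zero_iff]
    exact and_iff_right (hu m)
  ext n
  obtain ⟨m, rfl⟩ := hπ.2 n
  rw [coeff_of_monomial_map hπ.1 hφ, coeff_topPart, coeff_topPart,
    coeff_of_monomial_map hπ.1 hφ, mul_ite, mul_zero]
  refine if_congr (and_congr (hs m).symm ?_) rfl rfl
  rw [hπ.2.forall (p := fun m' => m' ∈ (φ f).support → le' (π m) m')]
  exact forall_congr' fun m' => imp_congr (hs m').symm (hle m m')

theorem map_InI_le {φ : MvPolynomial σ ℂ →ₐ[ℂ] MvPolynomial σ ℂ}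
    {π : (σ →₀ ℕ) → (σ →₀ ℕ)} (hπ : Function.Bijective π) {u : (σ →₀ ℕ) → ℂ}
    (hu : ∀ m, u m ≠ 0) (hφ : ∀ m c, φ (monomial m c) = monomial (π m) (u m * c))
    {le le' : (σ →₀ ℕ) → (σ →₀ ℕ) → Prop} (hle : ∀ m m', le m m' ↔ le' (π m) (π m'))
    {I : Ideal (MvPolynomial σ ℂ)} (hI : ∀ f ∈ I, φ f ∈ I) :
    Ideal.map φ.toRingHom (InI le I) ≤ InI le' I := by
  rw [Ideal.map_le_iff_le_comap]
  apply Ideal.span_le.2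
  rintro _ ⟨f, hf, -, rfl⟩
  change φ (topPart le f) ∈ InI le' I
  rw [map_topPart hπ hu hφ hle]
  exact topPart_mem (hI f hf)

end Transport

section Generators

theorem MI.range {n : ℕ} (K : MI n) : 1 ≤ K.val 0 ∧ K.val 2 ≤ n := ⟨(K.2.2 0).1, (K.2.2 2).2⟩

theorem MI.ext3 {n : ℕ} {K L : MI n} (h0 : K.val 0 = L.val 0) (h1 : K.val 1 = L.val 1)
    (h2 : K.val 2 = L.val 2) : K = L := by
  apply Subtype.ext
  funext i; fin_cases i <;> assumption

/-- The elements of `I_{3,6}`, listed in the order used for the standard monomials below. -/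
def tripL : List (ℕ × ℕ × ℕ) :=
  [(1, 3, 5), (3, 4, 5), (1, 2, 3), (1, 2, 4), (1, 4, 6), (2, 4, 6), (1, 5, 6), (1, 2, 5),
    (1, 4, 5), (1, 3, 6), (1, 3, 4), (2, 3, 6), (4, 5, 6), (1, 2, 6), (3, 5, 6), (2, 3, 5),
    (2, 4, 5), (2, 5, 6), (3, 4, 6), (2, 3, 4)]

theorem mem_tripL : ∀ a b c : Fin 7, 1 ≤ a → a < b → b < c → (a.val, b.val, c.val) ∈ tripL := by
  decide +kernel

theorem MI.mem_tripL (K : MI 6) : (K.val 0, K.val 1, K.val 2) ∈ tripL := by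
  have h := K.range
  have h1 := K.lt01
  have h2 := K.lt12
  exact _root_.mem_tripL ⟨K.val 0, by omega⟩ ⟨K.val 1, by omega⟩ ⟨K.val 2, by omega⟩
    (Fin.mk_le_mk.2 h.1) (Fin.mk_lt_mk.2 h1) (Fin.mk_lt_mk.2 h2)

/-- To check a statement about all triples it suffices to check the elements of `tripL`. -/
theorem MI.forall_of (Q : ℕ × ℕ × ℕ → Prop) (h : ∀ t ∈ tripL, Q t) (K : MI 6) :
    Q (K.val 0, K.val 1, K.val 2) :=
  h _ K.mem_tripL

theorem tr_involutive (i x : ℕ) : tr i (tr i x) = x := by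
  unfold tr; split_ifs <;> omega

theorem tr_injective (i : ℕ) : Function.Injective (tr i) :=
  (show Function.Involutive (tr i) from tr_involutive i).injective

theorem tr_range {i x : ℕ} (h1 : 1 ≤ i) (h5 : i ≤ 5) (hx : 1 ≤ x ∧ x ≤ 6) :
    1 ≤ tr i x ∧ tr i x ≤ 6 := by
  unfold tr; split_ifs <;> omega

/-- The sorted image of a triple under the transposition `(i, i+1)`. -/
def trS (i : ℕ) (t : ℕ × ℕ × ℕ) : ℕ × ℕ × ℕ :=
  if (t.1 = i ∧ t.2.1 = i + 1) ∨ (t.2.1 = i ∧ t.2.2 = i + 1) then t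
  else (tr i t.1, tr i t.2.1, tr i t.2.2)

theorem trS_facts : ∀ i ∈ List.range' 1 5, ∀ t ∈ tripL,
    (1 ≤ (trS i t).1 ∧ (trS i t).1 < (trS i t).2.1 ∧ (trS i t).2.1 < (trS i t).2.2 ∧
      (trS i t).2.2 ≤ 6) ∧ trS i (trS i t) = t := by
  decide +kernel

theorem tr_comp_eq (i : ℕ) (K : MI 6) :
    (fun a => tr i (K.val a)) = ![tr i (K.val 0), tr i (K.val 1), tr i (K.val 2)] := by
  funext a; fin_cases a <;> rfl

theorem mem_range'_of {i : ℕ} (h1 : 1 ≤ i) (h5 : i ≤ 5) : i ∈ List.range' 1 5 := by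
  rw [List.mem_range'_1]; omega

/-- The action of the transposition `(i, i+1)` on triples. -/
noncomputable def trK (i : ℕ) (h1 : 1 ≤ i) (h5 : i ≤ 5) (K : MI 6) : MI 6 :=
  ⟨![(trS i (K.val 0, K.val 1, K.val 2)).1, (trS i (K.val 0, K.val 1, K.val 2)).2.1,
    (trS i (K.val 0, K.val 1, K.val 2)).2.2], by
    have h := (MI.forall_of _ (trS_facts i (mem_range'_of h1 h5)) K).1
    rw [sorted3_iff]
    tauto⟩

theorem trK_involutive {i : ℕ} (h1 : 1 ≤ i) (h5 : i ≤ 5) :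
    Function.Involutive (trK i h1 h5) := by
  intro K
  have h := (MI.forall_of _ (trS_facts i (mem_range'_of h1 h5)) K).2
  simp only [Prod.ext_iff] at h
  exact MI.ext3 h.1 h.2.1 h.2.2

/-- The sign in the action of `s_i` on the Plücker variable `p_K`. -/
def trSign (i : ℕ) (K : MI 6) : ℤ :=
  if (K.val 0 = i ∧ K.val 1 = i + 1) ∨ (K.val 1 = i ∧ K.val 2 = i + 1) then -1 else 1

theorem sAuto_X {i : ℕ} (h1 : 1 ≤ i) (h5 : i ≤ 5) (K : MI 6) :
    sAuto i (X K) = C (trSign i K : ℂ) * X (trK i h1 h5 K) := by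
  have h01 := K.lt01
  have h12 := K.lt12
  rw [sAuto, aeval_X, trSign]
  split_ifs with h
  · have : trK i h1 h5 K = K := by
      apply MI.ext3 <;> simp [trK, trS, h]
    rw [this]
    simp
  · have l1 : tr i (K.val 0) < tr i (K.val 1) := by unfold tr; split_ifs <;> omega
    have l2 : tr i (K.val 1) < tr i (K.val 2) := by unfold tr; split_ifs <;> omega
    rw [tr_comp_eq, sort3_of_lt l1 l2, ← pvar_coe]
    simp [trK, trS, h]

theorem sAuto_monomial {i : ℕ} (h1 : 1 ≤ i) (h5 : i ≤ 5) (m : MI 6 →₀ ℕ) (c : ℂ) :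
    sAuto i (monomial m c) = monomial (m.mapDomain (trK i h1 h5))
      ((m.prod fun K e => (trSign i K : ℂ) ^ e) * c) := by
  rw [monomial_eq, map_mul, ← algebraMap_eq, AlgHom.commutes, algebraMap_eq, Finsupp.prod,
    map_prod]
  simp only [map_pow, sAuto_X h1 h5, mul_pow]
  rw [Finset.prod_mul_distrib, monomial_eq, Finsupp.prod_mapDomain_index_inj
    (trK_involutive h1 h5).injective, C_mul, Finsupp.prod, Finsupp.prod, map_prod]
  simp only [map_pow]
  ring

theorem trSign_prod_ne_zero (i : ℕ) (m : MI 6 →₀ ℕ) :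
    (m.prod fun K e => (trSign i K : ℂ) ^ e) ≠ 0 := by
  rw [Finsupp.prod, Finset.prod_ne_zero_iff]
  intro K _
  apply pow_ne_zero
  unfold trSign
  split_ifs <;> simp

theorem mapDomain_trK_involutive {i : ℕ} (h1 : 1 ≤ i) (h5 : i ≤ 5) :
    Function.Involutive (Finsupp.mapDomain (M := ℕ) (trK i h1 h5)) := by
  intro m
  rw [← Finsupp.mapDomain_comp, (trK_involutive h1 h5).comp_self, Finsupp.mapDomain_id]

theorem sAuto_P {i : ℕ} (h1 : 1 ≤ i) (h5 : i ≤ 5) (a b c : ℕ) :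
    sAuto i (P a b c) = P (tr i a) (tr i b) (tr i c) := by
  have base : ∀ a b c, a < b → b < c → sAuto i (P a b c) = P (tr i a) (tr i b) (tr i c) := by
    intro a b c hab hbc
    rw [P_of_lt hab hbc]
    by_cases hS : Sorted 3 6 ![a, b, c]
    · have hS' := (sorted3_iff _ _ _ _).1 hS
      rw [pvar, dif_pos hS, sAuto, aeval_X]
      split_ifs with h
      · simp only [Matrix.cons_val] at h
        have : X (⟨![a, b, c], hS⟩ : MI 6) = P a b c := by
          rw [P_of_lt hab hbc, pvar, dif_pos hS]
        rw [this]
        rcases h with ⟨rfl, rfl⟩ | ⟨rfl, rfl⟩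
        · rw [← P_swap12]
          congr 1 <;> unfold tr <;> split_ifs <;> omega
        · rw [← P_swap23]
          congr 1 <;> unfold tr <;> split_ifs <;> omega
      · simp only [Matrix.cons_val] at h
        have l1 : tr i a < tr i b := by unfold tr; split_ifs <;> omega
        have l2 : tr i b < tr i c := by unfold tr; split_ifs <;> omega
        rw [tr_comp_eq, P_of_lt l1 l2]
        change pvar 6 (sort3 ![tr i a, tr i b, tr i c]) = _
        rw [sort3_of_lt l1 l2]
    · rw [pvar_not_sorted hS, map_zero]
      have : ∀ x, ¬ (1 ≤ x ∧ x ≤ 6) → ¬ (1 ≤ tr i x ∧ tr i x ≤ 6) := by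
        intro x hx; unfold tr; split_ifs <;> omega
      have key : ∀ x y z : ℕ, ¬ ((1 ≤ x ∧ x ≤ 6) ∧ (1 ≤ y ∧ y ≤ 6) ∧ (1 ≤ z ∧ z ≤ 6)) →
          P x y z = 0 := by
        intro x y z h
        by_contra hne
        apply h
        unfold P at hne
        have hS : Sorted 3 6 (sort3 ![x, y, z]) := by
          by_contra h'; rw [pvar_not_sorted h'] at hne; simp at hne
        have hmem : ∀ w ∈ [x, y, z], 1 ≤ w ∧ w ≤ 6 := by
          intro w hw
          rw [← (List.perm_insertionSort (· ≤ ·) [x, y, z]).mem_iff, List.mem_iff_getElem] at hw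
          obtain ⟨j, hj, rfl⟩ := hw
          have hj3 : j < 3 := by rw [List.length_insertionSort] at hj; exact hj
          have := hS.2 ⟨j, hj3⟩
          change 1 ≤ (List.insertionSort (· ≤ ·) [x, y, z]).getD j 0 ∧
            (List.insertionSort (· ≤ ·) [x, y, z]).getD j 0 ≤ 6 at this
          rwa [List.getD_eq_getElem _ _ hj] at this
        exact ⟨hmem x (by simp), hmem y (by simp), hmem z (by simp)⟩
      rw [key]
      rw [sorted3_iff] at hS
      intro ⟨ha, hb, hc⟩
      have ha' := not_imp_not.1 (this a) ha
      have hb' := not_imp_not.1 (this b) hb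
      have hc' := not_imp_not.1 (this c) hc
      omega
  rcases lt_trichotomy a b with hab | rfl | hab
  · rcases lt_trichotomy b c with hbc | rfl | hbc
    · exact base _ _ _ hab hbc
    · simp [P_self23]
    · rw [P_swap23 a c b, P_swap23 (tr i a) (tr i c) (tr i b), map_neg]
      rcases lt_trichotomy a c with hac | rfl | hac
      · rw [base _ _ _ hac hbc]
      · simp [P_self12]
      · rw [P_swap12 c a b, P_swap12 (tr i c) (tr i a) (tr i b), map_neg, base _ _ _ hac hab]
  · simp [P_self12]
  · rw [P_swap12 b a c, P_swap12 (tr i b) (tr i a) (tr i c), map_neg]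
    rcases lt_trichotomy a c with hac | rfl | hac
    · rw [base _ _ _ hab hac]
    · simp [P_self23]
    · rw [P_swap23 b c a, P_swap23 (tr i b) (tr i c) (tr i a), map_neg]
      rcases lt_trichotomy b c with hbc | rfl | hbc
      · rw [base _ _ _ hbc hac]
      · simp [P_self12]
      · rw [P_swap12 c b a, P_swap12 (tr i c) (tr i b) (tr i a), map_neg, base _ _ _ hbc hab]

theorem sAuto_mem {i : ℕ} (h1 : 1 ≤ i) (h5 : i ≤ 5) {f : PRing 6} (hf : f ∈ PluckerIdeal 6) :
    sAuto i f ∈ PluckerIdeal 6 := by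
  have : PluckerIdeal 6 ≤ (PluckerIdeal 6).comap (sAuto i) := by
    apply Ideal.span_le.2
    rintro _ ⟨I, J, hI, hJ, rfl⟩
    change sAuto i (Rrel 6 I J) ∈ PluckerIdeal 6
    rw [Rrel_eq_neg_Ralt hI hJ, map_neg, neg_mem_iff]
    have e : sAuto i (Ralt (I 0) (I 1) (J 0) (J 1) (J 2) (J 3)) =
        Ralt (tr i (I 0)) (tr i (I 1)) (tr i (J 0)) (tr i (J 1)) (tr i (J 2)) (tr i (J 3)) := by
      simp only [Ralt, map_sub, map_add, map_mul, sAuto_P h1 h5]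
    rw [e]
    have inj := tr_injective i
    have hn : ∀ a b : Fin 4, a ≠ b → tr i (J a) ≠ tr i (J b) :=
      fun a b hab h => hab (hJ.1.injective (inj h))
    apply Ralt_mem (tr_range h1 h5 (hI.2 0)) (tr_range h1 h5 (hI.2 1)) (tr_range h1 h5 (hJ.2 0))
      (tr_range h1 h5 (hJ.2 1)) (tr_range h1 h5 (hJ.2 2)) (tr_range h1 h5 (hJ.2 3))
    · exact fun h => absurd (hI.1.injective (inj h)) (by decide)
    all_goals exact hn _ _ (by decide)
  exact this hf

theorem sAuto_involutive {i : ℕ} (h1 : 1 ≤ i) (h5 : i ≤ 5) (f : PRing 6) :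
    sAuto i (sAuto i f) = f := by
  have : (sAuto i).comp (sAuto i) = AlgHom.id ℂ _ := by
    apply MvPolynomial.algHom_ext
    intro K
    change sAuto i (sAuto i (X K)) = X K
    rw [← P_MI, sAuto_P h1 h5, sAuto_P h1 h5]
    simp only [tr_involutive]
  exact DFunLike.congr_fun this f

theorem mem_map_sAuto {i : ℕ} (h1 : 1 ≤ i) (h5 : i ≤ 5) (A : Ideal (PRing 6)) (f : PRing 6) :
    f ∈ Ideal.map (sAuto i).toRingHom A ↔ sAuto i f ∈ A := by
  rw [Ideal.mem_map_iff_of_surjective (sAuto i).toRingHom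
    fun f => ⟨sAuto i f, sAuto_involutive h1 h5 f⟩]
  constructor
  · rintro ⟨g, hg, rfl⟩
    exact (sAuto_involutive h1 h5 g).symm ▸ hg
  · intro h
    exact ⟨_, h, sAuto_involutive h1 h5 f⟩

theorem map_sAuto_map {i : ℕ} (h1 : 1 ≤ i) (h5 : i ≤ 5) (A : Ideal (PRing 6)) :
    Ideal.map (sAuto i).toRingHom (Ideal.map (sAuto i).toRingHom A) = A := by
  ext f
  rw [mem_map_sAuto h1 h5, mem_map_sAuto h1 h5, sAuto_involutive h1 h5]

end Generators

section Weights

/-- The labels `(a; j₁, j₂; i₁, i₂; b)` on which an initial ideal depends. For an iterated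
sequence `a = 5`, `b = 6`, and `j₁, j₂`, `i₁, i₂` are the first two entries of the prepended
triples. -/
structure Lab where
  a : ℕ
  j₁ : ℕ
  j₂ : ℕ
  i₁ : ℕ
  i₂ : ℕ
  b : ℕ

/-- Relabelling. -/
def Lab.map (f : ℕ → ℕ) (τ : Lab) : Lab :=
  ⟨f τ.a, f τ.j₁, f τ.j₂, f τ.i₁, f τ.i₂, f τ.b⟩

/-- The weight `(X, Y, U, V)` of a set of indices (given by its characteristic function). -/
def wt (τ : Lab) (p : ℕ → Bool) : ℕ × ℕ × ℕ × ℕ :=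
  let x := p τ.b && !p τ.i₁
  let y := p τ.b && p τ.i₁ && !p τ.i₂
  let dead := p τ.b && p τ.i₁ && p τ.i₂
  let q := fun z => (p z && z != τ.b) || (x && z == τ.i₁) || (y && z == τ.i₂)
  (x.toNat, y.toNat, (!dead && q τ.a && !q τ.j₁).toNat,
    (!dead && q τ.a && q τ.j₁ && !q τ.j₂).toNat)

/-- Membership in a triple. -/
def memT (t : ℕ × ℕ × ℕ) (x : ℕ) : Bool := x == t.1 || x == t.2.1 || x == t.2.2

theorem wt_map {f : ℕ → ℕ} (hf : Function.Injective f) (τ : Lab) {p q : ℕ → Bool}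
    (h : ∀ x, q (f x) = p x) : wt (τ.map f) q = wt τ p := by
  have hb : ∀ x y, (f x == f y) = (x == y) := fun x y => by
    rw [Bool.eq_iff_iff, beq_iff_eq, beq_iff_eq, hf.eq_iff]
  simp only [wt, Lab.map, h, hb, bne]

/-- The triple of entries of an index. -/
def MI.tri (K : MI 6) : ℕ × ℕ × ℕ := (K.val 0, K.val 1, K.val 2)

/-- The weight of a Plücker variable. -/
def wK (τ : Lab) (K : MI 6) : ℕ × ℕ × ℕ × ℕ := wt τ (memT K.tri)

/-- Weight of an exponent. -/
noncomputable def W (τ : Lab) : (MI 6 →₀ ℕ) →+ ℕ × ℕ × ℕ × ℕ := Finsupp.weight (wK τ)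

/-- Lexicographic comparison of 4-tuples. -/
def lex4 (x y : ℕ × ℕ × ℕ × ℕ) : Prop :=
  x.1 < y.1 ∨ x.1 = y.1 ∧ (x.2.1 < y.2.1 ∨ x.2.1 = y.2.1 ∧
    (x.2.2.1 < y.2.2.1 ∨ x.2.2.1 = y.2.2.1 ∧ x.2.2.2 ≤ y.2.2.2))

instance (x y : ℕ × ℕ × ℕ × ℕ) : Decidable (lex4 x y) :=
  inferInstanceAs (Decidable (_ ∨ _ ∧ (_ ∨ _ ∧ (_ ∨ _ ∧ _))))

theorem lex4_trans {x y z : ℕ × ℕ × ℕ × ℕ} (h1 : lex4 x y) (h2 : lex4 y z) : lex4 x z := by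
  unfold lex4 at *; omega

theorem lex4_total (x y : ℕ × ℕ × ℕ × ℕ) : lex4 x y ∨ lex4 y x := by
  unfold lex4 at *; omega

theorem lex4_refl (x : ℕ × ℕ × ℕ × ℕ) : lex4 x x := by
  unfold lex4 at *; omega

theorem lex4_antisymm {x y : ℕ × ℕ × ℕ × ℕ} (h1 : lex4 x y) (h2 : lex4 y x) : x = y := by
  unfold lex4 at *
  ext <;> omega

/-- The order on exponents defined by the weight: large weights come first. -/
def leL (τ : Lab) (m m' : MI 6 →₀ ℕ) : Prop := lex4 (W τ m') (W τ m)

/-- The initial ideal of the Plücker ideal for the labels `τ`. -/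
noncomputable def In (τ : Lab) : Ideal (PRing 6) := InI (leL τ) (PluckerIdeal 6)

theorem leL_trans (τ : Lab) (a b c : MI 6 →₀ ℕ) (h1 : leL τ a b) (h2 : leL τ b c) : leL τ a c :=
  lex4_trans h2 h1

theorem memT_trS (i : ℕ) {t : ℕ × ℕ × ℕ} (h1 : t.1 < t.2.1) (h2 : t.2.1 < t.2.2) (x : ℕ) :
    memT (trS i t) (tr i x) = memT t x := by
  obtain ⟨a, b, c⟩ := t
  simp only at h1 h2
  rw [Bool.eq_iff_iff]
  unfold trS memT
  split_ifs with h
  · simp only [Bool.or_eq_true, beq_iff_eq]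
    simp only at h
    unfold tr
    split_ifs <;> omega
  · simp only [Bool.or_eq_true, beq_iff_eq, (tr_injective i).eq_iff]

theorem W_map_tr {i : ℕ} (h1 : 1 ≤ i) (h5 : i ≤ 5) (τ : Lab) (m : MI 6 →₀ ℕ) :
    W (τ.map (tr i)) (m.mapDomain (trK i h1 h5)) = W τ m := by
  simp only [W, Finsupp.weight_apply]
  rw [Finsupp.sum_mapDomain_index (by simp) (by intros; rw [add_smul])]
  refine Finsupp.sum_congr fun K _ => ?_
  congr 1
  exact wt_map (tr_injective i) τ (memT_trS i K.lt01 K.lt12)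

theorem Lab.map_tr_map_tr (i : ℕ) (τ : Lab) : (τ.map (tr i)).map (tr i) = τ := by
  simp only [Lab.map, tr_involutive]

theorem map_sAuto_In {i : ℕ} (h1 : 1 ≤ i) (h5 : i ≤ 5) (τ : Lab) :
    Ideal.map (sAuto i).toRingHom (In τ) = In (τ.map (tr i)) := by
  have key : ∀ τ, Ideal.map (sAuto i).toRingHom (In τ) ≤ In (τ.map (tr i)) := by
    intro τ
    refine map_InI_le (mapDomain_trK_involutive h1 h5).bijective (trSign_prod_ne_zero i)
      (sAuto_monomial h1 h5) (fun m m' => ?_) (fun f hf => sAuto_mem h1 h5 hf)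
    simp only [leL, W_map_tr]
  apply le_antisymm (key τ)
  have := Ideal.map_mono (f := (sAuto i).toRingHom) (key (τ.map (tr i)))
  rwa [map_sAuto_map h1 h5, Lab.map_tr_map_tr] at this

/-- The multidegree of an index. -/
def eN (x : ℕ) : ℕ → ℕ := fun y => if y = x then 1 else 0

/-- The multidegree of a Plücker variable. -/
def dK (K : MI 6) : ℕ → ℕ := eN (K.val 0) + eN (K.val 1) + eN (K.val 2)

theorem eN_sort3 (a b c : ℕ) :
    eN (sort3 ![a, b, c] 0) + eN (sort3 ![a, b, c] 1) + eN (sort3 ![a, b, c] 2) =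
      eN a + eN b + eN c := by
  have h := ((List.perm_insertionSort (· ≤ ·) [a, b, c]).map eN).sum_eq
  have hl : (List.insertionSort (· ≤ ·) [a, b, c]).length = 3 := by
    rw [List.length_insertionSort]; rfl
  obtain ⟨x, y, z, e⟩ := List.length_eq_three.1 hl
  have e' : ∀ i, sort3 ![a, b, c] i = [x, y, z].getD i 0 := fun i => by rw [← e]; rfl
  rw [e] at h
  simp only [List.map_cons, List.map_nil, List.sum_cons, List.sum_nil, add_zero] at h
  rw [e', e', e']
  simp only [← add_assoc] at h
  exact h

theorem P_hom (a b c : ℕ) : IsWeightedHomogeneous dK (P a b c) (eN a + eN b + eN c) := by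
  rw [P, ← eN_sort3, ← mem_weightedHomogeneousSubmodule ℂ, ← zsmul_eq_mul]
  apply zsmul_mem
  rw [pvar]
  split_ifs with h
  · exact isWeightedHomogeneous_X ℂ dK (⟨_, h⟩ : MI 6)
  · exact zero_mem _

theorem Ralt_hom (b c d e f g : ℕ) : IsWeightedHomogeneous dK (Ralt b c d e f g)
    (eN b + eN c + eN d + eN e + eN f + eN g) := by
  have h : ∀ x y z x' y' z', eN x + eN y + eN z + (eN x' + eN y' + eN z') =
      eN b + eN c + eN d + eN e + eN f + eN g →
      P x y z * P x' y' z' ∈ weightedHomogeneousSubmodule ℂ dK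
        (eN b + eN c + eN d + eN e + eN f + eN g) := by
    intro x y z x' y' z' h
    rw [← h]
    exact (P_hom _ _ _).mul (P_hom _ _ _)
  rw [← mem_weightedHomogeneousSubmodule, Ralt]
  refine sub_mem (add_mem (sub_mem ?_ ?_) ?_) ?_ <;> apply h <;> ring

theorem Rrel_hom : ∀ f ∈ {f | ∃ I J, Sorted 2 6 I ∧ Sorted 4 6 J ∧ f = Rrel 6 I J}, IsHom dK f := by
  rintro _ ⟨I, J, hI, hJ, rfl⟩ m hm m' hm'
  rw [Rrel_eq_neg_Ralt hI hJ, support_neg, mem_support_iff] at hm hm'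
  rw [Ralt_hom _ _ _ _ _ _ hm, Ralt_hom _ _ _ _ _ _ hm']

theorem In_eq_of_le {τ : Lab} {B : Ideal (PRing 6)}
    (h : ∀ f ∈ PluckerIdeal 6, IsHom dK f → topPart (leL τ) f ∈ B) : In τ ≤ B := by
  rw [In, PluckerIdeal, InI_eq_span_hom dK (leL_trans τ) Rrel_hom]
  apply Ideal.span_le.2
  rintro _ ⟨f, hf, hh, rfl⟩
  exact h f hf hh

end Weights

section Orders

theorem lexLE_cons (β : ℕ × ℕ) (L : List (ℕ × ℕ)) (a b : (ℕ × ℕ) →₀ ℕ) :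
    lexLE (β :: L) a b ↔ a β < b β ∨ a β = b β ∧ lexLE L a b := by
  constructor
  · rintro (⟨k, hk, h1, h2⟩ | h)
    · cases k with
      | zero => exact Or.inl h2
      | succ k =>
        refine Or.inr ⟨h1 0 (Nat.succ_pos _), Or.inl ⟨k, by simpa using hk, fun m hm => ?_, h2⟩⟩
        exact h1 (m + 1) (by omega)
    · exact Or.inr ⟨h 0 (Nat.succ_pos _), Or.inr fun k hk => h (k + 1) (by simpa using hk)⟩
  · rintro (h | ⟨h, ⟨k, hk, h1, h2⟩ | h'⟩)
    · exact Or.inl ⟨0, Nat.succ_pos _, by simp, h⟩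
    · refine Or.inl ⟨k + 1, by simpa using hk, fun m hm => ?_, h2⟩
      cases m with
      | zero => exact h
      | succ m => exact h1 m (by omega)
    · refine Or.inr fun k hk => ?_
      cases k with
      | zero => exact h
      | succ k => exact h' k (by simpa using hk)

theorem lexLT_cons (β : ℕ × ℕ) (L : List (ℕ × ℕ)) (a b : (ℕ × ℕ) →₀ ℕ) :
    lexLT (β :: L) a b ↔ a β < b β ∨ a β = b β ∧ lexLT L a b := by
  constructor
  · rintro ⟨k, hk, h1, h2⟩
    cases k with
    | zero => exact Or.inl h2
    | succ k =>
      exact Or.inr ⟨h1 0 (Nat.succ_pos _), k, by simpa using hk, fun m hm => h1 (m + 1) (by omega),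
        h2⟩
  · rintro (h | ⟨h, k, hk, h1, h2⟩)
    · exact ⟨0, Nat.succ_pos _, by simp, h⟩
    · refine ⟨k + 1, by simpa using hk, fun m hm => ?_, h2⟩
      cases m with
      | zero => exact h
      | succ m => exact h1 m (by omega)

theorem lexLE_nil (a b : (ℕ × ℕ) →₀ ℕ) : lexLE [] a b := Or.inr (by simp)

theorem lexLT_nil (a b : (ℕ × ℕ) →₀ ℕ) : ¬ lexLT [] a b := by
  rintro ⟨k, hk, -⟩
  exact absurd hk (by simp)

theorem lexLE_trans {L : List (ℕ × ℕ)} {a b c : (ℕ × ℕ) →₀ ℕ} (h1 : lexLE L a b)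
    (h2 : lexLE L b c) : lexLE L a c := by
  induction L with
  | nil => exact lexLE_nil _ _
  | cons β L ih =>
    rw [lexLE_cons] at *
    rcases h1 with h1 | ⟨h1, h1'⟩ <;> rcases h2 with h2 | ⟨h2, h2'⟩
    · exact Or.inl (h1.trans h2)
    · exact Or.inl (h2 ▸ h1)
    · exact Or.inl (h1 ▸ h2)
    · exact Or.inr ⟨h1.trans h2, ih h1' h2'⟩

theorem lexLT_trans {L : List (ℕ × ℕ)} {a b c : (ℕ × ℕ) →₀ ℕ} (h1 : lexLT L a b)
    (h2 : lexLT L b c) : lexLT L a c := by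
  induction L with
  | nil => exact absurd h1 (lexLT_nil _ _)
  | cons β L ih =>
    rw [lexLT_cons] at *
    rcases h1 with h1 | ⟨h1, h1'⟩ <;> rcases h2 with h2 | ⟨h2, h2'⟩
    · exact Or.inl (h1.trans h2)
    · exact Or.inl (h2 ▸ h1)
    · exact Or.inl (h1 ▸ h2)
    · exact Or.inr ⟨h1.trans h2, ih h1' h2'⟩

theorem not_lexLT_of_lexLE {L : List (ℕ × ℕ)} {a b : (ℕ × ℕ) →₀ ℕ} (h1 : lexLE L a b) :
    ¬ lexLT L b a := by
  induction L with
  | nil => exact lexLT_nil _ _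
  | cons β L ih =>
    rw [lexLE_cons] at h1
    rw [lexLT_cons]
    rintro (h | ⟨h, h'⟩)
    · rcases h1 with h1 | ⟨h1, -⟩ <;> omega
    · rcases h1 with h1 | ⟨-, h1⟩
      · omega
      · exact ih h1 h'

theorem lexLT_add_right {L : List (ℕ × ℕ)} {a b : (ℕ × ℕ) →₀ ℕ} (c : (ℕ × ℕ) →₀ ℕ) :
    lexLT L (a + c) (b + c) ↔ lexLT L a b := by
  induction L with
  | nil => simp [lexLT_nil]
  | cons β L ih => simp [lexLT_cons, ih]

theorem Psi_add (a b : (ℕ × ℕ) →₀ ℕ) : Psi (a + b) = Psi a + Psi b := by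
  rw [Psi, Finsupp.sum_add_index' (by simp) (by intros; ring)]
  rfl

theorem Psi_single (β : ℕ × ℕ) (k : ℕ) : Psi (Finsupp.single β k) = k * Ht β := by
  rw [Psi, Finsupp.sum_single_index (by simp)]

theorem Psi_zero : Psi 0 = 0 := by simp [Psi]

theorem psiLE_trans {S : List (ℕ × ℕ)} {a b c : (ℕ × ℕ) →₀ ℕ} (h1 : psiLE S a b)
    (h2 : psiLE S b c) : psiLE S a c := by
  rcases h1 with h1 | ⟨h1, h1'⟩ <;> rcases h2 with h2 | ⟨h2, h2'⟩
  · exact Or.inl (h1.trans h2)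
  · exact Or.inl (h2 ▸ h1)
  · exact Or.inl (h1 ▸ h2)
  · exact Or.inr ⟨h1.trans h2, lexLE_trans h2' h1'⟩

theorem psiLT_trans {S : List (ℕ × ℕ)} {a b c : (ℕ × ℕ) →₀ ℕ} (h1 : psiLT S a b)
    (h2 : psiLT S b c) : psiLT S a c := by
  rcases h1 with h1 | ⟨h1, h1'⟩ <;> rcases h2 with h2 | ⟨h2, h2'⟩
  · exact Or.inl (h1.trans h2)
  · exact Or.inl (h2 ▸ h1)
  · exact Or.inl (h1 ▸ h2)
  · exact Or.inr ⟨h1.trans h2, lexLT_trans h2' h1'⟩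

theorem not_psiLT_of_psiLE {S : List (ℕ × ℕ)} {a b : (ℕ × ℕ) →₀ ℕ} (h1 : psiLE S a b) :
    ¬ psiLT S b a := by
  rintro (h | ⟨h, h'⟩)
  · rcases h1 with h1 | ⟨h1, -⟩ <;> omega
  · rcases h1 with h1 | ⟨-, h1⟩
    · omega
    · exact not_lexLT_of_lexLE h1 h'

theorem psiLE_of_psiLT {S : List (ℕ × ℕ)} {a b : (ℕ × ℕ) →₀ ℕ} (h : psiLT S a b) :
    psiLE S a b :=
  h.imp id (And.imp id Or.inl)

theorem psiLE_refl (S : List (ℕ × ℕ)) (a : (ℕ × ℕ) →₀ ℕ) : psiLE S a a :=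
  Or.inr ⟨rfl, Or.inr fun _ _ => rfl⟩

theorem psiLT_irrefl (S : List (ℕ × ℕ)) (a : (ℕ × ℕ) →₀ ℕ) : ¬ psiLT S a a :=
  not_psiLT_of_psiLE (psiLE_refl S a)

theorem psiLT_add_right {S : List (ℕ × ℕ)} {a b : (ℕ × ℕ) →₀ ℕ} (h : psiLT S a b)
    (c : (ℕ × ℕ) →₀ ℕ) : psiLT S (a + c) (b + c) := by
  simpa only [psiLT, Psi_add, add_lt_add_iff_right, add_left_inj, lexLT_add_right] using h

/-- `e` is the lowest exponent of `f`, with coefficient `c`. -/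
def LeadP (S : List (ℕ × ℕ)) (f : MvPolynomial (ℕ × ℕ) ℂ) (e : (ℕ × ℕ) →₀ ℕ) (c : ℂ) : Prop :=
  coeff e f = c ∧ ∀ m, coeff m f ≠ 0 → m = e ∨ psiLT S e m

theorem LeadP.minSupp_eq {S : List (ℕ × ℕ)} {f : MvPolynomial (ℕ × ℕ) ℂ} {e : (ℕ × ℕ) →₀ ℕ}
    {c : ℂ} (h : LeadP S f e c) (hc : c ≠ 0) : minSupp S f = e := by
  have hex : ∃ m ∈ f.support, ∀ m' ∈ f.support, psiLE S m m' := by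
    refine ⟨e, mem_support_iff.2 (h.1 ▸ hc), fun m' hm' => ?_⟩
    rcases h.2 m' (mem_support_iff.1 hm') with rfl | h'
    · exact psiLE_refl _ _
    · exact psiLE_of_psiLT h'
  rw [minSupp, dif_pos hex]
  obtain ⟨h1, h2⟩ := hex.choose_spec
  rcases h.2 _ (mem_support_iff.1 h1) with h' | h'
  · exact h'
  · exact absurd h' (not_psiLT_of_psiLE (h2 e (mem_support_iff.2 (h.1 ▸ hc))))

theorem LeadP.mul {S : List (ℕ × ℕ)} {f g : MvPolynomial (ℕ × ℕ) ℂ} {e e' : (ℕ × ℕ) →₀ ℕ}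
    {c c' : ℂ} (h : LeadP S f e c) (h' : LeadP S g e' c') : LeadP S (f * g) (e + e') (c * c') := by
  classical
  have key : ∀ m m', coeff m f ≠ 0 → coeff m' g ≠ 0 →
      (m = e ∧ m' = e') ∨ psiLT S (e + e') (m + m') := by
    intro m m' hm hm'
    rcases h.2 m hm with rfl | h1 <;> rcases h'.2 m' hm' with rfl | h2
    · exact Or.inl ⟨rfl, rfl⟩
    · right
      rw [add_comm m, add_comm m]
      exact psiLT_add_right h2 _
    · exact Or.inr (psiLT_add_right h1 _)
    · right
      refine psiLT_trans (psiLT_add_right h1 _) ?_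
      rw [add_comm m, add_comm m]
      exact psiLT_add_right h2 _
  constructor
  · rw [coeff_mul, Finset.sum_eq_single (e, e'), h.1, h'.1]
    · rintro ⟨m, m'⟩ hm hne
      by_contra hcon
      rw [Finset.HasAntidiagonal.mem_antidiagonal] at hm
      rcases key m m' (left_ne_zero_of_mul hcon) (right_ne_zero_of_mul hcon) with ⟨rfl, rfl⟩ | h3
      · exact hne rfl
      · exact psiLT_irrefl S (e + e') (hm ▸ h3 :)
    · intro hm
      rw [Finset.HasAntidiagonal.mem_antidiagonal] at hm
      exact absurd rfl hm
  · intro m hm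
    rw [coeff_mul] at hm
    obtain ⟨⟨a, b⟩, hab, hne⟩ := Finset.exists_ne_zero_of_sum_ne_zero hm
    rw [Finset.HasAntidiagonal.mem_antidiagonal] at hab
    rcases key a b (left_ne_zero_of_mul hne) (right_ne_zero_of_mul hne) with ⟨rfl, rfl⟩ | h3
    · exact Or.inl hab.symm
    · exact Or.inr (hab ▸ h3)

theorem LeadP.one (S : List (ℕ × ℕ)) : LeadP S 1 0 1 := by
  classical
  refine ⟨by simp, fun m hm => Or.inl ?_⟩
  rw [coeff_one] at hm
  by_contra h
  rw [if_neg (Ne.symm h)] at hm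
  exact hm rfl

theorem LeadP.pow {S : List (ℕ × ℕ)} {f : MvPolynomial (ℕ × ℕ) ℂ} {e : (ℕ × ℕ) →₀ ℕ}
    {c : ℂ} (h : LeadP S f e c) (k : ℕ) : LeadP S (f ^ k) (k • e) (c ^ k) := by
  induction k with
  | zero => simpa using LeadP.one S
  | succ k ih => rw [pow_succ, pow_succ, succ_nsmul]; exact ih.mul h

theorem LeadP.prod {S : List (ℕ × ℕ)} {ι : Type*} (s : Finset ι)
    {f : ι → MvPolynomial (ℕ × ℕ) ℂ} {e : ι → (ℕ × ℕ) →₀ ℕ} {c : ι → ℂ}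
    (h : ∀ i ∈ s, LeadP S (f i) (e i) (c i)) :
    LeadP S (∏ i ∈ s, f i) (∑ i ∈ s, e i) (∏ i ∈ s, c i) := by
  classical
  induction s using Finset.induction_on with
  | empty => simpa using LeadP.one S
  | insert a s ha ih =>
    rw [Finset.prod_insert ha, Finset.prod_insert ha, Finset.sum_insert ha]
    exact (h a (Finset.mem_insert_self _ _)).mul
      (ih fun i hi => h i (Finset.mem_insert_of_mem hi))

end Orders

section Leading

theorem ASmat_cons {β : ℕ × ℕ} (hβ : 1 ≤ β.1 ∧ β.1 ≤ 6) (L : List (ℕ × ℕ)) (i : ℕ) {j : ℕ}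
    (hj : 1 ≤ j ∧ j ≤ 6) :
    ASmat 6 (β :: L) i j = ASmat 6 L i j + if j = β.2 then X β * ASmat 6 L i β.1 else 0 := by
  simp only [ASmat, matMul, factor, mul_add, Finset.sum_add_distrib, mul_ite, mul_one, mul_zero]
  congr 1
  · rw [Finset.sum_ite_eq' _ j, if_pos (Finset.mem_Icc.2 hj)]
  · split_ifs with h
    · subst h
      simp only [and_true]
      rw [Finset.sum_ite_eq' _ β.1, if_pos (Finset.mem_Icc.2 hβ), mul_comm]
    · simp [h]

/-- The minor of `A_L` on the columns `t`. -/
noncomputable def minor (L : List (ℕ × ℕ)) (t : ℕ × ℕ × ℕ) : MvPolynomial (ℕ × ℕ) ℂ :=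
  phiStar 6 L ![t.1, t.2.1, t.2.2]

theorem minor_tri (L : List (ℕ × ℕ)) (K : MI 6) : phiStar 6 L K.val = minor L K.tri := by
  rw [minor, MI.tri, ← eq_vec3]

theorem minor_eq (L : List (ℕ × ℕ)) (x y z : ℕ) : minor L (x, y, z) =
    ASmat 6 L 1 x * ASmat 6 L 2 y * ASmat 6 L 3 z - ASmat 6 L 1 x * ASmat 6 L 2 z * ASmat 6 L 3 y
    - ASmat 6 L 1 y * ASmat 6 L 2 x * ASmat 6 L 3 z + ASmat 6 L 1 y * ASmat 6 L 2 z * ASmat 6 L 3 x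
    + ASmat 6 L 1 z * ASmat 6 L 2 x * ASmat 6 L 3 y
    - ASmat 6 L 1 z * ASmat 6 L 2 y * ASmat 6 L 3 x := by
  rw [minor, phiStar, Matrix.det_fin_three]
  rfl

/-- The entries of a triple are distinct and belong to `[1,n]`. -/
def DistIn (n : ℕ) (t : ℕ × ℕ × ℕ) : Prop :=
  t.1 ≠ t.2.1 ∧ t.1 ≠ t.2.2 ∧ t.2.1 ≠ t.2.2 ∧
    (1 ≤ t.1 ∧ t.1 ≤ n) ∧ (1 ≤ t.2.1 ∧ t.2.1 ≤ n) ∧ 1 ≤ t.2.2 ∧ t.2.2 ≤ n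

/-- Replacement of `q` by `p`. -/
def sub (t : ℕ × ℕ × ℕ) (q p : ℕ) : ℕ × ℕ × ℕ :=
  (if t.1 = q then p else t.1, if t.2.1 = q then p else t.2.1, if t.2.2 = q then p else t.2.2)

theorem minor_cons {β : ℕ × ℕ} (hβ : 1 ≤ β.1 ∧ β.1 ≤ 6) (L : List (ℕ × ℕ)) {t : ℕ × ℕ × ℕ}
    (ht : DistIn 6 t) : minor (β :: L) t =
      minor L t + if memT t β.2 then X β * minor L (sub t β.2 β.1) else 0 := by
  obtain ⟨x, y, z⟩ := t
  obtain ⟨hxy, hxz, hyz, hx, hy, hz⟩ := ht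
  simp only at hxy hxz hyz hx hy hz
  simp only [minor_eq, sub, memT, ASmat_cons hβ L _ hx, ASmat_cons hβ L _ hy,
    ASmat_cons hβ L _ hz, Bool.or_eq_true, beq_iff_eq]
  by_cases h1 : x = β.2
  · have h2 : y ≠ β.2 := fun h => hxy (h1.trans h.symm)
    have h3 : z ≠ β.2 := fun h => hxz (h1.trans h.symm)
    simp only [h1, if_true, if_neg h2, if_neg h3, true_or]
    ring
  by_cases h2 : y = β.2
  · have h3 : z ≠ β.2 := fun h => hyz (h2.trans h.symm)
    simp only [h2, if_true, if_neg h1, if_neg h3, true_or, or_true]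
    ring
  by_cases h3 : z = β.2
  · simp only [h3, if_true, if_neg h1, if_neg h2, or_true]
    ring
  · have h1' := Ne.symm h1
    have h2' := Ne.symm h2
    have h3' := Ne.symm h3
    simp [h1, h2, h3, h1', h2', h3']

theorem minor_sub_eq_zero (L : List (ℕ × ℕ)) {t : ℕ × ℕ × ℕ} {p q : ℕ} (hp : memT t p)
    (hq : memT t q) (hpq : p ≠ q) : minor L (sub t q p) = 0 := by
  obtain ⟨x, y, z⟩ := t
  simp only [memT, Bool.or_eq_true, beq_iff_eq] at hp hq
  simp only [minor_eq, sub]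
  rcases hp with (rfl | rfl) | rfl <;> rcases hq with (rfl | rfl) | rfl <;>
    first
    | exact absurd rfl hpq
    | (simp only [if_true, if_neg hpq]; split_ifs <;> ring)

/-- One step of the greedy reduction of a triple. -/
def stepT (t : ℕ × ℕ × ℕ) (β : ℕ × ℕ) : ℕ × ℕ × ℕ :=
  if memT t β.2 && !memT t β.1 then sub t β.2 β.1 else t

/-- Whether the greedy reduction uses `β`. -/
def used (t : ℕ × ℕ × ℕ) (β : ℕ × ℕ) : ℕ := (memT t β.2 && !memT t β.1).toNat

/-- The lowest exponent of a minor. -/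
noncomputable def lead : List (ℕ × ℕ) → ℕ × ℕ × ℕ → (ℕ × ℕ) →₀ ℕ
  | [], _ => 0
  | β :: L, t => Finsupp.single β (used t β) + lead L (stepT t β)

theorem DistIn.stepT {t : ℕ × ℕ × ℕ} {β : ℕ × ℕ} {n : ℕ} (hβ : 1 ≤ β.1 ∧ β.1 ≤ n)
    (ht : DistIn n t) : DistIn n (stepT t β) := by
  obtain ⟨x, y, z⟩ := t
  unfold _root_.stepT
  split_ifs with h
  · simp only [memT, Bool.and_eq_true, Bool.or_eq_true, beq_iff_eq, Bool.not_eq_true',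
      Bool.or_eq_false_iff, beq_eq_false_iff_ne] at h
    unfold DistIn sub at *
    simp only at *
    split_ifs <;> omega
  · exact ht

theorem lead_apply_of_notMem {L : List (ℕ × ℕ)} {β : ℕ × ℕ} (h : β ∉ L) (t : ℕ × ℕ × ℕ) :
    lead L t β = 0 := by
  induction L generalizing t with
  | nil => rfl
  | cons γ L ih =>
    rw [List.mem_cons, not_or] at h
    rw [lead, Finsupp.add_apply, Finsupp.single_apply, if_neg (Ne.symm h.1), ih h.2]

theorem minor_nil {t : ℕ × ℕ × ℕ} (ht : DistIn 6 t) :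
    (DistIn 3 t → minor [] t = 1 ∨ minor [] t = -1) ∧ (¬ DistIn 3 t → minor [] t = 0) := by
  obtain ⟨x, y, z⟩ := t
  have hA : ∀ i j, ASmat 6 [] i j = if i = j then 1 else 0 := fun i j => rfl
  simp only [minor_eq, hA]
  unfold DistIn at *
  simp only at *
  constructor
  · intro h
    have : (x = 1 ∧ y = 2 ∧ z = 3) ∨ (x = 1 ∧ y = 3 ∧ z = 2) ∨ (x = 2 ∧ y = 1 ∧ z = 3) ∨
      (x = 2 ∧ y = 3 ∧ z = 1) ∨ (x = 3 ∧ y = 1 ∧ z = 2) ∨ (x = 3 ∧ y = 2 ∧ z = 1) := by omega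
    rcases this with ⟨rfl, rfl, rfl⟩ | ⟨rfl, rfl, rfl⟩ | ⟨rfl, rfl, rfl⟩ | ⟨rfl, rfl, rfl⟩ |
      ⟨rfl, rfl, rfl⟩ | ⟨rfl, rfl, rfl⟩ <;> simp
  · intro h
    have : 3 < x ∨ 3 < y ∨ 3 < z := by omega
    rcases this with h | h | h
    · rw [if_neg (by omega : ¬ 1 = x), if_neg (by omega : ¬ 2 = x), if_neg (by omega : ¬ 3 = x)]
      ring
    · rw [if_neg (by omega : ¬ 1 = y), if_neg (by omega : ¬ 2 = y), if_neg (by omega : ¬ 3 = y)]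
      ring
    · rw [if_neg (by omega : ¬ 1 = z), if_neg (by omega : ¬ 2 = z), if_neg (by omega : ¬ 3 = z)]
      ring

/-- Homogeneity and support of the minors. -/
theorem minor_supp {L : List (ℕ × ℕ)} (hL : ∀ β ∈ L, 1 ≤ β.1 ∧ β.1 < β.2 ∧ β.2 ≤ 6)
    {t : ℕ × ℕ × ℕ} (ht : DistIn 6 t) {m : (ℕ × ℕ) →₀ ℕ} (hm : coeff m (minor L t) ≠ 0) :
    Psi m + 6 = t.1 + t.2.1 + t.2.2 ∧ ∀ β ∉ L, m β = 0 := by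
  classical
  induction L generalizing t m with
  | nil =>
    by_cases h3 : DistIn 3 t
    · have hm0 : m = 0 := by
        by_contra h
        rcases (minor_nil ht).1 h3 with h' | h' <;> rw [h'] at hm
        · rw [coeff_one, if_neg (Ne.symm h)] at hm
          exact hm rfl
        · rw [coeff_neg, coeff_one, if_neg (Ne.symm h), neg_zero] at hm
          exact hm rfl
      subst hm0
      refine ⟨?_, by simp⟩
      rw [Psi_zero]
      unfold DistIn at h3
      omega
    · rw [(minor_nil ht).2 h3] at hm
      exact absurd (coeff_zero m) hm
  | cons β L ih =>
    have hβ := hL β List.mem_cons_self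
    have hL' : ∀ β ∈ L, 1 ≤ β.1 ∧ β.1 < β.2 ∧ β.2 ≤ 6 := fun γ hγ =>
      hL γ (List.mem_cons_of_mem _ hγ)
    rw [minor_cons ⟨hβ.1, by omega⟩ L ht, coeff_add] at hm
    by_cases h1 : coeff m (minor L t) = 0
    · rw [h1, zero_add] at hm
      split_ifs at hm with hq
      swap
      · exact absurd (coeff_zero m) hm
      by_cases hp : memT t β.1
      · rw [minor_sub_eq_zero L hp hq (by omega), mul_zero] at hm
        exact absurd (coeff_zero m) hm
      rw [coeff_X_mul'] at hm
      split_ifs at hm with hs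
      swap
      · exact absurd rfl hm
      have hst : stepT t β = sub t β.2 β.1 := by simp [stepT, hp, hq]
      have hle : Finsupp.single β 1 ≤ m := by
        rw [Finsupp.single_le_iff]
        exact Nat.one_le_iff_ne_zero.2 (Finsupp.mem_support_iff.1 hs)
      obtain ⟨m', rfl⟩ := exists_add_of_le hle
      rw [add_tsub_cancel_left] at hm
      obtain ⟨h2, h3⟩ := ih hL' (hst ▸ ht.stepT ⟨hβ.1, by omega⟩) hm
      constructor
      · rw [Psi_add, Psi_single, one_mul, Ht]
        obtain ⟨x, y, z⟩ := t
        simp only [memT, Bool.or_eq_true, beq_iff_eq, not_or] at hp hq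
        simp only [sub] at h2
        unfold DistIn at ht
        simp only at *
        split_ifs at h2 <;> omega
      · intro γ hγ
        rw [List.mem_cons, not_or] at hγ
        rw [Finsupp.add_apply, Finsupp.single_apply, if_neg (Ne.symm hγ.1), h3 γ hγ.2]
    · obtain ⟨h2, h3⟩ := ih hL' ht h1
      exact ⟨h2, fun γ hγ => h3 γ fun h => hγ (List.mem_cons_of_mem _ h)⟩

theorem minor_lead {L : List (ℕ × ℕ)} (hL : ∀ β ∈ L, 1 ≤ β.1 ∧ β.1 < β.2 ∧ β.2 ≤ 6)
    (hnd : L.Nodup) {t : ℕ × ℕ × ℕ} (ht : DistIn 6 t) (hf : DistIn 3 (L.foldl stepT t)) :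
    ∃ c ≠ 0, LeadP L (minor L t) (lead L t) c := by
  classical
  induction L generalizing t with
  | nil =>
    rcases (minor_nil ht).1 hf with h | h
    · exact ⟨1, one_ne_zero, h ▸ LeadP.one []⟩
    · refine ⟨-1, neg_ne_zero.2 one_ne_zero, ?_⟩
      have := LeadP.one []
      rw [h]
      refine ⟨by simp [lead], fun m hm => this.2 m ?_⟩
      rwa [coeff_neg, neg_ne_zero] at hm
  | cons β L ih =>
    have hβ := hL β List.mem_cons_self
    have hL' : ∀ β ∈ L, 1 ≤ β.1 ∧ β.1 < β.2 ∧ β.2 ≤ 6 := fun γ hγ =>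
      hL γ (List.mem_cons_of_mem _ hγ)
    rw [List.nodup_cons] at hnd
    have hst : DistIn 6 (stepT t β) := ht.stepT ⟨hβ.1, by omega⟩
    obtain ⟨c, hc, h1, h2⟩ := ih hL' hnd.2 hst hf
    refine ⟨c, hc, ?_⟩
    have hhom : ∀ m, coeff m (minor (β :: L) t) ≠ 0 → Psi m + 6 = t.1 + t.2.1 + t.2.2 :=
      fun m hm => (minor_supp hL ht hm).1
    by_cases hu : memT t β.2 && !memT t β.1
    · have hst' : stepT t β = sub t β.2 β.1 := by simp [stepT, hu]
      have hm : minor (β :: L) t = minor L t + X β * minor L (stepT t β) := by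
        rw [minor_cons ⟨hβ.1, by omega⟩ L ht, hst', if_pos]
        simp only [Bool.and_eq_true] at hu
        exact hu.1
      have hle : lead (β :: L) t = Finsupp.single β 1 + lead L (stepT t β) := by
        rw [lead, used, hu]; rfl
      have h0 : ∀ m : (ℕ × ℕ) →₀ ℕ, m β ≠ 0 → coeff m (minor L t) = 0 := by
        intro m hm
        by_contra h
        exact hm ((minor_supp hL' ht h).2 β hnd.1)
      have hcl : coeff (lead (β :: L) t) (minor (β :: L) t) = c := by
        rw [hm, coeff_add, h0, zero_add, hle, coeff_X_mul, h1]
        rw [hle]; simp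
      refine ⟨hcl, fun m hm' => ?_⟩
      have hP : Psi (lead (β :: L) t) = Psi m := by
        have e1 := hhom m hm'
        have e2 := hhom (lead (β :: L) t) (hcl ▸ hc)
        omega
      by_cases hb : m β = 0
      · right
        refine Or.inr ⟨hP, ?_⟩
        rw [lexLT_cons]
        left
        rw [hb, hle]; simp
      · rw [hm, coeff_add, h0 m hb, zero_add, coeff_X_mul', if_pos (by simpa using hb)] at hm'
        have hle' : Finsupp.single β 1 ≤ m := by
          rw [Finsupp.single_le_iff]
          omega
        obtain ⟨m', rfl⟩ := exists_add_of_le hle'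
        rw [add_tsub_cancel_left] at hm'
        rcases h2 m' hm' with rfl | h3
        · exact Or.inl hle.symm
        · right
          refine Or.inr ⟨hP, ?_⟩
          rw [hle, Psi_add, Psi_add] at hP
          rw [lexLT_cons]
          right
          have e1 := (minor_supp hL' hst hm').2 β hnd.1
          have e2 := lead_apply_of_notMem hnd.1 (stepT t β)
          refine ⟨by simp [hle, e1, e2], ?_⟩
          rw [hle, add_comm _ m', add_comm _ (lead L _), lexLT_add_right]
          rcases h3 with h3 | h3
          · omega
          · exact h3.2
    · have hst' : stepT t β = t := by simp [stepT, hu]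
      have hle : lead (β :: L) t = lead L t := by
        rw [lead, used, hst', Bool.eq_false_of_not_eq_true hu]; simp
      have hm : minor (β :: L) t = minor L t := by
        rw [minor_cons ⟨hβ.1, by omega⟩ L ht]
        split_ifs with h
        · simp only [h, Bool.true_and, Bool.not_eq_true', Bool.not_eq_false] at hu
          rw [minor_sub_eq_zero L hu h (by omega), mul_zero, add_zero]
        · rw [add_zero]
      rw [hst'] at h1 h2
      rw [hm, hle]
      refine ⟨h1, fun m hm' => (h2 m hm').imp id ?_⟩
      rintro (h3 | ⟨h3, h4⟩)
      · exact Or.inl h3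
      · refine Or.inr ⟨h3, ?_⟩
        rw [lexLT_cons]
        right
        refine ⟨?_, h4⟩
        rw [(minor_supp hL' ht hm').2 β hnd.1, lead_apply_of_notMem hnd.1]

end Leading

section Words

/-- The first indices of the roots of an iterated sequence for `Gr(3,6)`. -/
structure Word where
  i₁ : ℕ
  i₂ : ℕ
  i₃ : ℕ
  j₁ : ℕ
  j₂ : ℕ
  j₃ : ℕ
  b₁ : ℕ
  b₂ : ℕ
  b₃ : ℕ

/-- Three distinct elements of `[1,n]`. -/
def Triple (n x y z : ℕ) : Prop :=
  (1 ≤ x ∧ x ≤ n) ∧ (1 ≤ y ∧ y ≤ n) ∧ (1 ≤ z ∧ z ≤ n) ∧ x ≠ y ∧ x ≠ z ∧ y ≠ z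

/-- The constraints on the indices of an iterated sequence. -/
def Word.Ok (w : Word) : Prop :=
  Triple 5 w.i₁ w.i₂ w.i₃ ∧ Triple 4 w.j₁ w.j₂ w.j₃ ∧ Triple 3 w.b₁ w.b₂ w.b₃

/-- The sequence of roots. -/
def Word.list (w : Word) : List (ℕ × ℕ) :=
  [(w.i₁, 6), (w.i₂, 6), (w.i₃, 6), (w.j₁, 5), (w.j₂, 5), (w.j₃, 5), (w.b₁, 4), (w.b₂, 4),
    (w.b₃, 4)]

theorem IsIter.exists_base {S : List (ℕ × ℕ)} (h : IsIter 4 S) :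
    ∃ x y z, Triple 3 x y z ∧ S = [(x, 4), (y, 4), (z, 4)] := by
  have hp : S.Perm [(1,4),(2,4),(3,4)] := by
    generalize hn : 4 = n at h
    cases h with
    | base L hp => exact hp
    | step r L i₁ i₂ i₃ hr => omega
  obtain ⟨⟨x, x'⟩, ⟨y, y'⟩, ⟨z, z'⟩, rfl⟩ := List.length_eq_three.1 hp.length_eq
  have hx := hp.mem_iff (a := (x, x')).1 (by simp)
  have hy := hp.mem_iff (a := (y, y')).1 (by simp)
  have hz := hp.mem_iff (a := (z, z')).1 (by simp)
  have hn := hp.nodup_iff.2 (by decide)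
  simp only [List.mem_cons, Prod.mk.injEq, List.not_mem_nil, or_false] at hx hy hz
  simp only [List.nodup_cons, List.mem_cons, Prod.mk.injEq, List.not_mem_nil, or_false] at hn
  obtain rfl : x' = 4 := by omega
  obtain rfl : y' = 4 := by omega
  obtain rfl : z' = 4 := by omega
  refine ⟨x, y, z, ?_, rfl⟩
  unfold Triple
  omega

theorem IsIter.exists_step {n : ℕ} {S : List (ℕ × ℕ)} (h : IsIter (n + 1) S) (hn : 4 ≤ n) :
    ∃ x y z L, Triple n x y z ∧ IsIter n L ∧ S = (x, n + 1) :: (y, n + 1) :: (z, n + 1) :: L := by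
  generalize hm : n + 1 = m at h
  cases h with
  | base L hp => omega
  | step r L i₁ i₂ i₃ hr hL h1 h2 h3 h4 h5 h6 h7 h8 h9 =>
    obtain rfl : n = r := by omega
    exact ⟨i₁, i₂, i₃, L, ⟨⟨h1, h2⟩, ⟨h3, h4⟩, ⟨h5, h6⟩, h7, h8, h9⟩, hL, rfl⟩

theorem isIter_six_iff {S : List (ℕ × ℕ)} : IsIter 6 S ↔ ∃ w : Word, w.Ok ∧ S = w.list := by
  constructor
  · intro h
    obtain ⟨i₁, i₂, i₃, L, hi, hL, rfl⟩ := h.exists_step (by norm_num)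
    obtain ⟨j₁, j₂, j₃, L', hj, hL', rfl⟩ := hL.exists_step (by norm_num)
    obtain ⟨b₁, b₂, b₃, hb, rfl⟩ := hL'.exists_base
    exact ⟨⟨i₁, i₂, i₃, j₁, j₂, j₃, b₁, b₂, b₃⟩, ⟨hi, hj, hb⟩, rfl⟩
  · rintro ⟨⟨i₁, i₂, i₃, j₁, j₂, j₃, b₁, b₂, b₃⟩, ⟨hi, hj, hb⟩, rfl⟩
    unfold Triple at hi hj hb
    simp only at hi hj hb
    obtain ⟨⟨hi1, hi1'⟩, ⟨hi2, hi2'⟩, ⟨hi3, hi3'⟩, hi4, hi5, hi6⟩ := hi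
    obtain ⟨⟨hj1, hj1'⟩, ⟨hj2, hj2'⟩, ⟨hj3, hj3'⟩, hj4, hj5, hj6⟩ := hj
    refine IsIter.step 5 _ _ _ _ (by omega) (IsIter.step 4 _ _ _ _ le_rfl (IsIter.base _ ?_)
      hj1 hj1' hj2 hj2' hj3 hj3' hj4 hj5 hj6) hi1 hi1' hi2 hi2' hi3 hi3' hi4 hi5 hi6
    have h : ∀ x ∈ List.range' 1 3, ∀ y ∈ List.range' 1 3, ∀ z ∈ List.range' 1 3,
        x ≠ y → x ≠ z → y ≠ z → [(x, 4), (y, 4), (z, 4)].Perm [(1, 4), (2, 4), (3, 4)] := by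
      decide +kernel
    obtain ⟨hb1, hb2, hb3, hb4, hb5, hb6⟩ := hb
    exact h b₁ (List.mem_range'_1.2 (by omega)) b₂ (List.mem_range'_1.2 (by omega)) b₃
      (List.mem_range'_1.2 (by omega)) hb4 hb5 hb6

theorem Word.Ok.lt {w : Word} (h : w.Ok) : ∀ β ∈ w.list, 1 ≤ β.1 ∧ β.1 < β.2 ∧ β.2 ≤ 6 := by
  unfold Word.Ok Triple at h
  simp only [Word.list, List.forall_mem_cons, List.not_mem_nil, false_imp_iff, implies_true,
    and_true]
  omega

theorem Word.Ok.nodup {w : Word} (h : w.Ok) : w.list.Nodup := by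
  unfold Word.Ok Triple at h
  simp only [Word.list, List.nodup_cons, List.mem_cons, Prod.mk.injEq, List.not_mem_nil, or_false,
    List.nodup_nil, and_true, not_false_eq_true]
  omega

theorem memT_stepT (t : ℕ × ℕ × ℕ) (p q z : ℕ) : memT (stepT t (p, q)) z =
    (memT t z && !((memT t q && !memT t p) && z == q) || (memT t q && !memT t p) && z == p) := by
  unfold stepT
  split_ifs with h
  · simp only at h
    rw [h, Bool.eq_iff_iff]
    simp only [memT, Bool.and_eq_true, Bool.or_eq_true, beq_iff_eq, Bool.not_eq_true',
      Bool.or_eq_false_iff, beq_eq_false_iff_ne, sub] at *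
    split_ifs <;> simp only [Bool.true_and, beq_eq_false_iff_ne, true_and] <;> omega
  · simp only [Bool.not_eq_true] at h
    rw [h]
    simp

theorem used_eq (t : ℕ × ℕ × ℕ) (p q : ℕ) :
    used t (p, q) = (memT t q && !memT t p).toNat := rfl

theorem used_second (t : ℕ × ℕ × ℕ) {r p₁ p₂ : ℕ} (h1 : p₁ ≠ r) (h2 : p₂ ≠ r) (h3 : p₁ ≠ p₂) :
    used (stepT t (p₁, r)) (p₂, r) = (memT t r && memT t p₁ && !memT t p₂).toNat := by
  rw [used_eq, memT_stepT, memT_stepT]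
  have e1 : (r == p₁) = false := by simpa using h1.symm
  have e2 : (p₂ == r) = false := by simpa using h2
  have e3 : (p₂ == p₁) = false := by simpa using h3.symm
  rw [e1, e2, e3, beq_self_eq_true]
  cases memT t r <;> cases memT t p₁ <;> cases memT t p₂ <;> rfl

theorem not_four {t : ℕ × ℕ × ℕ} {r p₁ p₂ p₃ : ℕ} (h1 : p₁ ≠ r)
    (h2 : p₂ ≠ r) (h3 : p₃ ≠ r) (h12 : p₁ ≠ p₂) (h13 : p₁ ≠ p₃) (h23 : p₂ ≠ p₃) (hr : memT t r)
    (hp1 : memT t p₁) (hp2 : memT t p₂) : memT t p₃ = false := by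
  by_contra h
  rw [Bool.not_eq_false] at h
  simp only [memT, Bool.or_eq_true, beq_iff_eq] at *
  omega

theorem used_third (t : ℕ × ℕ × ℕ) {r p₁ p₂ p₃ : ℕ} (h1 : p₁ ≠ r) (h2 : p₂ ≠ r)
    (h3 : p₃ ≠ r) (h12 : p₁ ≠ p₂) (h13 : p₁ ≠ p₃) (h23 : p₂ ≠ p₃) :
    used (stepT (stepT t (p₁, r)) (p₂, r)) (p₃, r) =
      (memT t r && memT t p₁ && memT t p₂).toNat := by
  rw [used_second _ h2 h3 h23, memT_stepT, memT_stepT, memT_stepT]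
  have e1 : (r == p₁) = false := by simpa using h1.symm
  have e2 : (p₂ == r) = false := by simpa using h2
  have e3 : (p₂ == p₁) = false := by simpa using h12.symm
  have e4 : (p₃ == r) = false := by simpa using h3
  have e5 : (p₃ == p₁) = false := by simpa using h13.symm
  rw [e1, e2, e3, e4, e5, beq_self_eq_true]
  have := not_four (t := t) h1 h2 h3 h12 h13 h23
  revert this
  cases memT t r <;> cases memT t p₁ <;> cases memT t p₂ <;> cases memT t p₃ <;> simp

/-- The triple obtained after the three steps with roots `(p, r)`. -/
def step3 (t : ℕ × ℕ × ℕ) (r p₁ p₂ p₃ : ℕ) : ℕ × ℕ × ℕ :=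
  stepT (stepT (stepT t (p₁, r)) (p₂, r)) (p₃, r)

theorem memT_step3 (t : ℕ × ℕ × ℕ) {r p₁ p₂ p₃ z : ℕ} (h1 : p₁ ≠ r) (h2 : p₂ ≠ r)
    (h3 : p₃ ≠ r) (h12 : p₁ ≠ p₂) (h13 : p₁ ≠ p₃) (h23 : p₂ ≠ p₃) :
    memT (step3 t r p₁ p₂ p₃) z = (memT t z && z != r || memT t r && !memT t p₁ && z == p₁ ||
      memT t r && memT t p₁ && !memT t p₂ && z == p₂ ||
      memT t r && memT t p₁ && memT t p₂ && z == p₃) := by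
  have hc := not_four (t := t) h1 h2 h3 h12 h13 h23
  have e1 : (r == p₁) = false := by simpa using h1.symm
  have e1' : (r == p₂) = false := by simpa using h2.symm
  have e2 : (p₂ == r) = false := by simpa using h2
  have e3 : (p₂ == p₁) = false := by simpa using h12.symm
  have e4 : (p₃ == r) = false := by simpa using h3
  have e5 : (p₃ == p₁) = false := by simpa using h13.symm
  have e6 : (p₃ == p₂) = false := by simpa using h23.symm
  simp only [step3, memT_stepT, e1, e1', e2, e3, e4, e5, e6, beq_self_eq_true, bne]
  have hz : z = r → memT t z = memT t r := fun h => by rw [h]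
  have hz' : (z == r) = true → memT t z = memT t r := fun h => hz (by simpa using h)
  have hz1 : (z == r) = true → (z == p₁) = false := fun h => by
    rw [beq_iff_eq] at h; rw [h]; exact e1
  have hz2 : (z == r) = true → (z == p₂) = false := fun h => by
    rw [beq_iff_eq] at h; rw [h]; exact e1'
  have hz3 : (z == r) = true → (z == p₃) = false := fun h => by
    rw [beq_iff_eq] at h; rw [h]; simpa using h3.symm
  revert hc hz' hz1 hz2 hz3
  generalize memT t r = a1
  generalize memT t p₁ = a2
  generalize memT t p₂ = a3
  generalize memT t p₃ = a4
  generalize memT t z = a5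
  generalize (z == r) = a6
  generalize (z == p₁) = a7
  generalize (z == p₂) = a8
  generalize (z == p₃) = a9
  revert a1 a2 a3 a4 a5 a6 a7 a8 a9
  decide +kernel

theorem DistIn.step3 {t : ℕ × ℕ × ℕ} {r p₁ p₂ p₃ : ℕ} (h : Triple r p₁ p₂ p₃)
    (ht : DistIn (r + 1) t) : DistIn r (step3 t (r + 1) p₁ p₂ p₃) := by
  obtain ⟨h1, h2, h3, h12, h13, h23⟩ := h
  have hd : DistIn (r + 1) (_root_.step3 t (r + 1) p₁ p₂ p₃) :=
    ((ht.stepT ⟨h1.1, by simp only; omega⟩).stepT ⟨h2.1, by simp only; omega⟩).stepT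
      ⟨h3.1, by simp only; omega⟩
  have hm : memT (_root_.step3 t (r + 1) p₁ p₂ p₃) (r + 1) = false := by
    rw [memT_step3 t (by omega) (by omega) (by omega) h12 h13 h23]
    have e1 : (r + 1 == p₁) = false := by simp only [beq_eq_false_iff_ne]; omega
    have e2 : (r + 1 == p₂) = false := by simp only [beq_eq_false_iff_ne]; omega
    have e3 : (r + 1 == p₃) = false := by simp only [beq_eq_false_iff_ne]; omega
    rw [e1, e2, e3, bne_self_eq_false]
    simp
  simp only [memT, Bool.or_eq_false_iff, beq_eq_false_iff_ne] at hm
  unfold DistIn at *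
  omega

theorem MI.distIn (K : MI 6) : DistIn 6 K.tri := by
  have h1 := K.lt01
  have h2 := K.lt12
  have h3 := K.range
  unfold DistIn MI.tri
  simp only
  omega

theorem Word.foldl_list (w : Word) (t : ℕ × ℕ × ℕ) : w.list.foldl stepT t =
    step3 (step3 (step3 t 6 w.i₁ w.i₂ w.i₃) 5 w.j₁ w.j₂ w.j₃) 4 w.b₁ w.b₂ w.b₃ := by
  simp only [Word.list, List.foldl_cons, List.foldl_nil, step3]

theorem Word.Ok.foldl {w : Word} (h : w.Ok) {t : ℕ × ℕ × ℕ} (ht : DistIn 6 t) :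
    DistIn 3 (w.list.foldl stepT t) := by
  rw [Word.foldl_list]
  exact ((ht.step3 h.1).step3 h.2.1).step3 h.2.2

theorem Word.Ok.leadP {w : Word} (h : w.Ok) (K : MI 6) :
    ∃ c ≠ 0, LeadP w.list (phiStar 6 w.list K.val) (lead w.list K.tri) c := by
  rw [minor_tri]
  exact minor_lead h.lt h.nodup K.distIn (h.foldl K.distIn)

theorem Word.Ok.valS_eq {w : Word} (h : w.Ok) (K : MI 6) :
    valS 6 w.list K.val = lead w.list K.tri := by
  obtain ⟨c, hc, hl⟩ := h.leadP K
  exact hl.minSupp_eq hc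

theorem Word.Ok.Psi_valS {w : Word} (h : w.Ok) (K : MI 6) :
    Psi (valS 6 w.list K.val) + 6 = K.val 0 + K.val 1 + K.val 2 := by
  obtain ⟨c, hc, hl⟩ := h.leadP K
  rw [minor_tri] at hl
  rw [h.valS_eq]
  exact (minor_supp h.lt K.distIn (hl.1 ▸ hc)).1

end Words

section Comparison

/-- The total exponent of the roots starting at `x`. -/
def src (S : List (ℕ × ℕ)) (x : ℕ) (a : (ℕ × ℕ) →₀ ℕ) : ℕ :=
  (S.map fun β => if β.1 = x then a β else 0).sum

/-- The total exponent of the roots ending at `x`. -/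
def tgt (S : List (ℕ × ℕ)) (x : ℕ) (a : (ℕ × ℕ) →₀ ℕ) : ℕ :=
  (S.map fun β => if β.2 = x then a β else 0).sum

theorem sum_map_single {S : List (ℕ × ℕ)} (hS : S.Nodup) {β : ℕ × ℕ} (hβ : β ∈ S) (u : ℕ)
    (p : ℕ × ℕ → Prop) [DecidablePred p] :
    (S.map fun γ => if p γ then Finsupp.single β u γ else 0).sum = if p β then u else 0 := by
  induction S with
  | nil => exact absurd hβ List.not_mem_nil
  | cons γ S ih =>
    rw [List.nodup_cons] at hS
    rw [List.map_cons, List.sum_cons]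
    rcases List.mem_cons.1 hβ with rfl | h
    · rw [List.sum_eq_zero, Finsupp.single_eq_same, add_zero]
      intro x hx
      obtain ⟨δ, hδ, rfl⟩ := List.mem_map.1 hx
      have : β ≠ δ := fun h => hS.1 (h ▸ hδ)
      rw [Finsupp.single_apply, if_neg this, ite_self]
    · have : β ≠ γ := fun h' => hS.1 (h' ▸ h)
      rw [ih hS.2 h, Finsupp.single_apply, if_neg this, ite_self, zero_add]

theorem sum_map_add (S : List (ℕ × ℕ)) (a b : (ℕ × ℕ) →₀ ℕ)
    (p : ℕ × ℕ → Prop) [DecidablePred p] :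
    (S.map fun γ => if p γ then (a + b) γ else 0).sum =
      (S.map fun γ => if p γ then a γ else 0).sum +
        (S.map fun γ => if p γ then b γ else 0).sum := by
  rw [← List.sum_map_add]
  congr 1
  refine List.map_congr_left fun γ _ => ?_
  split_ifs <;> simp

theorem step_conservation (t : ℕ × ℕ × ℕ) (x : ℕ) {β : ℕ × ℕ} (hβ : β.1 ≠ β.2) :
    (memT t x).toNat + (if β.1 = x then used t β else 0) =
      (memT (stepT t β) x).toNat + (if β.2 = x then used t β else 0) := by
  obtain ⟨p, q⟩ := β
  simp only at hβ
  rw [memT_stepT, used_eq]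
  have e1 : (x == p) = decide (p = x) := by
    rw [Bool.eq_iff_iff, beq_iff_eq, decide_eq_true_iff, eq_comm]
  have e2 : (x == q) = decide (q = x) := by
    rw [Bool.eq_iff_iff, beq_iff_eq, decide_eq_true_iff, eq_comm]
  rw [e1, e2]
  by_cases hp : p = x
  · subst hp
    simp only [hβ.symm, if_true, if_false, decide_true, decide_false]
    cases memT t p <;> cases memT t q <;> rfl
  · by_cases hq : q = x
    · subst hq
      simp only [hp, if_true, if_false, decide_true, decide_false]
      cases memT t p <;> cases memT t q <;> rfl
    · simp only [hp, hq, if_false, decide_false]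
      cases memT t p <;> cases memT t q <;> cases memT t x <;> rfl

theorem lead_conservation {S L : List (ℕ × ℕ)} (hS : S.Nodup) (hL : L ⊆ S)
    (hne : ∀ β ∈ L, β.1 ≠ β.2) (t : ℕ × ℕ × ℕ) (x : ℕ) :
    (memT t x).toNat + src S x (lead L t) =
      (memT (L.foldl stepT t) x).toNat + tgt S x (lead L t) := by
  induction L generalizing t with
  | nil => simp [lead, src, tgt]
  | cons β L ih =>
    rw [List.cons_subset] at hL
    have h1 := ih hL.2 (fun γ hγ => hne γ (List.mem_cons_of_mem _ hγ)) (stepT t β)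
    have h2 := step_conservation t x (hne β List.mem_cons_self)
    rw [src, tgt] at *
    rw [lead, sum_map_add, sum_map_add, sum_map_single hS hL.1, sum_map_single hS hL.1,
      List.foldl_cons]
    omega

theorem MSdot_apply (S : List (ℕ × ℕ)) (m : MI 6 →₀ ℕ) (β : ℕ × ℕ) :
    MSdot 6 S m β = Finsupp.weight (fun K : MI 6 => valS 6 S K.val β) m := by
  rw [MSdot, Finsupp.weight_apply, Finsupp.sum_apply]
  simp

theorem weight_fun_add {σ M : Type*} [AddCommMonoid M] (f g : σ → M) (m : σ →₀ ℕ) :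
    Finsupp.weight (fun K => f K + g K) m = Finsupp.weight f m + Finsupp.weight g m := by
  simp only [Finsupp.weight_apply, smul_add, Finsupp.sum_add]

theorem weight_fun_map {σ M N : Type*} [AddCommMonoid M] [AddCommMonoid N] (φ : M →+ N)
    (f : σ → M) (m : σ →₀ ℕ) :
    Finsupp.weight (fun K => φ (f K)) m = φ (Finsupp.weight f m) := by
  simp only [Finsupp.weight_apply, map_finsuppSum, map_nsmul]

theorem dK_apply (K : MI 6) (x : ℕ) : dK K x = (memT K.tri x).toNat := by
  have h1 := K.lt01
  have h2 := K.lt12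
  simp only [dK, Pi.add_apply, eN, memT, MI.tri]
  by_cases e1 : x = K.val 0
  · have : x ≠ K.val 1 := by omega
    have : x ≠ K.val 2 := by omega
    simp_all
  · by_cases e2 : x = K.val 1
    · have : x ≠ K.val 2 := by omega
      simp_all
    · by_cases e3 : x = K.val 2
      · simp_all
      · have e1 := beq_eq_false_iff_ne.2 e1
        have e2 := beq_eq_false_iff_ne.2 e2
        have e3 := beq_eq_false_iff_ne.2 e3
        have h : ∀ y, x ≠ y → (if x = y then 1 else 0) = 0 := fun y h => if_neg h
        rw [e1, e2, e3, h _ (beq_eq_false_iff_ne.1 e1), h _ (beq_eq_false_iff_ne.1 e2),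
          h _ (beq_eq_false_iff_ne.1 e3)]
        rfl

theorem weight_apply_fun (m : MI 6 →₀ ℕ) (x : ℕ) :
    Finsupp.weight dK m x = Finsupp.weight (fun K => (memT K.tri x).toNat) m := by
  have := weight_fun_map (Pi.evalAddMonoidHom (fun _ : ℕ => ℕ) x) dK m
  rw [← funext (fun K => dK_apply K x)]
  exact this.symm

/-- The labels on which the initial ideal of an iterated sequence depends. -/
def Word.lab (w : Word) : Lab := ⟨5, w.j₁, w.j₂, w.i₁, w.i₂, 6⟩

section

variable {w : Word} (K : MI 6)

theorem Word.Ok.val_one (h : w.Ok) : valS 6 w.list K.val (w.i₁, 6) = (wK w.lab K).1 := by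
  have hn := h.nodup
  rw [h.valS_eq]
  rw [Word.list] at *
  rw [List.nodup_cons] at hn
  rw [lead, Finsupp.add_apply, Finsupp.single_eq_same, lead_apply_of_notMem hn.1]
  rfl

theorem Word.Ok.val_two (h : w.Ok) : valS 6 w.list K.val (w.i₂, 6) = (wK w.lab K).2.1 := by
  have hn := h.nodup
  rw [h.valS_eq]
  unfold Word.Ok Triple at h
  rw [Word.list] at *
  simp only [List.nodup_cons] at hn
  rw [lead, lead, Finsupp.add_apply, Finsupp.add_apply, Finsupp.single_eq_same,
    lead_apply_of_notMem hn.2.1, Finsupp.single_apply, if_neg, used_second _ (by omega) (by omega)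
    (by omega), zero_add, add_zero]
  · rfl
  · rw [Prod.mk.injEq]; omega

theorem Word.Ok.val_three (h : w.Ok) : valS 6 w.list K.val (w.i₃, 6) =
    (memT K.tri 6 && memT K.tri w.i₁ && memT K.tri w.i₂).toNat := by
  have hn := h.nodup
  rw [h.valS_eq]
  unfold Word.Ok Triple at h
  rw [Word.list] at *
  simp only [List.nodup_cons] at hn
  rw [lead, lead, lead, Finsupp.add_apply, Finsupp.add_apply, Finsupp.add_apply,
    Finsupp.single_eq_same, lead_apply_of_notMem hn.2.2.1, Finsupp.single_apply, if_neg,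
    Finsupp.single_apply, if_neg, used_third _ (by omega) (by omega)
    (by omega) (by omega) (by omega) (by omega), zero_add, zero_add, add_zero]
  · rw [Prod.mk.injEq]; omega
  · rw [Prod.mk.injEq]; omega

theorem Word.Ok.memT_six (h : w.Ok) {z : ℕ} (hz : z ≠ 6) :
    memT (step3 K.tri 6 w.i₁ w.i₂ w.i₃) z =
      if memT K.tri 6 && memT K.tri w.i₁ && memT K.tri w.i₂ then
        z == w.i₁ || z == w.i₂ || z == w.i₃
      else (memT K.tri z && z != 6) || (memT K.tri 6 && !memT K.tri w.i₁ && z == w.i₁) ||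
        (memT K.tri 6 && memT K.tri w.i₁ && !memT K.tri w.i₂ && z == w.i₂) := by
  unfold Word.Ok Triple at h
  rw [memT_step3 _ (by omega) (by omega) (by omega) (by omega) (by omega) (by omega)]
  split_ifs with hd
  · simp only [Bool.and_eq_true] at hd
    obtain ⟨⟨h1, h2⟩, h3⟩ := hd
    rw [h1, h2, h3]
    simp only [Bool.not_true, Bool.and_false, Bool.false_and, Bool.or_false, Bool.true_and]
    rw [Bool.eq_iff_iff]
    have := K.distIn
    unfold DistIn at this
    simp only [memT, Bool.or_eq_true, beq_iff_eq, Bool.and_eq_true, bne_iff_ne] at *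
    omega
  · rw [Bool.not_eq_true] at hd
    rw [hd]
    simp

theorem Word.Ok.val_four (h : w.Ok) : valS 6 w.list K.val (w.j₁, 5) = (wK w.lab K).2.2.1 +
    ((5 == w.i₁ || 5 == w.i₂ || 5 == w.i₃) &&
      !(w.j₁ == w.i₁ || w.j₁ == w.i₂ || w.j₁ == w.i₃)).toNat *
      valS 6 w.list K.val (w.i₃, 6) := by
  have hn := h.nodup
  have e1 := h.memT_six K (z := 5) (by norm_num)
  have e2 := h.memT_six K (z := w.j₁) (by unfold Word.Ok Triple at h; omega)
  rw [h.val_three, h.valS_eq]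
  rw [Word.list] at *
  simp only [List.nodup_cons] at hn
  have hl : lead [(w.i₁, 6), (w.i₂, 6), (w.i₃, 6), (w.j₁, 5), (w.j₂, 5), (w.j₃, 5), (w.b₁, 4),
      (w.b₂, 4), (w.b₃, 4)] K.tri (w.j₁, 5) =
      used (step3 K.tri 6 w.i₁ w.i₂ w.i₃) (w.j₁, 5) := by
    simp only [lead, Finsupp.add_apply, step3, Finsupp.single_eq_same]
    have h0 := lead_apply_of_notMem hn.2.2.2.1
    simp only [lead, Finsupp.add_apply] at h0
    rw [h0, Finsupp.single_apply, if_neg (by rw [Prod.mk.injEq]; omega), Finsupp.single_apply,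
      if_neg (by rw [Prod.mk.injEq]; omega), Finsupp.single_apply,
      if_neg (by rw [Prod.mk.injEq]; omega)]
    omega
  rw [hl, used_eq, e1, e2]
  simp only [wK, Word.lab, wt]
  cases hd : memT K.tri 6 && memT K.tri w.i₁ && memT K.tri w.i₂ <;> simp

theorem Word.Ok.val_five (h : w.Ok) : valS 6 w.list K.val (w.j₂, 5) = (wK w.lab K).2.2.2 +
    ((5 == w.i₁ || 5 == w.i₂ || 5 == w.i₃) && (w.j₁ == w.i₁ || w.j₁ == w.i₂ || w.j₁ == w.i₃) &&
      !(w.j₂ == w.i₁ || w.j₂ == w.i₂ || w.j₂ == w.i₃)).toNat *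
      valS 6 w.list K.val (w.i₃, 6) := by
  have hn := h.nodup
  have e1 := h.memT_six K (z := 5) (by norm_num)
  have e2 := h.memT_six K (z := w.j₁) (by unfold Word.Ok Triple at h; omega)
  have e3 := h.memT_six K (z := w.j₂) (by unfold Word.Ok Triple at h; omega)
  rw [h.val_three, h.valS_eq]
  unfold Word.Ok Triple at h
  rw [Word.list] at *
  simp only [List.nodup_cons] at hn
  have hl : lead [(w.i₁, 6), (w.i₂, 6), (w.i₃, 6), (w.j₁, 5), (w.j₂, 5), (w.j₃, 5), (w.b₁, 4),
      (w.b₂, 4), (w.b₃, 4)] K.tri (w.j₂, 5) =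
      used (stepT (step3 K.tri 6 w.i₁ w.i₂ w.i₃) (w.j₁, 5)) (w.j₂, 5) := by
    simp only [lead, Finsupp.add_apply, step3, Finsupp.single_eq_same]
    have h0 := lead_apply_of_notMem hn.2.2.2.2.1
    simp only [lead, Finsupp.add_apply] at h0
    rw [h0, Finsupp.single_apply, if_neg (by rw [Prod.mk.injEq]; omega), Finsupp.single_apply,
      if_neg (by rw [Prod.mk.injEq]; omega), Finsupp.single_apply,
      if_neg (by rw [Prod.mk.injEq]; omega), Finsupp.single_apply,
      if_neg (by rw [Prod.mk.injEq]; omega)]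
    omega
  rw [hl, used_second _ (by omega) (by omega) (by omega), e1, e2, e3]
  simp only [wK, Word.lab, wt]
  cases hd : memT K.tri 6 && memT K.tri w.i₁ && memT K.tri w.i₂ <;> simp

theorem Word.Ok.conservation (h : w.Ok) (x : ℕ) :
    (memT K.tri x).toNat + src w.list x (valS 6 w.list K.val) =
      (if 1 ≤ x ∧ x ≤ 3 then 1 else 0) + tgt w.list x (valS 6 w.list K.val) := by
  rw [h.valS_eq, lead_conservation h.nodup (List.Subset.refl _) (fun β hβ => (h.lt β hβ).2.1.ne)]
  congr 1
  have := h.foldl K.distIn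
  unfold DistIn at this
  split_ifs with hx
  · rw [show memT (w.list.foldl stepT K.tri) x = true by
      simp only [memT, Bool.or_eq_true, beq_iff_eq]; omega]
    rfl
  · rw [show memT (w.list.foldl stepT K.tri) x = false by
      simp only [memT, Bool.or_eq_false_iff, beq_eq_false_iff_ne]; omega]
    rfl

end

theorem weight_fun_mul {σ : Type*} (u : ℕ) (f : σ → ℕ) (m : σ →₀ ℕ) :
    Finsupp.weight (fun K => u * f K) m = u * Finsupp.weight f m :=
  weight_fun_map (AddMonoidHom.mulLeft u) f m

theorem W_fst (τ : Lab) (m : MI 6 →₀ ℕ) :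
    (W τ m).1 = Finsupp.weight (fun K => (wK τ K).1) m :=
  (weight_fun_map (AddMonoidHom.fst ℕ (ℕ × ℕ × ℕ)) (wK τ) m).symm

theorem W_snd (τ : Lab) (m : MI 6 →₀ ℕ) :
    (W τ m).2.1 = Finsupp.weight (fun K => (wK τ K).2.1) m :=
  (weight_fun_map ((AddMonoidHom.fst ℕ (ℕ × ℕ)).comp (AddMonoidHom.snd ℕ (ℕ × ℕ × ℕ)))
    (wK τ) m).symm

theorem W_third (τ : Lab) (m : MI 6 →₀ ℕ) :
    (W τ m).2.2.1 = Finsupp.weight (fun K => (wK τ K).2.2.1) m :=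
  (weight_fun_map (((AddMonoidHom.fst ℕ ℕ).comp (AddMonoidHom.snd ℕ (ℕ × ℕ))).comp
    (AddMonoidHom.snd ℕ (ℕ × ℕ × ℕ))) (wK τ) m).symm

theorem W_fourth (τ : Lab) (m : MI 6 →₀ ℕ) :
    (W τ m).2.2.2 = Finsupp.weight (fun K => (wK τ K).2.2.2) m :=
  (weight_fun_map (((AddMonoidHom.snd ℕ ℕ).comp (AddMonoidHom.snd ℕ (ℕ × ℕ))).comp
    (AddMonoidHom.snd ℕ (ℕ × ℕ × ℕ))) (wK τ) m).symm

theorem MSdot_sum (S : List (ℕ × ℕ)) (m : MI 6 →₀ ℕ) (p : ℕ × ℕ → Prop) [DecidablePred p] :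
    (S.map fun β => if p β then MSdot 6 S m β else 0).sum = Finsupp.weight (fun K : MI 6 =>
      (S.map fun β => if p β then valS 6 S K.val β else 0).sum) m := by
  let φ : ((ℕ × ℕ) →₀ ℕ) →+ ℕ :=
    { toFun := fun a => (S.map fun β => if p β then a β else 0).sum
      map_zero' := by simp
      map_add' := fun a b => sum_map_add S a b p }
  have := weight_fun_map φ (fun K : MI 6 => valS 6 S K.val) m
  exact this.symm

theorem Word.Ok.MSdot_conservation {w : Word} (h : w.Ok) (m : MI 6 →₀ ℕ) (x : ℕ) :
    Finsupp.weight dK m x + src w.list x (MSdot 6 w.list m) =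
      (if 1 ≤ x ∧ x ≤ 3 then 1 else 0) * m.degree + tgt w.list x (MSdot 6 w.list m) := by
  rw [weight_apply_fun, src, tgt, MSdot_sum, MSdot_sum, Finsupp.degree_eq_weight_one,
    ← weight_fun_add, ← weight_fun_mul, ← weight_fun_add]
  refine congrArg (fun f => Finsupp.weight f m) (funext fun K => ?_)
  rw [mul_one]
  exact h.conservation K x

theorem three_mul_degree (m : MI 6 →₀ ℕ) :
    3 * m.degree = ∑ x ∈ Finset.Icc 1 6, Finsupp.weight dK m x := by
  let φ : (ℕ → ℕ) →+ ℕ :=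
    { toFun := fun f => ∑ x ∈ Finset.Icc 1 6, f x
      map_zero' := by simp
      map_add' := fun a b => Finset.sum_add_distrib }
  have := weight_fun_map φ dK m
  rw [Finsupp.degree_eq_weight_one, ← weight_fun_mul]
  refine Eq.trans ?_ this
  refine congrArg (fun f => Finsupp.weight f m) (funext fun K => ?_)
  have h1 := K.lt01
  have h2 := K.lt12
  have h3 := K.range
  have key : ∀ x, 1 ≤ x → x ≤ 6 → ∑ y ∈ Finset.Icc 1 6, eN x y = 1 := fun x hx hx' => by
    simp only [eN]
    rw [Finset.sum_ite_eq' _ x, if_pos (Finset.mem_Icc.2 ⟨hx, hx'⟩)]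
  change 3 * 1 = ∑ x ∈ Finset.Icc 1 6, (eN (K.val 0) x + eN (K.val 1) x + eN (K.val 2) x)
  rw [Finset.sum_add_distrib, Finset.sum_add_distrib, key, key, key] <;> omega

theorem degree_eq_of_weight_eq {m m' : MI 6 →₀ ℕ}
    (h : Finsupp.weight dK m = Finsupp.weight dK m') : m.degree = m'.degree := by
  have h1 := three_mul_degree m
  rw [h, ← three_mul_degree] at h1
  omega

set_option maxHeartbeats 1000000 in
theorem Word.Ok.Psi_MSdot {w : Word} (h : w.Ok) (m : MI 6 →₀ ℕ) :
    Psi (MSdot 6 w.list m) + 6 * m.degree =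
      ∑ x ∈ Finset.Icc 1 6, x * Finsupp.weight dK m x := by
  let ψ : ((ℕ × ℕ) →₀ ℕ) →+ ℕ := ⟨⟨Psi, Psi_zero⟩, Psi_add⟩
  let φ : (ℕ → ℕ) →+ ℕ :=
    { toFun := fun f => ∑ x ∈ Finset.Icc 1 6, x * f x
      map_zero' := by simp
      map_add' := fun a b => by simp [mul_add, Finset.sum_add_distrib] }
  have e1 := weight_fun_map φ dK m
  have e2 := weight_fun_map ψ (fun K : MI 6 => valS 6 w.list K.val) m
  change _ = Psi (MSdot 6 w.list m) at e2
  rw [← e2, Finsupp.degree_eq_weight_one, ← weight_fun_mul, ← weight_fun_add]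
  refine Eq.trans ?_ e1
  refine congrArg (fun f => Finsupp.weight f m) (funext fun K => ?_)
  have h1 := K.lt01
  have h2 := K.lt12
  have h3 := K.range
  have key : ∀ x, 1 ≤ x → x ≤ 6 → ∑ y ∈ Finset.Icc 1 6, y * eN x y = x := fun x hx hx' => by
    simp only [eN, mul_ite, mul_one, mul_zero]
    rw [Finset.sum_ite_eq' _ x, if_pos (Finset.mem_Icc.2 ⟨hx, hx'⟩)]
  change Psi (valS 6 w.list K.val) + 6 * 1 =
    ∑ x ∈ Finset.Icc 1 6, x * (eN (K.val 0) x + eN (K.val 1) x + eN (K.val 2) x)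
  simp only [mul_add]
  rw [Finset.sum_add_distrib, Finset.sum_add_distrib, key, key, key, ← h.Psi_valS] <;> omega

set_option maxHeartbeats 1000000 in
theorem Word.Ok.psiLE_iff {w : Word} (h : w.Ok) {m m' : MI 6 →₀ ℕ}
    (hd : Finsupp.weight dK m = Finsupp.weight dK m') :
    psiLE w.list (MSdot 6 w.list m) (MSdot 6 w.list m') ↔ leL w.lab m m' := by
  have hdeg := degree_eq_of_weight_eq hd
  have hPsi : Psi (MSdot 6 w.list m) = Psi (MSdot 6 w.list m') := by
    have e1 := h.Psi_MSdot m
    have e2 := h.Psi_MSdot m'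
    rw [hd] at e1
    omega
  have c := fun x => h.MSdot_conservation m x
  have c' := fun x => h.MSdot_conservation m' x
  have v1 : ∀ m, MSdot 6 w.list m (w.i₁, 6) = (W w.lab m).1 := fun m => by
    rw [MSdot_apply, W_fst, funext fun K => h.val_one K]
  have v2 : ∀ m, MSdot 6 w.list m (w.i₂, 6) = (W w.lab m).2.1 := fun m => by
    rw [MSdot_apply, W_snd, funext fun K => h.val_two K]
  obtain ⟨u, v4⟩ : ∃ u, ∀ m, MSdot 6 w.list m (w.j₁, 5) =
      (W w.lab m).2.2.1 + u * MSdot 6 w.list m (w.i₃, 6) := ⟨_, fun m => by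
    rw [MSdot_apply, W_third, MSdot_apply, ← weight_fun_mul, ← weight_fun_add]
    exact congrArg (fun f => Finsupp.weight f m) (funext fun K => h.val_four K)⟩
  obtain ⟨v, v5⟩ : ∃ u, ∀ m, MSdot 6 w.list m (w.j₂, 5) =
      (W w.lab m).2.2.2 + u * MSdot 6 w.list m (w.i₃, 6) := ⟨_, fun m => by
    rw [MSdot_apply, W_fourth, MSdot_apply, ← weight_fun_mul, ← weight_fun_add]
    exact congrArg (fun f => Finsupp.weight f m) (funext fun K => h.val_five K)⟩
  rw [hd, hdeg] at c
  have v1m := v1 m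
  have v2m := v2 m
  have v4m := v4 m
  have v5m := v5 m
  have v1m' := v1 m'
  have v2m' := v2 m'
  have v4m' := v4 m'
  have v5m' := v5 m'
  rw [psiLE, leL, lex4, hPsi]
  simp only [lt_irrefl, true_and, false_or]
  generalize MSdot 6 w.list m = a at *
  generalize MSdot 6 w.list m' = a' at *
  generalize W w.lab m = p at *
  generalize W w.lab m' = p' at *
  have hw := h
  unfold Word.Ok Triple at hw
  have c6 := c 6
  have c6' := c' 6
  have c5 := c 5
  have c5' := c' 5
  simp only [src, tgt, Word.list, List.map_cons, List.map_nil, List.sum_cons, List.sum_nil]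
    at c6 c6' c5 c5'
  have hb : ∀ b, 1 ≤ b → b ≤ 3 → a (w.i₁, 6) = a' (w.i₁, 6) → a (w.i₂, 6) = a' (w.i₂, 6) →
      a (w.i₃, 6) = a' (w.i₃, 6) → a (w.j₁, 5) = a' (w.j₁, 5) → a (w.j₂, 5) = a' (w.j₂, 5) →
      a (w.j₃, 5) = a' (w.j₃, 5) → a (b, 4) = a' (b, 4) := by
    intro b hb1 hb3 e1 e2 e3 e4 e5 e6
    have cb := c b
    have cb' := c' b
    simp only [src, tgt, Word.list, List.map_cons, List.map_nil, List.sum_cons, List.sum_nil,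
      e1, e2, e3, e4, e5, e6] at cb cb'
    simp only [if_neg (by omega : ¬ 6 = b), if_neg (by omega : ¬ 5 = b),
      if_neg (by omega : ¬ 4 = b)] at cb cb'
    have : b = w.b₁ ∨ b = w.b₂ ∨ b = w.b₃ := by omega
    rcases this with rfl | rfl | rfl
    · rw [if_pos rfl, if_neg (by omega : ¬ w.b₂ = w.b₁), if_neg (by omega : ¬ w.b₃ = w.b₁)]
        at cb cb'
      clear c5 c5' c6 c6' v1m v2m v4m v5m v1m' v2m' v4m' v5m' e1 e2 e3 e4 e5 e6 hw
      linarith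
    · rw [if_pos rfl, if_neg (by omega : ¬ w.b₁ = w.b₂), if_neg (by omega : ¬ w.b₃ = w.b₂)]
        at cb cb'
      clear c5 c5' c6 c6' v1m v2m v4m v5m v1m' v2m' v4m' v5m' e1 e2 e3 e4 e5 e6 hw
      linarith
    · rw [if_pos rfl, if_neg (by omega : ¬ w.b₁ = w.b₃), if_neg (by omega : ¬ w.b₂ = w.b₃)]
        at cb cb'
      clear c5 c5' c6 c6' v1m v2m v4m v5m v1m' v2m' v4m' v5m' e1 e2 e3 e4 e5 e6 hw
      linarith
  have hb1 := hb w.b₁ (by omega) (by omega)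
  have hb2 := hb w.b₂ (by omega) (by omega)
  have hb3 := hb w.b₃ (by omega) (by omega)
  have h3 : a (w.i₁, 6) = a' (w.i₁, 6) → a (w.i₂, 6) = a' (w.i₂, 6) →
      a (w.i₃, 6) = a' (w.i₃, 6) := by
    intro e1 e2
    simp only [e1, e2, if_neg (by omega : ¬ w.i₁ = 6), if_neg (by omega : ¬ w.i₂ = 6),
      if_neg (by omega : ¬ w.i₃ = 6), if_neg (by omega : ¬ w.j₁ = 6),
      if_neg (by omega : ¬ w.j₂ = 6),
      if_neg (by omega : ¬ w.j₃ = 6), if_neg (by omega : ¬ w.b₁ = 6),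
      if_neg (by omega : ¬ w.b₂ = 6),
      if_neg (by omega : ¬ w.b₃ = 6), if_true, if_neg (by omega : ¬ 5 = 6),
      if_neg (by omega : ¬ 4 = 6)] at c6 c6'
    omega
  have h6 : a (w.i₁, 6) = a' (w.i₁, 6) → a (w.i₂, 6) = a' (w.i₂, 6) →
      a (w.i₃, 6) = a' (w.i₃, 6) → a (w.j₁, 5) = a' (w.j₁, 5) → a (w.j₂, 5) = a' (w.j₂, 5) →
      a (w.j₃, 5) = a' (w.j₃, 5) := by
    intro e1 e2 e3 e4 e5
    simp only [e1, e2, e3, e4, e5, if_neg (by omega : ¬ w.j₁ = 5), if_neg (by omega : ¬ w.j₂ = 5),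
      if_neg (by omega : ¬ w.j₃ = 5), if_neg (by omega : ¬ w.b₁ = 5),
      if_neg (by omega : ¬ w.b₂ = 5),
      if_neg (by omega : ¬ w.b₃ = 5), if_true, if_neg (by omega : ¬ 6 = 5),
      if_neg (by omega : ¬ 4 = 5)] at c5 c5'
    omega
  clear c c' c5 c5' c6 c6' hb hw v1 v2 v4 v5
  simp only [Word.list, lexLE_cons, lexLE_nil, and_true]
  by_cases q1 : a (w.i₁, 6) = a' (w.i₁, 6)
  swap
  · omega
  by_cases q2 : a (w.i₂, 6) = a' (w.i₂, 6)
  swap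
  · omega
  have q3 := h3 q1 q2
  rw [q3] at v4m v5m
  by_cases q4 : a (w.j₁, 5) = a' (w.j₁, 5)
  swap
  · clear hb1 hb2 hb3 h6 h3
    generalize u * a' (w.i₃, 6) = z at *
    omega
  by_cases q5 : a (w.j₂, 5) = a' (w.j₂, 5)
  swap
  · clear hb1 hb2 hb3 h6 h3
    generalize u * a' (w.i₃, 6) = z at *
    generalize v * a' (w.i₃, 6) = z' at *
    omega
  have q6 := h6 q1 q2 q3 q4 q5
  have q7 := hb1 q1 q2 q3 q4 q5 q6
  have q8 := hb2 q1 q2 q3 q4 q5 q6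
  have q9 := hb3 q1 q2 q3 q4 q5 q6
  clear hb1 hb2 hb3 h6 h3
  generalize u * a' (w.i₃, 6) = z at *
  generalize v * a' (w.i₃, 6) = z' at *
  omega

end Comparison

section Toric

theorem Word.Ok.InIdeal_eq {w : Word} (h : w.Ok) : InIdeal 6 w.list = In w.lab := by
  have h1 := InI_congr (le := fun m m' => psiLE w.list (MSdot 6 w.list m) (MSdot 6 w.list m'))
    (le' := leL w.lab) dK (fun a b c => psiLE_trans) (leL_trans w.lab) Rrel_hom
  rw [InIdeal_eq_InI, In, PluckerIdeal]
  exact h1 fun m m' hm => h.psiLE_iff hm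

/-- The pullback of the Plücker algebra to the polynomial ring in the coordinates `x_β`. -/
noncomputable def pull (S : List (ℕ × ℕ)) : PRing 6 →ₐ[ℂ] MvPolynomial (ℕ × ℕ) ℂ :=
  aeval fun K => phiStar 6 S K.val

theorem minor_swap12 (S : List (ℕ × ℕ)) (a b c : ℕ) : minor S (b, a, c) = -minor S (a, b, c) := by
  simp only [minor_eq]; ring

theorem minor_swap23 (S : List (ℕ × ℕ)) (a b c : ℕ) : minor S (a, c, b) = -minor S (a, b, c) := by
  simp only [minor_eq]; ring

theorem pull_P (S : List (ℕ × ℕ)) {a b c : ℕ} (ha : 1 ≤ a ∧ a ≤ 6) (hb : 1 ≤ b ∧ b ≤ 6)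
    (hc : 1 ≤ c ∧ c ≤ 6) : pull S (P a b c) = minor S (a, b, c) := by
  have h0 : ∀ a b c, (1 ≤ a ∧ a ≤ 6) → (1 ≤ b ∧ b ≤ 6) → (1 ≤ c ∧ c ≤ 6) → a < b → b < c →
      pull S (P a b c) = minor S (a, b, c) := by
    intro a b c ha hb hc h1 h2
    have hs : Sorted 3 6 ![a, b, c] := (sorted3_iff _ _ _ _).2 ⟨h1, h2, ha.1, hc.2⟩
    rw [P_of_lt h1 h2, pvar, dif_pos hs, pull, aeval_X]
    rfl
  have h1 : ∀ a b c, (1 ≤ a ∧ a ≤ 6) → (1 ≤ b ∧ b ≤ 6) → (1 ≤ c ∧ c ≤ 6) → a < b →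
      pull S (P a b c) = minor S (a, b, c) := by
    intro a b c ha hb hc hab
    rcases lt_trichotomy b c with h | rfl | h
    · exact h0 a b c ha hb hc hab h
    · rw [P_self23, map_zero, minor_eq]; ring
    · rw [← neg_inj, ← map_neg, ← P_swap23, ← minor_swap23]
      rcases lt_trichotomy a c with h' | rfl | h'
      · exact h0 a c b ha hc hb h' h
      · rw [P_self12, map_zero, minor_eq]; ring
      · rw [← neg_inj, ← map_neg, ← P_swap12, ← minor_swap12]
        exact h0 c a b hc ha hb h' hab
  rcases lt_trichotomy a b with h | rfl | h
  · exact h1 a b c ha hb hc h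
  · rw [P_self12, map_zero, minor_eq]; ring
  · rw [← neg_inj, ← map_neg, ← P_swap12, ← minor_swap12]
    exact h1 b a c hb ha hc h

theorem pull_eq_zero (S : List (ℕ × ℕ)) {f : PRing 6} (hf : f ∈ PluckerIdeal 6) :
    pull S f = 0 := by
  have : PluckerIdeal 6 ≤ RingHom.ker (pull S) := by
    apply Ideal.span_le.2
    rintro _ ⟨I, J, hI, hJ, rfl⟩
    rw [SetLike.mem_coe, RingHom.mem_ker, Rrel_eq_neg_Ralt hI hJ, Ralt]
    simp only [map_neg, map_add, map_sub, map_mul, pull_P S (hI.2 0) (hI.2 1) (hJ.2 _),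
      pull_P S (hJ.2 _) (hJ.2 _) (hJ.2 _), minor_eq]
    ring
  exact this hf

/-- A ring homomorphism whose kernel contains an initial ideal. -/
noncomputable def toricHom (v : MI 6 → (ℕ × ℕ) →₀ ℕ) (c : MI 6 → ℂ) :
    PRing 6 →ₐ[ℂ] MvPolynomial (ℕ × ℕ) ℂ :=
  aeval fun K => monomial (v K) (c K)

theorem toricHom_monomial (v : MI 6 → (ℕ × ℕ) →₀ ℕ) (c : MI 6 → ℂ) (m : MI 6 →₀ ℕ) (a : ℂ) :
    toricHom v c (monomial m a) =
      monomial (m.sum fun K e => e • v K) (a * m.prod fun K e => c K ^ e) := by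
  rw [toricHom, aeval_monomial, algebraMap_eq, Finsupp.prod]
  simp only [monomial_pow]
  rw [← monomial_sum_prod, C_mul_monomial]
  rfl

theorem pull_leadP {S : List (ℕ × ℕ)} {c : MI 6 → ℂ}
    (h : ∀ K : MI 6, LeadP S (phiStar 6 S K.val) (valS 6 S K.val) (c K)) (m : MI 6 →₀ ℕ) :
    LeadP S (pull S (monomial m 1)) (MSdot 6 S m) (m.prod fun K e => c K ^ e) := by
  rw [pull, aeval_monomial, map_one, one_mul]
  exact LeadP.prod _ fun K _ => (h K).pow _

theorem topPart_mem_ker {S : List (ℕ × ℕ)} {c : MI 6 → ℂ}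
    (h : ∀ K : MI 6, LeadP S (phiStar 6 S K.val) (valS 6 S K.val) (c K)) {f : PRing 6}
    (hf : f ∈ PluckerIdeal 6) :
    toricHom (fun K => valS 6 S K.val) c
      (topPart (fun m m' => psiLE S (MSdot 6 S m) (MSdot 6 S m')) f) = 0 := by
  classical
  ext e
  rw [coeff_zero, topPart, map_sum, coeff_sum]
  simp only [toricHom_monomial, coeff_monomial]
  rw [← Finset.sum_filter]
  by_cases he : ∃ m₀ ∈ f.support, MSdot 6 S m₀ = e ∧ ∀ m' ∈ f.support,
    psiLE S (MSdot 6 S m₀) (MSdot 6 S m')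
  swap
  · rw [Finset.filter_eq_empty_iff.2, Finset.sum_empty]
    intro m hm hm'
    rw [Finset.mem_filter] at hm
    exact he ⟨m, hm.1, hm', hm.2⟩
  obtain ⟨m₀, hm₀, rfl, hmin⟩ := he
  have h0 := congrArg (coeff (MSdot 6 S m₀)) (pull_eq_zero S hf)
  rw [f.as_sum, map_sum, coeff_sum, coeff_zero] at h0
  rw [← h0]
  rw [Finset.sum_filter, Finset.sum_filter]
  refine Finset.sum_congr rfl fun m hm => ?_
  have hl := pull_leadP h m
  rw [show (monomial m) (coeff m f) = C (coeff m f) * monomial m 1 by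
    rw [C_mul_monomial, mul_one], map_mul, ← algebraMap_eq, AlgHom.commutes, algebraMap_eq,
    coeff_C_mul]
  by_cases hme : MSdot 6 S m = MSdot 6 S m₀
  · have : (m.sum fun K e => e • valS 6 S K.val) = MSdot 6 S m₀ := hme
    rw [if_pos (hme ▸ hmin), if_pos this, ← hme, hl.1]
  · have : ¬ (m.sum fun K e => e • valS 6 S K.val) = MSdot 6 S m₀ := hme
    rw [if_neg this, ite_self]
    rw [eq_comm, mul_eq_zero]
    right
    by_contra hc
    rcases hl.2 _ hc with h1 | h1
    · exact hme h1.symm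
    · exact not_psiLT_of_psiLE (hmin m hm) h1

theorem Word.Ok.InIdeal_le_ker {w : Word} (h : w.Ok) : ∃ c : MI 6 → ℂ, (∀ K, c K ≠ 0) ∧
    ∀ f ∈ In w.lab, toricHom (fun K => valS 6 w.list K.val) c f = 0 := by
  choose c hc hl using h.leadP
  refine ⟨c, hc, fun f hf => ?_⟩
  have hl' : ∀ K : MI 6, LeadP w.list (phiStar 6 w.list K.val) (valS 6 w.list K.val) (c K) :=
    fun K => by rw [h.valS_eq]; exact hl K
  rw [← h.InIdeal_eq, InIdeal_eq_InI] at hf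
  have : InI (fun m m' => psiLE w.list (MSdot 6 w.list m) (MSdot 6 w.list m')) (PluckerIdeal 6) ≤
      RingHom.ker (toricHom (fun K => valS 6 w.list K.val) c) := by
    apply Ideal.span_le.2
    rintro _ ⟨g, hg, -, rfl⟩
    exact topPart_mem_ker hl' hg
  exact this hf

/-- The initial ideal contains no monomials, and only homogeneous binomials. -/
def Toric (τ : Lab) : Prop :=
  (∀ t, monomial t (1 : ℂ) ∉ In τ) ∧
    ∀ t t' c, monomial t (1 : ℂ) + monomial t' c ∈ In τ → W τ t = W τ t'

theorem Word.Ok.W_eq {w : Word} (h : w.Ok) {m m' : MI 6 →₀ ℕ}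
    (he : MSdot 6 w.list m = MSdot 6 w.list m') : W w.lab m = W w.lab m' := by
  have h1 : ∀ β, Finsupp.weight (fun K : MI 6 => valS 6 w.list K.val β) m =
      Finsupp.weight (fun K : MI 6 => valS 6 w.list K.val β) m' := fun β => by
    rw [← MSdot_apply, ← MSdot_apply, he]
  have e1 := h1 (w.i₁, 6)
  have e2 := h1 (w.i₂, 6)
  have e3 := h1 (w.i₃, 6)
  have e4 := h1 (w.j₁, 5)
  have e5 := h1 (w.j₂, 5)
  rw [funext fun K => h.val_one K, ← W_fst, ← W_fst] at e1
  rw [funext fun K => h.val_two K, ← W_snd, ← W_snd] at e2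
  rw [funext fun K => h.val_four K, weight_fun_add, weight_fun_add, weight_fun_mul,
    weight_fun_mul, e3, ← W_third, ← W_third] at e4
  rw [funext fun K => h.val_five K, weight_fun_add, weight_fun_add, weight_fun_mul,
    weight_fun_mul, e3, ← W_fourth, ← W_fourth] at e5
  exact Prod.ext e1 (Prod.ext e2 (Prod.ext (Nat.add_right_cancel e4) (Nat.add_right_cancel e5)))

theorem Word.Ok.toric {w : Word} (h : w.Ok) : Toric w.lab := by
  classical
  obtain ⟨c, hc, hk⟩ := h.InIdeal_le_ker
  have hne : ∀ m : MI 6 →₀ ℕ, (m.prod fun K e => c K ^ e) ≠ 0 := fun m =>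
    Finset.prod_ne_zero_iff.2 fun K _ => pow_ne_zero _ (hc K)
  refine ⟨fun t ht => ?_, fun t t' a ht => h.W_eq ?_⟩
  · have := hk _ ht
    rw [toricHom_monomial, monomial_eq_zero, one_mul] at this
    exact hne t this
  · by_contra hcon
    have := congrArg (coeff (MSdot 6 w.list t)) (hk _ ht)
    rw [map_add, toricHom_monomial, toricHom_monomial, coeff_add, coeff_zero, one_mul] at this
    change coeff _ (monomial (MSdot 6 w.list t) _) + coeff _ (monomial (MSdot 6 w.list t') _) = 0
      at this
    rw [coeff_monomial, coeff_monomial, if_pos rfl, if_neg fun e => hcon e.symm, add_zero] at this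
    exact hne t this

theorem Toric.map {i : ℕ} (h1 : 1 ≤ i) (h5 : i ≤ 5) {τ : Lab} (h : Toric τ) :
    Toric (τ.map (tr i)) := by
  have hu := trSign_prod_ne_zero i
  have hW : ∀ t, W (τ.map (tr i)) t = W τ (t.mapDomain (trK i h1 h5)) := fun t => by
    rw [← W_map_tr h1 h5 τ, mapDomain_trK_involutive h1 h5]
  refine ⟨fun t ht => ?_, fun t t' c ht => ?_⟩
  · rw [← map_sAuto_In h1 h5, mem_map_sAuto h1 h5, sAuto_monomial h1 h5, mul_one] at ht
    refine h.1 (t.mapDomain (trK i h1 h5)) ?_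
    have := (In τ).mul_mem_left (C (t.prod fun K e => (trSign i K : ℂ) ^ e)⁻¹) ht
    rwa [C_mul_monomial, inv_mul_cancel₀ (hu t)] at this
  · rw [← map_sAuto_In h1 h5, mem_map_sAuto h1 h5, map_add, sAuto_monomial h1 h5,
      sAuto_monomial h1 h5, mul_one] at ht
    rw [hW, hW]
    have := (In τ).mul_mem_left (C (t.prod fun K e => (trSign i K : ℂ) ^ e)⁻¹) ht
    rw [mul_add, C_mul_monomial, inv_mul_cancel₀ (hu t), C_mul_monomial] at this
    exact h.2 _ _ _ this

end Toric

section Rewriting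

theorem insertionSort_three (a b c : ℕ) :
    ∃ x y z, List.insertionSort (· ≤ ·) [a, b, c] = [x, y, z] ∧
    [x, y, z].Perm [a, b, c] ∧ sort3 ![a, b, c] = ![x, y, z] ∧ x ≤ y ∧ y ≤ z := by
  have hl : (List.insertionSort (· ≤ ·) [a, b, c]).length = 3 := by
    rw [List.length_insertionSort]; rfl
  obtain ⟨x, y, z, e⟩ := List.length_eq_three.1 hl
  have hp := List.pairwise_insertionSort (· ≤ ·) [a, b, c]
  rw [e] at hp
  refine ⟨x, y, z, e, e ▸ List.perm_insertionSort _ _, ?_, ?_, ?_⟩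
  · have e' : ∀ i, sort3 ![a, b, c] i = [x, y, z].getD i 0 := fun i => by rw [← e]; rfl
    rw [eq_vec3 (sort3 ![a, b, c]), e', e', e']
    rfl
  · simp at hp; omega
  · simp at hp; omega

theorem memT_sort3 (a b c : ℕ) : memT (sort3 ![a, b, c] 0, sort3 ![a, b, c] 1, sort3 ![a, b, c] 2) =
    memT (a, b, c) := by
  obtain ⟨x, y, z, -, hp, e, -, -⟩ := insertionSort_three a b c
  rw [e]
  funext u
  have := hp.mem_iff (a := u)
  rw [Bool.eq_iff_iff]
  simp only [List.mem_cons, List.not_mem_nil, or_false] at this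
  simpa [memT, or_assoc] using this

theorem P_wK_hom (τ : Lab) (a b c : ℕ) :
    IsWeightedHomogeneous (wK τ) (P a b c) (wt τ (memT (a, b, c))) := by
  rw [P, ← memT_sort3, ← mem_weightedHomogeneousSubmodule ℂ, ← zsmul_eq_mul]
  apply zsmul_mem
  rw [pvar]
  split_ifs with h
  · exact isWeightedHomogeneous_X ℂ (wK τ) (⟨_, h⟩ : MI 6)
  · exact zero_mem _

/-- The triple `t` contains `x`, `y` and `z`. -/
def hits (t : ℕ × ℕ × ℕ) (x y z : ℕ) : Bool := memT t x && memT t y && memT t z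

/-- Three distinct entries in `{1, …, 6}`. -/
def Distinct3 (a b c : ℕ) : Prop :=
  (1 ≤ a ∧ a ≤ 6) ∧ (1 ≤ b ∧ b ≤ 6) ∧ (1 ≤ c ∧ c ≤ 6) ∧ a ≠ b ∧ a ≠ c ∧ b ≠ c

instance (a b c : ℕ) : Decidable (Distinct3 a b c) :=
  inferInstanceAs (Decidable (_ ∧ _ ∧ _ ∧ _ ∧ _ ∧ _))

theorem P_eq_C_mul_X {a b c : ℕ} (h : Distinct3 a b c) :
    ∃ K : MI 6, ∃ ε : ℂ, ε ≠ 0 ∧ P a b c = C ε * X K ∧ memT K.tri = memT (a, b, c) := by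
  obtain ⟨ha, hb, hc, h1, h2, h3⟩ := h
  obtain ⟨x, y, z, -, hp, e, hxy, hyz⟩ := insertionSort_three a b c
  have hn : [x, y, z].Nodup := hp.nodup_iff.2 (by simp [*])
  have hx := hp.mem_iff (a := x)
  have hz := hp.mem_iff (a := z)
  simp at hn hx hz
  have hs : Sorted 3 6 (sort3 ![a, b, c]) := by
    rw [e, sorted3_iff]
    omega
  refine ⟨⟨_, hs⟩, ((sg a b * sg a c * sg b c : ℤ) : ℂ), ?_, ?_, memT_sort3 a b c⟩
  · rw [Int.cast_ne_zero]
    have h1 := sg_sq h1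
    have h2 := sg_sq h2
    have h3 := sg_sq h3
    intro h0
    have : (sg a b * sg a b) * (sg a c * sg a c) * (sg b c * sg b c) = 0 := by
      rw [show (sg a b * sg a b) * (sg a c * sg a c) * (sg b c * sg b c) =
        (sg a b * sg a c * sg b c) * (sg a b * sg a c * sg b c) by ring, h0, mul_zero]
    rw [h1, h2, h3] at this
    norm_num at this
  · rw [P, pvar, dif_pos hs, map_intCast]

theorem MI.eq_of_hits {K : MI 6} {a b c : ℕ} (h : Distinct3 a b c) (hK : hits K.tri a b c) :
    memT K.tri = memT (a, b, c) := by
  unfold Distinct3 at h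
  simp only [hits, memT, Bool.and_eq_true, Bool.or_eq_true, beq_iff_eq] at hK
  funext x
  rw [Bool.eq_iff_iff]
  simp only [memT, Bool.or_eq_true, beq_iff_eq]
  omega

theorem MI.eq_of_memT {K K' : MI 6} (h : memT K.tri = memT K'.tri) : K = K' := by
  have e : ∀ x, (x = K.val 0 ∨ x = K.val 1) ∨ x = K.val 2 ↔
      (x = K'.val 0 ∨ x = K'.val 1) ∨ x = K'.val 2 := fun x => by
    have := congrFun h x
    rw [Bool.eq_iff_iff] at this
    simpa [memT, MI.tri] using this
  have h01 := K.lt01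
  have h12 := K.lt12
  have h01' := K'.lt01
  have h12' := K'.lt12
  have a0 := (e (K.val 0)).1 (by omega)
  have a1 := (e (K.val 1)).1 (by omega)
  have a2 := (e (K.val 2)).1 (by omega)
  clear h e
  apply MI.ext3 <;> omega

/-- A quadratic relation: the leading terms of `Ralt b c d e f g` are the first two. -/
structure Rule where
  b : ℕ
  c : ℕ
  d : ℕ
  e : ℕ
  f : ℕ
  g : ℕ

/-- The leading binomial of a relation. -/
noncomputable def Rule.poly (ρ : Rule) : PRing 6 :=
  P ρ.b ρ.c ρ.d * P ρ.e ρ.f ρ.g - P ρ.b ρ.c ρ.e * P ρ.d ρ.f ρ.g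

/-- The weight of `P a b c * P x y z`. -/
def wt2 (τ : Lab) (a b c x y z : ℕ) : ℕ × ℕ × ℕ × ℕ := wt τ (memT (a, b, c)) + wt τ (memT (x, y, z))

/-- The relation is well-formed and its leading part is `Rule.poly`. -/
def Rule.Ok (τ : Lab) (ρ : Rule) : Prop :=
  Distinct3 ρ.b ρ.c ρ.d ∧ Distinct3 ρ.b ρ.c ρ.e ∧ Distinct3 ρ.d ρ.f ρ.g ∧ Distinct3 ρ.e ρ.f ρ.g ∧
    ρ.d ≠ ρ.e ∧ wt2 τ ρ.b ρ.c ρ.d ρ.e ρ.f ρ.g = wt2 τ ρ.b ρ.c ρ.e ρ.d ρ.f ρ.g ∧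
    (ρ.f = ρ.b ∨ ρ.f = ρ.c ∨
      ¬ lex4 (wt2 τ ρ.b ρ.c ρ.d ρ.e ρ.f ρ.g) (wt2 τ ρ.b ρ.c ρ.f ρ.d ρ.e ρ.g)) ∧
    (ρ.g = ρ.b ∨ ρ.g = ρ.c ∨ ¬ lex4 (wt2 τ ρ.b ρ.c ρ.d ρ.e ρ.f ρ.g) (wt2 τ ρ.b ρ.c ρ.g ρ.d ρ.e ρ.f))

instance (τ : Lab) (ρ : Rule) : Decidable (ρ.Ok τ) :=
  inferInstanceAs (Decidable (_ ∧ _ ∧ _ ∧ _ ∧ _ ∧ _ ∧ _ ∧ _))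

theorem mem_In_of_add {τ : Lab} {g h : PRing 6} (hf : g + h ∈ PluckerIdeal 6)
    {w : ℕ × ℕ × ℕ × ℕ} (hg : ∀ m, coeff m g ≠ 0 → W τ m = w)
    (hh : ∀ m, coeff m h ≠ 0 → ¬ lex4 w (W τ m)) : g ∈ In τ := by
  classical
  by_cases h0 : g = 0
  · rw [h0]; exact zero_mem _
  obtain ⟨m₀, hm₀⟩ := ne_zero_iff.1 h0
  have hdis : ∀ m, coeff m g ≠ 0 → coeff m h = 0 := fun m hm => by
    by_contra hc
    apply hh m hc
    rw [hg m hm]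
    exact lex4_refl _
  have key : topPart (leL τ) (g + h) = g := by
    ext m
    rw [coeff_topPart]
    by_cases hm : coeff m g = 0
    · rw [hm, if_neg]
      rintro ⟨h1, h2⟩
      have h1 := mem_support_iff.1 h1
      rw [coeff_add, hm, zero_add] at h1
      have := h2 m₀ (by rw [mem_support_iff, coeff_add, hdis _ hm₀, add_zero]; exact hm₀)
      rw [leL, hg _ hm₀] at this
      exact hh m h1 this
    · rw [if_pos, coeff_add, hdis m hm, add_zero]
      refine ⟨by rwa [mem_support_iff, coeff_add, hdis m hm, add_zero], fun m' hm' => ?_⟩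
      rw [leL, hg m hm]
      by_cases hm'' : coeff m' g = 0
      · rw [mem_support_iff, coeff_add, hm'', zero_add] at hm'
        exact (lex4_total _ _).resolve_right (hh m' hm')
      · rw [hg m' hm'']
        exact lex4_refl _
  rw [← key]
  exact topPart_mem hf

theorem mul_wt2 (τ : Lab) (a b c x y z : ℕ) {m : MI 6 →₀ ℕ}
    (hm : coeff m (P a b c * P x y z) ≠ 0) : W τ m = wt2 τ a b c x y z :=
  ((P_wK_hom τ a b c).mul (P_wK_hom τ x y z)) hm

theorem Rule.Ok.mem_In {τ : Lab} {ρ : Rule} (h : ρ.Ok τ) : ρ.poly ∈ In τ := by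
  obtain ⟨b, c, d, e, f, g⟩ := ρ
  obtain ⟨h1, h2, h3, h4, h5, hw, hf, hg⟩ := h
  simp only [Rule.poly] at *
  have hR : Ralt b c d e f g ∈ PluckerIdeal 6 := by
    unfold Distinct3 at h1 h2 h3 h4
    apply Ralt_mem <;> omega
  have : Ralt b c d e f g = (P b c d * P e f g - P b c e * P d f g) +
      (P b c f * P d e g - P b c g * P d e f) := by rw [Ralt]; ring
  rw [this] at hR
  refine mem_In_of_add hR (w := wt2 τ b c d e f g) (fun m hm => ?_) (fun m hm => ?_)
  · rw [coeff_sub] at hm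
    by_cases h0 : coeff m (P b c d * P e f g) = 0
    · rw [hw]
      refine mul_wt2 _ _ _ _ _ _ _ fun h0' => hm ?_
      rw [h0, h0', sub_zero]
    · exact mul_wt2 _ _ _ _ _ _ _ h0
  · rw [coeff_sub] at hm
    by_cases h0 : coeff m (P b c f * P d e g) = 0
    · have h0' : coeff m (P b c g * P d e f) ≠ 0 := fun h0' => hm (by rw [h0, h0', sub_zero])
      rw [mul_wt2 τ _ _ _ _ _ _ h0']
      rcases hg with rfl | rfl | hg
      · rw [P_self13, zero_mul, coeff_zero] at h0'
        exact absurd rfl h0'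
      · rw [P_self23, zero_mul, coeff_zero] at h0'
        exact absurd rfl h0'
      · exact hg
    · rw [mul_wt2 τ _ _ _ _ _ _ h0]
      rcases hf with rfl | rfl | hf
      · rw [P_self13, zero_mul, coeff_zero] at h0
        exact absurd rfl h0
      · rw [P_self23, zero_mul, coeff_zero] at h0
        exact absurd rfl h0
      · exact hf

/-- The position of a triple in `tripL`. -/
def pos (t : ℕ × ℕ × ℕ) : ℕ := tripL.findIdx fun u => hits t u.1 u.2.1 u.2.2

theorem pos_congr {t t' : ℕ × ℕ × ℕ} (h : memT t = memT t') : pos t = pos t' := by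
  simp only [pos, hits, h]

/-- The first term of the leading binomial is larger for the position order. -/
def Rule.Decr (ρ : Rule) : Prop :=
  4 ^ pos (ρ.b, ρ.c, ρ.e) + 4 ^ pos (ρ.d, ρ.f, ρ.g) <
    4 ^ pos (ρ.b, ρ.c, ρ.d) + 4 ^ pos (ρ.e, ρ.f, ρ.g)

instance (ρ : Rule) : Decidable ρ.Decr := inferInstanceAs (Decidable (_ < _))

/-- Standard monomials: those not divisible by the first term of any of the rules. -/
def Std (R : List Rule) (m : MI 6 →₀ ℕ) : Prop :=
  ∀ ρ ∈ R, ∀ x y : MI 6, hits x.tri ρ.b ρ.c ρ.d → hits y.tri ρ.e ρ.f ρ.g → m x = 0 ∨ m y = 0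

theorem wt_tri (τ : Lab) {K : MI 6} {t : ℕ × ℕ × ℕ} (h : memT K.tri = memT t) :
    wK τ K = wt τ (memT t) := by rw [wK, h]

theorem dK_tri (K : MI 6) : dK K = fun x => (memT K.tri x).toNat := funext fun x => dK_apply K x

theorem Rule.Ok.reduce {τ : Lab} {ρ : Rule} (h : ρ.Ok τ) (hd : ρ.Decr) {J : Ideal (PRing 6)}
    (hJ : ρ.poly ∈ J) {x y : MI 6} (hx : hits x.tri ρ.b ρ.c ρ.d) (hy : hits y.tri ρ.e ρ.f ρ.g) :
    ∃ z w : MI 6, ∃ ε : ℂ, X x * X y - C ε * (X z * X w) ∈ J ∧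
      4 ^ pos z.tri + 4 ^ pos w.tri < 4 ^ pos x.tri + 4 ^ pos y.tri ∧
      dK z + dK w = dK x + dK y ∧ wK τ z + wK τ w = wK τ x + wK τ y := by
  obtain ⟨b, c, d, e, f, g⟩ := ρ
  obtain ⟨h1, h2, h3, h4, h5, hw, -, -⟩ := h
  unfold Rule.Decr at hd
  simp only [Rule.poly] at *
  have hx := MI.eq_of_hits h1 hx
  have hy := MI.eq_of_hits h4 hy
  obtain ⟨x', ε₁, e1, p1, m1⟩ := P_eq_C_mul_X h1
  obtain ⟨y', ε₂, e2, p2, m2⟩ := P_eq_C_mul_X h4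
  obtain ⟨z, ε₃, e3, p3, m3⟩ := P_eq_C_mul_X h2
  obtain ⟨w, ε₄, e4, p4, m4⟩ := P_eq_C_mul_X h3
  obtain rfl : x = x' := MI.eq_of_memT (hx.trans m1.symm)
  obtain rfl : y = y' := MI.eq_of_memT (hy.trans m2.symm)
  refine ⟨z, w, ε₃ * ε₄ * (ε₁ * ε₂)⁻¹, ?_, ?_, ?_, ?_⟩
  · have := J.mul_mem_left (C (ε₁ * ε₂)⁻¹) hJ
    rw [p1, p2, p3, p4] at this
    have hC : (C (ε₁ * ε₂)⁻¹ * C ε₁ * C ε₂ : PRing 6) = 1 := by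
      rw [← C_mul, ← C_mul, mul_assoc, inv_mul_cancel₀ (mul_ne_zero e1 e2), C_1]
    convert this using 1
    rw [C_mul, C_mul]
    linear_combination (-(X x * X y) : PRing 6) * hC
  · rw [pos_congr hx, pos_congr hy, pos_congr m3, pos_congr m4]
    exact hd
  · rw [dK_tri, dK_tri, dK_tri, dK_tri, hx, hy, m3, m4]
    funext u
    unfold Distinct3 at h1 h2 h3 h4
    simp only [Pi.add_apply, memT]
    have key : ∀ p q r s : Bool, (p && q) = false → (p && r) = false → (q && r) = false →
        (p || q || r).toNat = p.toNat + q.toNat + r.toNat := by decide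
    have ne : ∀ p q : ℕ, p ≠ q → ((u == p) && (u == q)) = false := fun p q hpq => by
      rw [Bool.eq_false_iff]
      intro h
      simp only [Bool.and_eq_true, beq_iff_eq] at h
      omega
    rw [key _ _ _ true (ne _ _ (by omega)) (ne _ _ (by omega)) (ne _ _ (by omega)),
      key _ _ _ true (ne _ _ (by omega)) (ne _ _ (by omega)) (ne _ _ (by omega)),
      key _ _ _ true (ne _ _ (by omega)) (ne _ _ (by omega)) (ne _ _ (by omega)),
      key _ _ _ true (ne _ _ (by omega)) (ne _ _ (by omega)) (ne _ _ (by omega))]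
    omega
  · rw [wt_tri τ hx, wt_tri τ hy, wt_tri τ m3, wt_tri τ m4]
    exact hw.symm

theorem exists_std {τ : Lab} {R : List Rule} (hOk : ∀ ρ ∈ R, ρ.Ok τ) (hd : ∀ ρ ∈ R, ρ.Decr)
    {J : Ideal (PRing 6)} (hJ : ∀ ρ ∈ R, ρ.poly ∈ J) (m : MI 6 →₀ ℕ) :
    ∃ s c, Std R s ∧ monomial m (1 : ℂ) - monomial s c ∈ J ∧
      Finsupp.weight dK s = Finsupp.weight dK m ∧ W τ s = W τ m := by
  classical
  induction hn : Finsupp.weight (fun K : MI 6 => 4 ^ pos K.tri) m using Nat.strong_induction_on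
    generalizing m with
  | _ n ih =>
  by_cases hs : Std R m
  · exact ⟨m, 1, hs, by rw [sub_self]; exact zero_mem _, rfl, rfl⟩
  unfold Std at hs
  push Not at hs
  obtain ⟨ρ, hρ, x, y, hx, hy, mx, my⟩ := hs
  have hne : x ≠ y := by
    rintro rfl
    obtain ⟨h1, -, -, h4, h5, -⟩ := hOk ρ hρ
    have h := (MI.eq_of_hits h1 hx).symm.trans (MI.eq_of_hits h4 hy)
    have hOk2 := (hOk ρ hρ).2.1
    have := congrFun h ρ.e
    simp only [memT, beq_self_eq_true, Bool.true_or] at this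
    simp only [Bool.or_eq_true, beq_iff_eq] at this
    unfold Distinct3 at hOk2
    omega
  obtain ⟨z, w, ε, hJ', hlt, hdK, hwK⟩ := (hOk ρ hρ).reduce (hd ρ hρ) (hJ ρ hρ) hx hy
  obtain ⟨m₀, rfl⟩ : ∃ m₀, m = m₀ + (Finsupp.single x 1 + Finsupp.single y 1) := by
    refine ⟨m - (Finsupp.single x 1 + Finsupp.single y 1), (tsub_add_cancel_of_le ?_).symm⟩
    intro K
    rw [Finsupp.add_apply, Finsupp.single_apply, Finsupp.single_apply]
    split_ifs with e1 e2 e2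
    · exact absurd (e1.trans e2.symm) hne
    · subst e1; omega
    · subst e2; omega
    · omega
  have wadd : ∀ {M : Type} [AddCommMonoid M] (v : MI 6 → M) (x y : MI 6),
      Finsupp.weight v (m₀ + (Finsupp.single x 1 + Finsupp.single y 1)) =
        Finsupp.weight v m₀ + (v x + v y) := fun v x y => by
    simp only [map_add, Finsupp.weight_single, one_smul]
  obtain ⟨s, c, h1, h2, h3, h4⟩ := ih _ (by
    rw [← hn, wadd, wadd]
    exact Nat.add_lt_add_left hlt _) (m₀ + (Finsupp.single z 1 + Finsupp.single w 1)) rfl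
  refine ⟨s, ε * c, h1, ?_, ?_, ?_⟩
  · have hm : ∀ x y : MI 6, monomial (m₀ + (Finsupp.single x 1 + Finsupp.single y 1)) (1 : ℂ) =
        monomial m₀ 1 * (X x * X y) := fun x y => by
      simp only [X, monomial_mul, mul_one]
    have a1 := J.mul_mem_left (monomial m₀ 1) hJ'
    have a2 := J.mul_mem_left (C ε) h2
    rw [hm] at a2 ⊢
    have := J.add_mem a1 a2
    rw [mul_sub (C ε), C_mul_monomial] at this
    convert this using 1
    ring
  · rw [h3, wadd, wadd, hdK]
  · rw [h4, W]
    erw [wadd, wadd]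
    rw [hwK]

theorem of_coeff_topPart {le : (MI 6 →₀ ℕ) → (MI 6 →₀ ℕ) → Prop} {f : PRing 6} {m : MI 6 →₀ ℕ}
    (h : coeff m (topPart le f) ≠ 0) : m ∈ f.support ∧ ∀ m' ∈ f.support, le m m' := by
  by_contra hc
  rw [coeff_topPart, if_neg hc] at h
  exact h rfl

theorem In_le {τ : Lab} {R : List Rule} (hOk : ∀ ρ ∈ R, ρ.Ok τ) (hd : ∀ ρ ∈ R, ρ.Decr)
    {J : Ideal (PRing 6)} (hJ : ∀ ρ ∈ R, ρ.poly ∈ J) (hJI : J ≤ In τ) (ht : Toric τ)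
    (hu : ∀ s s', Std R s → Std R s' → Finsupp.weight dK s = Finsupp.weight dK s' →
      W τ s = W τ s' → s = s') : In τ ≤ J := by
  apply In_eq_of_le
  intro f hf hhom
  by_cases h0 : topPart (leL τ) f = 0
  · rw [h0]; exact zero_mem _
  obtain ⟨m₀, hm₀⟩ := ne_zero_iff.1 h0
  choose s c h1 h2 h3 h4 using exists_std hOk hd hJ
  have heq : ∀ m ∈ (topPart (leL τ) f).support, s m = s m₀ := by
    intro m hm
    rw [mem_support_iff] at hm
    have a1 := of_coeff_topPart hm
    have a2 := of_coeff_topPart hm₀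
    apply hu _ _ (h1 _) (h1 _)
    · rw [h3, h3]
      exact hhom _ a1.1 _ a2.1
    · rw [h4, h4]
      exact lex4_antisymm (a2.2 _ a1.1) (a1.2 _ a2.1)
  obtain ⟨κ, hκ⟩ : ∃ κ, topPart (leL τ) f - monomial (s m₀) κ ∈ J := by
    refine ⟨∑ m ∈ (topPart (leL τ) f).support, coeff m (topPart (leL τ) f) * c m, ?_⟩
    rw [map_sum]
    nth_rewrite 1 [(topPart (leL τ) f).as_sum]
    rw [← Finset.sum_sub_distrib]
    refine J.sum_mem fun m hm => ?_
    have := J.mul_mem_left (C (coeff m (topPart (leL τ) f))) (h2 m)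
    rw [mul_sub, C_mul_monomial, C_mul_monomial, heq m hm, mul_one] at this
    exact this
  by_cases hk : κ = 0
  · rwa [hk, monomial_zero, sub_zero] at hκ
  · exfalso
    have hin : topPart (leL τ) f ∈ In τ := topPart_mem hf
    have := (In τ).mul_mem_left (C κ⁻¹) ((In τ).sub_mem hin (hJI hκ))
    rw [sub_sub_cancel, C_mul_monomial, inv_mul_cancel₀ hk] at this
    exact ht.1 _ this

theorem In_eq {τ τ' : Lab} {R : List Rule} (hOk : ∀ ρ ∈ R, ρ.Ok τ) (hOk' : ∀ ρ ∈ R, ρ.Ok τ')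
    (hd : ∀ ρ ∈ R, ρ.Decr) (ht : Toric τ) (ht' : Toric τ')
    (hu : ∀ s s', Std R s → Std R s' → Finsupp.weight dK s = Finsupp.weight dK s' →
      W τ s = W τ s' → s = s')
    (hu' : ∀ s s', Std R s → Std R s' → Finsupp.weight dK s = Finsupp.weight dK s' →
      W τ' s = W τ' s' → s = s') : In τ = In τ' := by
  have hJ : ∀ ρ ∈ R, ρ.poly ∈ In τ ⊓ In τ' := fun ρ hρ => ⟨(hOk ρ hρ).mem_In, (hOk' ρ hρ).mem_In⟩
  exact le_antisymm ((In_le hOk hd hJ inf_le_left ht hu).trans inf_le_right)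
    ((In_le hOk' hd hJ inf_le_right ht' hu').trans inf_le_left)

end Rewriting

section Uniqueness

/-- A linear functional in the degrees `d 1, …, d 6` and the weight `(X, Y, U, V)`. -/
structure Functional where
  d₁ : ℤ
  d₂ : ℤ
  d₃ : ℤ
  d₄ : ℤ
  d₅ : ℤ
  d₆ : ℤ
  x : ℤ
  y : ℤ
  u : ℤ
  v : ℤ

/-- Evaluation of a functional. -/
def Functional.eval (c : Functional) (d : ℕ → ℕ) (w : ℕ × ℕ × ℕ × ℕ) : ℤ :=
  c.d₁ * d 1 + c.d₂ * d 2 + c.d₃ * d 3 + c.d₄ * d 4 + c.d₅ * d 5 + c.d₆ * d 6 +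
    c.x * w.1 + c.y * w.2.1 + c.u * w.2.2.1 + c.v * w.2.2.2

/-- Evaluation of a functional at a Plücker variable. -/
def Functional.val (c : Functional) (τ : Lab) (t : ℕ × ℕ × ℕ) : ℤ :=
  c.eval (fun x => (memT t x).toNat) (wt τ (memT t))

/-- Evaluation of a functional as an additive map. -/
def Functional.hom (c : Functional) : ((ℕ → ℕ) × (ℕ × ℕ × ℕ × ℕ)) →+ ℤ where
  toFun p := c.eval p.1 p.2
  map_zero' := by simp [Functional.eval]
  map_add' p q := by
    simp only [Functional.eval, Prod.fst_add, Prod.snd_add, Pi.add_apply, Nat.cast_add]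
    ring

theorem Functional.weight_eq (c : Functional) (τ : Lab) {s s' : MI 6 →₀ ℕ}
    (hd : Finsupp.weight dK s = Finsupp.weight dK s') (hW : W τ s = W τ s') :
    Finsupp.weight (fun K : MI 6 => c.val τ K.tri) s =
      Finsupp.weight (fun K : MI 6 => c.val τ K.tri) s' := by
  have h : (fun K : MI 6 => c.val τ K.tri) = fun K => c.hom (dK K, wK τ K) := by
    funext K
    rw [dK_tri]
    rfl
  have hp : Finsupp.weight (fun K : MI 6 => (dK K, wK τ K)) s =
      Finsupp.weight (fun K : MI 6 => (dK K, wK τ K)) s' := by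
    ext1
    · have := fun s => weight_fun_map (AddMonoidHom.fst (ℕ → ℕ) (ℕ × ℕ × ℕ × ℕ))
        (fun K : MI 6 => (dK K, wK τ K)) s
      exact (this s).symm.trans (hd.trans (this s'))
    · have := fun s => weight_fun_map (AddMonoidHom.snd (ℕ → ℕ) (ℕ × ℕ × ℕ × ℕ))
        (fun K : MI 6 => (dK K, wK τ K)) s
      exact (this s).symm.trans (hW.trans (this s'))
  rw [h, weight_fun_map, weight_fun_map, hp]

theorem pos_injective {K K' : MI 6} (h : pos K.tri = pos K'.tri) : K = K' := by
  have key : ∀ t ∈ tripL, ∀ t' ∈ tripL, pos t = pos t' → t = t' := by decide +kernel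
  have e := key _ (MI.mem_tripL K) _ (MI.mem_tripL K') h
  have e0 := congrArg Prod.fst e
  have e1 := congrArg (fun t => t.2.1) e
  have e2 := congrArg (fun t => t.2.2) e
  exact MI.ext3 e0 e1 e2

instance : Finite (MI 6) :=
  Finite.of_injective (β := Fin 21)
    (fun K => ⟨pos K.tri, Nat.lt_succ_of_le (List.findIdx_le_length (xs := tripL))⟩)
    fun _ _ h => pos_injective (Fin.mk.inj h)

/-- The product of the variables of `t` and `t'` is the first term of a rule. -/
def isFirst (R : List Rule) (t t' : ℕ × ℕ × ℕ) : Bool := R.any fun ρ =>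
  (hits t ρ.b ρ.c ρ.d && hits t' ρ.e ρ.f ρ.g) || (hits t' ρ.b ρ.c ρ.d && hits t ρ.e ρ.f ρ.g)

theorem Std.isFirst {R : List Rule} {s : MI 6 →₀ ℕ} (hs : Std R s) {K K' : MI 6}
    (h : isFirst R K.tri K'.tri) : s K = 0 ∨ s K' = 0 := by
  simp only [_root_.isFirst, List.any_eq_true, Bool.or_eq_true, Bool.and_eq_true] at h
  obtain ⟨ρ, hρ, h | h⟩ := h
  · exact hs ρ hρ K K' h.1 h.2
  · exact (hs ρ hρ K' K h.1 h.2).symm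

/-- The functional is positive at `t` and nonpositive at the triples before `t`. -/
def Functional.LeadAt (c : Functional) (τ : Lab) (t : ℕ × ℕ × ℕ) : Prop :=
  0 < c.val τ t ∧ ∀ j ∈ tripL, pos j < pos t → c.val τ j ≤ 0

instance (c : Functional) (τ : Lab) (t : ℕ × ℕ × ℕ) : Decidable (c.LeadAt τ t) :=
  inferInstanceAs (Decidable (_ ∧ _))

/-- For every triple `t` the functionals rule out that `t` is the last position at which two
different standard monomials of the same degree and weight differ. -/
def Separates (F : List Functional) (τ : Lab) (R : List Rule) : Prop :=
  ∀ t ∈ tripL, ∃ a ∈ F, a.LeadAt τ t ∧ ∃ b ∈ F, b.LeadAt τ t ∧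
    ∀ j ∈ tripL, pos j < pos t → a.val τ j < 0 → isFirst R j t = false →
      ∀ k ∈ tripL, pos k < pos t → b.val τ k < 0 → isFirst R k t = false → isFirst R j k

instance (F : List Functional) (τ : Lab) (R : List Rule) : Decidable (Separates F τ R) :=
  inferInstanceAs (Decidable (∀ t ∈ tripL, _))

theorem exists_neg_of_weight_eq {a : MI 6 → ℤ} {s s' : MI 6 →₀ ℕ}
    (h : Finsupp.weight a s = Finsupp.weight a s') {t : MI 6} (hlt : s' t < s t)
    (hgt : ∀ j, pos t.tri < pos j.tri → s j = s' j) (ht : 0 < a t)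
    (hle : ∀ j : MI 6, pos j.tri < pos t.tri → a j ≤ 0) :
    ∃ j : MI 6, pos j.tri < pos t.tri ∧ a j < 0 ∧ s j ≠ 0 := by
  have := Fintype.ofFinite (MI 6)
  by_contra! hc
  have key : ∀ s : MI 6 →₀ ℕ, Finsupp.weight a s = ∑ K, (s K : ℤ) * a K := fun s => by
    rw [Finsupp.weight_apply, Finsupp.sum_fintype _ _ (by simp)]
    simp
  rw [key, key] at h
  have : ∑ K, (s' K : ℤ) * a K < ∑ K, (s K : ℤ) * a K := by
    refine Finset.sum_lt_sum (fun K _ => ?_) ⟨t, Finset.mem_univ _, ?_⟩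
    · rcases lt_trichotomy (pos K.tri) (pos t.tri) with hK | hK | hK
      · rcases (hle K hK).lt_or_eq with h0 | h0
        · rw [hc K hK h0]
          have : (0 : ℤ) ≤ s' K := Int.natCast_nonneg _
          simp only [Nat.cast_zero, zero_mul]
          nlinarith
        · rw [h0, mul_zero, mul_zero]
      · rw [pos_injective hK]
        have : (s' t : ℤ) ≤ s t := by exact_mod_cast hlt.le
        nlinarith
      · rw [hgt K hK]
    · have : (s' t : ℤ) < s t := by exact_mod_cast hlt
      nlinarith
  omega

theorem Separates.eq {F : List Functional} {τ : Lab} {R : List Rule} (hF : Separates F τ R)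
    {s s' : MI 6 →₀ ℕ} (hs : Std R s) (hs' : Std R s')
    (hd : Finsupp.weight dK s = Finsupp.weight dK s') (hW : W τ s = W τ s') : s = s' := by
  have := Fintype.ofFinite (MI 6)
  by_contra hne
  obtain ⟨t, ht, hgt⟩ : ∃ t, s t ≠ s' t ∧ ∀ j : MI 6, pos t.tri < pos j.tri → s j = s' j := by
    obtain ⟨t₀, h₀⟩ := DFunLike.ne_iff.1 hne
    obtain ⟨t, ht, hmax⟩ := (Finset.univ.filter fun t => s t ≠ s' t).exists_max_image
      (fun t => pos t.tri) ⟨t₀, by simpa using h₀⟩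
    refine ⟨t, by simpa using ht, fun j hj => ?_⟩
    by_contra hc
    exact absurd (hmax j (by simpa using hc)) (by omega)
  wlog hlt : s' t < s t generalizing s s'
  · exact this hs' hs hd.symm hW.symm (Ne.symm hne) (Ne.symm ht) (fun j hj => (hgt j hj).symm)
      (by omega)
  obtain ⟨a, -, ha, b, -, hb, hab⟩ := hF _ (MI.mem_tripL t)
  have lead : ∀ c : Functional, c.LeadAt τ t.tri → ∃ j : MI 6, pos j.tri < pos t.tri ∧
      c.val τ j.tri < 0 ∧ s j ≠ 0 := fun c hc =>
    exists_neg_of_weight_eq (c.weight_eq τ hd hW) hlt hgt hc.1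
      fun j hj => hc.2 _ (MI.mem_tripL j) hj
  obtain ⟨j, j1, j2, j3⟩ := lead a ha
  obtain ⟨k, k1, k2, k3⟩ := lead b hb
  have st : s t ≠ 0 := by omega
  have nf : ∀ j k : MI 6, s j ≠ 0 → s k ≠ 0 → isFirst R j.tri k.tri = false := fun j k hj hk => by
    rw [Bool.eq_false_iff]
    intro h
    rcases hs.isFirst h with h | h
    exacts [hj h, hk h]
  exact Bool.false_ne_true ((nf j k j3 k3).symm.trans
    (hab _ (MI.mem_tripL j) j1 j2 (nf _ _ j3 st) _ (MI.mem_tripL k) k1 k2 (nf _ _ k3 st)))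

/-- The weight for `τ'` can be recovered from the degree and the weight for `τ`. -/
def Recovers (τ τ' : Lab) (c c' : ℕ × Functional) : Prop :=
  0 < c.1 ∧ 0 < c'.1 ∧ ∀ t ∈ tripL, (wt τ' (memT t)).1 = (wt τ (memT t)).1 ∧
    (wt τ' (memT t)).2.1 = (wt τ (memT t)).2.1 ∧
    (c.1 * (wt τ' (memT t)).2.2.1 : ℤ) = c.2.val τ t ∧
    (c'.1 * (wt τ' (memT t)).2.2.2 : ℤ) = c'.2.val τ t

instance (τ τ' : Lab) (c c' : ℕ × Functional) : Decidable (Recovers τ τ' c c') :=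
  inferInstanceAs (Decidable (_ ∧ _ ∧ _))

theorem Recovers.eq {τ τ' : Lab} {c c' : ℕ × Functional} (h : Recovers τ τ' c c')
    {s s' : MI 6 →₀ ℕ} (hd : Finsupp.weight dK s = Finsupp.weight dK s') (hW : W τ s = W τ s') :
    W τ' s = W τ' s' := by
  obtain ⟨h1, h2, h3⟩ := h
  have h3 := fun K : MI 6 => h3 _ (MI.mem_tripL K)
  have h0 : ∀ s, (W τ' s).1 = (W τ s).1 ∧ (W τ' s).2.1 = (W τ s).2.1 := fun s => by
    rw [W_fst, W_fst, W_snd, W_snd]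
    exact ⟨congrArg (Finsupp.weight · s) (funext fun K => (h3 K).1),
      congrArg (Finsupp.weight · s) (funext fun K => (h3 K).2.1)⟩
  have key : ∀ (n : ℕ) (u : MI 6 → ℕ) (e : Functional), 0 < n →
      (∀ K, (n * u K : ℤ) = e.val τ K.tri) → Finsupp.weight u s = Finsupp.weight u s' := by
    intro n u e hn he
    have := e.weight_eq τ hd hW
    rw [← funext he] at this
    let φ : ℕ →+ ℤ := (AddMonoidHom.mulLeft (n : ℤ)).comp (Nat.castAddMonoidHom ℤ)
    have h' := fun s => weight_fun_map φ u s
    have e2 : φ (Finsupp.weight u s) = φ (Finsupp.weight u s') :=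
      (h' s).symm.trans (this.trans (h' s'))
    have e3 : (n : ℤ) * (Finsupp.weight u s : ℕ) = n * (Finsupp.weight u s' : ℕ) := e2
    have hn' : (n : ℤ) ≠ 0 := by positivity
    exact_mod_cast mul_left_cancel₀ hn' e3
  ext
  · rw [(h0 s).1, (h0 s').1, hW]
  · rw [(h0 s).2, (h0 s').2, hW]
  · rw [W_third, W_third]
    exact key c.1 _ c.2 h1 fun K => (h3 K).2.2.1
  · rw [W_fourth, W_fourth]
    exact key c'.1 _ c'.2 h2 fun K => (h3 K).2.2.2

theorem In_eq_of_separates {τ τ' : Lab} {R : List Rule} {F : List Functional}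
    {c c' : ℕ × Functional} (hOk : ∀ ρ ∈ R, ρ.Ok τ) (hOk' : ∀ ρ ∈ R, ρ.Ok τ')
    (hd : ∀ ρ ∈ R, ρ.Decr) (hF : Separates F τ R) (hc : Recovers τ' τ c c')
    (ht : Toric τ) (ht' : Toric τ') : In τ = In τ' :=
  In_eq hOk hOk' hd ht ht' (fun _ _ h h' => hF.eq h h')
    fun _ _ h h' hs hW => hF.eq h h' hs (hc.eq hs hW)

end Uniqueness

section Gluing

instance : DecidableEq Lab := fun τ τ' =>
  decidable_of_iff (τ.a = τ'.a ∧ τ.j₁ = τ'.j₁ ∧ τ.j₂ = τ'.j₂ ∧ τ.i₁ = τ'.i₁ ∧ τ.i₂ = τ'.i₂ ∧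
    τ.b = τ'.b) (by cases τ; cases τ'; simp)

/-- The pairs of distinct elements of `{1, …, n}`. -/
def distinctPairs (n : ℕ) : List (ℕ × ℕ) :=
  ((List.range' 1 n).product (List.range' 1 n)).filter fun p => p.1 ≠ p.2

/-- The labels of the iterated sequences. -/
def labs : List Lab :=
  ((distinctPairs 4).product (distinctPairs 5)).map fun p => ⟨5, p.1.1, p.1.2, p.2.1, p.2.2, 6⟩

theorem mem_labs {τ : Lab} : τ ∈ labs ↔ ∃ w : Word, w.Ok ∧ w.lab = τ := by
  have hp : ∀ n x y, (x, y) ∈ distinctPairs n ↔ (1 ≤ x ∧ x ≤ n) ∧ (1 ≤ y ∧ y ≤ n) ∧ x ≠ y := by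
    intro n x y
    simp only [distinctPairs, List.mem_filter, List.pair_mem_product, List.mem_range'_1,
      decide_eq_true_eq]
    omega
  have third : ∀ n x y, 3 ≤ n → (1 ≤ x ∧ x ≤ n) ∧ (1 ≤ y ∧ y ≤ n) ∧ x ≠ y →
      ∃ z, Triple n x y z := by
    intro n x y hn h
    by_cases h1 : x ≠ 1 ∧ y ≠ 1
    · exact ⟨1, by unfold Triple; omega⟩
    by_cases h2 : x ≠ 2 ∧ y ≠ 2
    · exact ⟨2, by unfold Triple; omega⟩
    · exact ⟨3, by unfold Triple; omega⟩
  simp only [labs, List.mem_map, Prod.exists, List.pair_mem_product, hp]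
  constructor
  · rintro ⟨j₁, j₂, i₁, i₂, ⟨hj, hi⟩, rfl⟩
    obtain ⟨j₃, hj₃⟩ := third 4 _ _ (by norm_num) hj
    obtain ⟨i₃, hi₃⟩ := third 5 _ _ (by norm_num) hi
    exact ⟨⟨i₁, i₂, i₃, j₁, j₂, j₃, 1, 2, 3⟩, ⟨hi₃, hj₃, by norm_num [Triple]⟩, rfl⟩
  · rintro ⟨w, ⟨h1, h2, -⟩, rfl⟩
    unfold Triple at h1 h2
    exact ⟨w.j₁, w.j₂, w.i₁, w.i₂, by tauto, rfl⟩

theorem toric_of_mem_labs {τ : Lab} (h : τ ∈ labs) : Toric τ := by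
  obtain ⟨w, hw, rfl⟩ := mem_labs.1 h
  exact hw.toric

/-- The action of a word in the simple transpositions. -/
def Lab.act (l : List ℕ) (τ : Lab) : Lab := l.foldl (fun τ i => τ.map (tr i)) τ

theorem toric_act {l : List ℕ} (hl : ∀ i ∈ l, 1 ≤ i ∧ i ≤ 5) {τ : Lab} (h : Toric τ) :
    Toric (τ.act l) := by
  induction l generalizing τ with
  | nil => exact h
  | cons i l ih =>
    exact ih (fun j hj => hl j (List.mem_cons_of_mem _ hj))
      (h.map (hl i List.mem_cons_self).1 (hl i List.mem_cons_self).2)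

theorem eqvGen_act {l : List ℕ} (hl : ∀ i ∈ l, 1 ≤ i ∧ i ≤ 5) (τ : Lab) :
    Relation.EqvGen StepRel (In τ) (In (τ.act l)) := by
  induction l generalizing τ with
  | nil => exact .refl _
  | cons i l ih =>
    obtain ⟨h1, h5⟩ := hl i List.mem_cons_self
    exact .trans _ _ _ (.rel _ _ ⟨i, h1, h5, (map_sAuto_In h1 h5 τ).symm⟩)
      (ih (fun j hj => hl j (List.mem_cons_of_mem _ hj)) _)

/-- A choice of `a, j₁, j₂`, and expressions for the third and fourth entries of the weights for
`(5, 1, 2)` in terms of those for `(a, j₁, j₂)`. -/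
structure JTree where
  a : ℕ
  j₁ : ℕ
  j₂ : ℕ
  u : ℕ × Functional
  v : ℕ × Functional

/-- A certificate showing that the initial ideals for several choices of `a, j₁, j₂` agree with
that for `(5, 1, 2)`. -/
structure Gluing where
  i₁ : ℕ
  i₂ : ℕ
  rules : List Rule
  functionals : List Functional
  trees : List JTree

/-- The labels for `(5, 1, 2)`. -/
def Gluing.lab (g : Gluing) : Lab := ⟨5, 1, 2, g.i₁, g.i₂, 6⟩

/-- The labels for a choice of `a, j₁, j₂`. -/
def Gluing.tree (g : Gluing) (T : JTree) : Lab := ⟨T.a, T.j₁, T.j₂, g.i₁, g.i₂, 6⟩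

/-- Words moving the trees `(a, j₁, j₂)` to trees with `a = 5`. -/
def toFive : List (List ℕ) := [[1, 2, 3, 4, 3, 2, 1], [4], [3, 4, 3]]

/-- The decidable conditions on a certificate. -/
def Gluing.Ok (g : Gluing) : Prop :=
  g.lab ∈ labs ∧ (∀ ρ ∈ g.rules, ρ.Ok g.lab ∧ ρ.Decr) ∧ Separates g.functionals g.lab g.rules ∧
    ∀ T ∈ g.trees, (∀ ρ ∈ g.rules, ρ.Ok (g.tree T)) ∧ Recovers (g.tree T) g.lab T.u T.v ∧
      ∃ l ∈ toFive, ∃ τ ∈ labs, τ.act l = g.tree T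

instance (g : Gluing) : Decidable g.Ok := inferInstanceAs (Decidable (_ ∧ _ ∧ _ ∧ _))

theorem Gluing.Ok.In_eq {g : Gluing} (h : g.Ok) {T : JTree} (hT : T ∈ g.trees) :
    In (g.tree T) = In g.lab := by
  obtain ⟨h1, h2, h3, h4⟩ := h
  obtain ⟨h5, h6, l, hl, τ, hτ, e⟩ := h4 T hT
  have ht : Toric (g.tree T) := by
    have : ∀ l ∈ toFive, ∀ i ∈ l, 1 ≤ i ∧ i ≤ 5 := by decide
    rw [← e]
    exact toric_act (this l hl) (toric_of_mem_labs hτ)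
  exact (In_eq_of_separates (fun ρ hρ => (h2 ρ hρ).1) h5 (fun ρ hρ => (h2 ρ hρ).2) h3 h6
    (toric_of_mem_labs h1) ht).symm

/-- Certificate for `i₁ = 1`, `i₂ = 5`. -/
def certα : Gluing where
  i₁ := 1
  i₂ := 5
  rules :=
    [⟨1, 2, 3, 4, 5, 1⟩, ⟨1, 2, 4, 3, 6, 1⟩, ⟨1, 3, 6, 5, 4, 1⟩, ⟨2, 1, 4, 3, 6, 2⟩,
     ⟨6, 1, 4, 3, 2, 6⟩, ⟨2, 6, 3, 4, 1, 5⟩, ⟨4, 6, 5, 2, 1, 3⟩, ⟨4, 1, 2, 5, 6, 4⟩,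
     ⟨1, 2, 6, 5, 3, 1⟩, ⟨1, 2, 6, 5, 4, 1⟩, ⟨3, 1, 2, 5, 6, 3⟩, ⟨5, 6, 3, 4, 1, 2⟩,
     ⟨6, 1, 4, 3, 5, 6⟩, ⟨6, 2, 4, 3, 5, 6⟩, ⟨5, 1, 4, 3, 6, 5⟩, ⟨3, 1, 4, 2, 5, 3⟩,
     ⟨5, 1, 3, 4, 2, 5⟩, ⟨2, 1, 3, 4, 5, 2⟩, ⟨1, 6, 3, 4, 2, 5⟩, ⟨4, 1, 3, 2, 5, 4⟩,
     ⟨2, 3, 6, 5, 4, 2⟩, ⟨5, 2, 4, 3, 6, 5⟩, ⟨5, 1, 3, 2, 6, 5⟩, ⟨2, 1, 3, 5, 6, 2⟩,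
     ⟨2, 1, 4, 5, 6, 2⟩, ⟨6, 1, 4, 2, 5, 6⟩, ⟨5, 1, 4, 2, 6, 5⟩, ⟨6, 1, 3, 2, 5, 6⟩,
     ⟨3, 1, 5, 4, 6, 3⟩, ⟨3, 1, 2, 4, 6, 3⟩, ⟨4, 1, 2, 3, 6, 4⟩, ⟨3, 4, 6, 1, 2, 5⟩,
     ⟨4, 1, 5, 3, 6, 4⟩, ⟨3, 2, 5, 6, 4, 3⟩, ⟨4, 2, 5, 6, 3, 4⟩]
  functionals :=
    [⟨1, 0, 0, 0, 0, 0, 0, 0, 0, 0⟩, ⟨-1, 0, 1, 0, 0, 0, 0, 0, 0, 0⟩,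
     ⟨0, 1, 0, 0, 0, 0, 0, 0, 0, 0⟩, ⟨1, 0, -1, 1, 0, 0, 0, 0, 0, 0⟩,
     ⟨1, -2, 1, 1, -2, 0, 0, 0, 0, 0⟩, ⟨-1, 2, -1, -1, 2, 2, 0, 0, 0, 0⟩,
     ⟨-1, 2, -1, -1, 2, 2, -3, 0, 0, 0⟩, ⟨-1, 2, -1, -1, 2, -1, 0, 3, 0, 0⟩,
     ⟨1, -2, -2, 1, 1, -2, 3, 0, 0, 0⟩, ⟨-2, 1, 1, -2, 1, 1, 0, 3, 0, 0⟩,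
     ⟨1, -1, 0, 0, 0, -1, 2, 1, 0, -1⟩, ⟨1, -2, 1, -2, 1, -2, 6, 3, 0, -3⟩,
     ⟨2, -4, -1, -1, 2, -4, 9, 6, 0, -3⟩, ⟨0, 0, 0, 0, 0, 0, 0, 1, 0, -1⟩,
     ⟨2, -4, -1, -1, 2, -4, 9, 9, 0, -6⟩, ⟨1, -2, 0, -1, 1, -2, 4, 3, 0, -2⟩,
     ⟨-1, 1, 0, 0, 0, 1, -2, -1, 0, 1⟩, ⟨-2, 1, -2, 1, 1, 1, -3, 0, 0, 0⟩,
     ⟨-1, -1, -1, -1, 2, -1, 3, 3, 0, -3⟩, ⟨2, -4, -1, -1, 2, -4, 9, 6, 0, -6⟩,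
     ⟨0, -1, 0, 0, 0, 0, 1, 1, 0, -1⟩, ⟨-2, 1, 1, 1, 1, 1, -3, 0, -3, 0⟩]
  trees :=
    [⟨1, 5, 2, (1, ⟨-1, 0, 0, 0, 1, 0, -1, 1, 1, 0⟩), (1, ⟨0, 0, 0, 0, 0, 0, 0, 0, 0, 1⟩)⟩,
     ⟨4, 3, 2, (3, ⟨-2, 1, 1, -2, 1, 1, -3, 0, 3, 3⟩), (3, ⟨1, -2, 1, 1, 1, -2, 3, 3, 0, -3⟩)⟩,
     ⟨3, 4, 2, (3, ⟨-2, 1, -2, 1, 1, 1, -3, 0, 3, 3⟩), (3, ⟨1, -2, 1, 1, 1, -2, 3, 3, 0, -3⟩)⟩]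

/-- Certificate for `i₁ = 1`, `i₂ = 2`. -/
def certβ : Gluing where
  i₁ := 1
  i₂ := 2
  rules :=
    [⟨1, 2, 5, 4, 6, 1⟩, ⟨1, 2, 3, 4, 5, 1⟩, ⟨1, 2, 4, 3, 6, 1⟩, ⟨1, 2, 5, 3, 6, 1⟩,
     ⟨1, 3, 6, 5, 4, 1⟩, ⟨2, 1, 4, 3, 6, 2⟩, ⟨6, 1, 4, 3, 2, 6⟩, ⟨2, 6, 3, 4, 1, 5⟩,
     ⟨4, 6, 5, 2, 1, 3⟩, ⟨4, 1, 2, 5, 6, 4⟩, ⟨3, 1, 2, 5, 6, 3⟩, ⟨5, 6, 3, 4, 1, 2⟩,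
     ⟨6, 1, 4, 3, 5, 6⟩, ⟨6, 2, 4, 3, 5, 6⟩, ⟨5, 1, 4, 3, 6, 5⟩, ⟨3, 1, 4, 2, 5, 3⟩,
     ⟨5, 1, 3, 4, 2, 5⟩, ⟨2, 1, 3, 4, 5, 2⟩, ⟨1, 6, 3, 4, 2, 5⟩, ⟨4, 1, 3, 2, 5, 4⟩,
     ⟨2, 3, 6, 5, 4, 2⟩, ⟨5, 2, 4, 3, 6, 5⟩, ⟨5, 1, 3, 2, 6, 5⟩, ⟨2, 1, 3, 5, 6, 2⟩,
     ⟨2, 1, 4, 5, 6, 2⟩, ⟨6, 1, 4, 5, 2, 6⟩, ⟨5, 1, 4, 2, 6, 5⟩, ⟨6, 1, 3, 5, 2, 6⟩,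
     ⟨3, 1, 5, 4, 6, 3⟩, ⟨3, 1, 2, 4, 6, 3⟩, ⟨4, 1, 2, 3, 6, 4⟩, ⟨3, 4, 6, 1, 2, 5⟩,
     ⟨4, 1, 5, 3, 6, 4⟩, ⟨3, 2, 5, 6, 4, 3⟩, ⟨4, 2, 5, 6, 3, 4⟩]
  functionals :=
    [⟨1, 0, 0, 0, 0, 0, 0, 0, 0, 0⟩, ⟨-1, 0, 1, 0, 0, 0, 0, 0, 0, 0⟩,
     ⟨0, 1, 0, 0, 0, 0, 0, 0, 0, 0⟩, ⟨1, 0, -1, 1, 0, 0, 0, 0, 0, 0⟩,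
     ⟨1, -2, 1, 1, -2, 0, 0, 0, 0, 0⟩, ⟨-1, 2, -1, -1, 2, 2, 0, 0, 0, 0⟩,
     ⟨-1, 2, -1, -1, 2, 2, -3, 0, 0, 0⟩, ⟨-1, 2, -1, -1, 2, -1, 0, 0, 0, 0⟩,
     ⟨1, -2, -2, 1, 1, -2, 3, 0, 0, 0⟩, ⟨-1, -1, 2, -1, -1, 2, 0, 0, 0, 0⟩,
     ⟨1, -1, 0, 0, 0, -1, 2, 0, 0, -1⟩, ⟨1, -2, 1, -2, 1, -2, 6, 0, 0, -3⟩,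
     ⟨0, -1, 0, 0, 0, 0, 1, 0, 0, 0⟩, ⟨2, -4, -1, -1, 2, -4, 9, 0, 0, -3⟩,
     ⟨0, 0, 0, 0, 0, 1, -1, -1, 0, 0⟩, ⟨1, -2, 0, -1, 1, 1, 1, -3, 0, -2⟩,
     ⟨1, -5, 1, -2, 1, 4, 0, -6, 0, -3⟩, ⟨-1, 1, 0, 0, 0, 0, -1, 1, 0, 1⟩,
     ⟨-2, 1, -2, 1, 1, 1, -3, 0, 0, 0⟩, ⟨-1, -1, -1, -1, 2, 2, 0, -3, 0, -3⟩,
     ⟨2, -4, -1, -1, 2, 2, 3, -6, 0, -6⟩, ⟨0, -1, 0, 0, 0, 1, 0, -1, 0, -1⟩,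
     ⟨-2, 1, 1, 1, 1, 1, -3, 0, -3, 0⟩]
  trees :=
    [⟨1, 5, 2, (1, ⟨-1, 0, 0, 0, 1, 1, -2, -1, 1, 0⟩), (1, ⟨0, 0, 0, 0, 0, 0, 0, 0, 0, 1⟩)⟩,
     ⟨4, 3, 2, (3, ⟨-2, 1, 1, -2, 1, 1, -3, 0, 3, 3⟩), (3, ⟨1, -2, 1, 1, 1, 1, 0, -3, 0, -3⟩)⟩,
     ⟨3, 4, 2, (3, ⟨-2, 1, -2, 1, 1, 1, -3, 0, 3, 3⟩), (3, ⟨1, -2, 1, 1, 1, 1, 0, -3, 0, -3⟩)⟩]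

/-- Certificate for `i₁ = 2`, `i₂ = 1`. -/
def certγ : Gluing where
  i₁ := 2
  i₂ := 1
  rules :=
    [⟨1, 2, 5, 4, 6, 1⟩, ⟨1, 2, 3, 4, 5, 1⟩, ⟨1, 2, 4, 3, 6, 1⟩, ⟨1, 2, 5, 3, 6, 1⟩,
     ⟨1, 3, 6, 5, 4, 1⟩, ⟨2, 1, 4, 3, 6, 2⟩, ⟨6, 1, 4, 3, 2, 6⟩, ⟨2, 6, 3, 4, 1, 5⟩,
     ⟨4, 1, 3, 6, 5, 4⟩, ⟨5, 6, 3, 4, 1, 2⟩, ⟨6, 1, 4, 3, 5, 6⟩, ⟨6, 2, 4, 3, 5, 6⟩,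
     ⟨5, 1, 4, 3, 6, 5⟩, ⟨3, 1, 4, 6, 5, 3⟩, ⟨4, 6, 1, 5, 2, 3⟩, ⟨5, 1, 6, 2, 3, 5⟩,
     ⟨3, 1, 6, 2, 5, 3⟩, ⟨3, 1, 4, 2, 5, 3⟩, ⟨5, 1, 3, 4, 2, 5⟩, ⟨2, 1, 3, 4, 5, 2⟩,
     ⟨4, 1, 6, 2, 5, 4⟩, ⟨5, 1, 6, 2, 4, 5⟩, ⟨4, 5, 2, 6, 1, 3⟩, ⟨4, 1, 3, 2, 5, 4⟩,
     ⟨2, 3, 6, 5, 4, 2⟩, ⟨5, 2, 4, 3, 6, 5⟩, ⟨2, 1, 3, 5, 6, 2⟩, ⟨2, 1, 4, 5, 6, 2⟩,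
     ⟨6, 1, 4, 5, 2, 6⟩, ⟨6, 1, 3, 5, 2, 6⟩, ⟨4, 1, 6, 2, 3, 4⟩, ⟨3, 4, 2, 6, 1, 5⟩,
     ⟨3, 1, 6, 2, 4, 3⟩, ⟨4, 2, 3, 5, 6, 4⟩, ⟨3, 2, 4, 5, 6, 3⟩]
  functionals :=
    [⟨1, 0, 0, 0, 0, 0, 0, 0, 0, 0⟩, ⟨-1, 0, 1, 0, 0, 0, 0, 0, 0, 0⟩,
     ⟨0, 1, 0, 0, 0, 0, 0, 0, 0, 0⟩, ⟨1, 0, -1, 1, 0, 0, 0, 0, 0, 0⟩,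
     ⟨1, -2, 1, 1, -2, 0, 0, 0, 0, 0⟩, ⟨-1, 2, -1, -1, 2, 2, 0, 0, 0, 0⟩,
     ⟨-1, 2, -1, -1, 2, -1, 3, 0, 0, 0⟩, ⟨-1, 2, -1, -1, 2, -1, 0, 0, 0, 0⟩,
     ⟨1, -2, -2, 1, 1, 1, -3, 0, 0, 0⟩, ⟨-1, -1, 2, -1, -1, 2, 0, 0, 0, 0⟩,
     ⟨1, -1, 0, 0, 0, 1, -2, 0, 0, -1⟩, ⟨1, -2, 1, -2, 1, 4, -6, 0, 0, -3⟩,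
     ⟨-1, 1, 0, 0, 0, -1, 2, 0, 0, 1⟩, ⟨0, 0, 0, 0, 0, 1, -1, -1, 0, 0⟩,
     ⟨-2, 1, 1, -2, 1, 1, 0, -3, 0, 0⟩, ⟨-1, 1, 0, 0, 0, 0, 0, -1, 0, 1⟩,
     ⟨-2, 1, -2, 1, 1, 1, -3, -3, 0, 0⟩, ⟨-1, -1, -1, -1, 2, 2, -3, 0, 0, 0⟩,
     ⟨2, -4, -1, -1, 2, 2, -6, 3, 0, -3⟩, ⟨-2, 1, 1, 1, 1, 1, 0, -3, -3, 0⟩,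
     ⟨-2, 1, 1, 1, 1, 1, -3, -3, -3, 0⟩]
  trees :=
    [⟨1, 5, 2, (1, ⟨-1, 0, 0, 0, 1, 1, -1, -2, 1, 0⟩), (1, ⟨0, 0, 0, 0, 0, 0, 0, 0, 0, 1⟩)⟩,
     ⟨4, 3, 2, (3, ⟨-2, 1, 1, -2, 1, 1, 0, -3, 3, 3⟩), (3, ⟨1, -2, 1, 1, 1, 1, -3, 0, 0, -3⟩)⟩,
     ⟨3, 4, 2, (3, ⟨-2, 1, -2, 1, 1, 1, 0, -3, 3, 3⟩), (3, ⟨1, -2, 1, 1, 1, 1, -3, 0, 0, -3⟩)⟩]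

/-- Certificate for `i₁ = 1`, `i₂ = 3`. -/
def certδ : Gluing where
  i₁ := 1
  i₂ := 3
  rules :=
    [⟨1, 2, 3, 4, 5, 1⟩, ⟨1, 3, 4, 5, 6, 1⟩, ⟨2, 1, 4, 3, 6, 2⟩, ⟨2, 6, 3, 4, 1, 5⟩,
     ⟨4, 6, 5, 2, 1, 3⟩, ⟨4, 1, 2, 5, 6, 4⟩, ⟨1, 2, 6, 3, 5, 1⟩, ⟨1, 2, 6, 4, 5, 1⟩,
     ⟨1, 2, 6, 3, 4, 1⟩, ⟨6, 1, 2, 5, 4, 6⟩, ⟨3, 1, 2, 5, 6, 3⟩, ⟨5, 6, 3, 4, 1, 2⟩,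
     ⟨6, 2, 4, 3, 5, 6⟩, ⟨5, 1, 4, 3, 6, 5⟩, ⟨6, 1, 2, 5, 3, 6⟩, ⟨1, 6, 4, 2, 3, 5⟩,
     ⟨3, 1, 4, 2, 5, 3⟩, ⟨5, 1, 3, 4, 2, 5⟩, ⟨2, 1, 3, 4, 5, 2⟩, ⟨4, 1, 3, 2, 5, 4⟩,
     ⟨2, 3, 6, 5, 4, 2⟩, ⟨5, 2, 4, 3, 6, 5⟩, ⟨5, 1, 3, 2, 6, 5⟩, ⟨2, 1, 3, 5, 6, 2⟩,
     ⟨2, 1, 4, 5, 6, 2⟩, ⟨5, 1, 4, 2, 6, 5⟩, ⟨3, 1, 5, 4, 6, 3⟩, ⟨3, 1, 2, 4, 6, 3⟩,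
     ⟨4, 1, 2, 3, 6, 4⟩, ⟨6, 1, 5, 4, 3, 6⟩, ⟨3, 4, 6, 1, 2, 5⟩, ⟨4, 1, 5, 3, 6, 4⟩,
     ⟨6, 1, 2, 4, 3, 6⟩, ⟨3, 2, 5, 6, 4, 3⟩, ⟨4, 2, 5, 6, 3, 4⟩]
  functionals :=
    [⟨1, 0, 0, 0, 0, 0, 0, 0, 0, 0⟩, ⟨-1, 0, 1, 0, 0, 0, 0, 0, 0, 0⟩,
     ⟨0, 1, 0, 0, 0, 0, 0, 0, 0, 0⟩, ⟨1, 0, -1, 1, 0, 0, 0, 0, 0, 0⟩,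
     ⟨1, -2, 1, 1, -2, 0, 0, 0, 0, 0⟩, ⟨-1, 2, -1, -1, 2, 2, 0, 0, 0, 0⟩,
     ⟨-1, 2, -1, -1, 2, 2, -3, 0, 0, 0⟩, ⟨2, -1, -1, -1, 2, -1, 3, 0, 0, -3⟩,
     ⟨1, -2, -2, 1, 1, -2, 3, 0, 0, 0⟩, ⟨0, 0, 0, 0, 0, 1, -1, -1, 0, 0⟩,
     ⟨1, -1, 0, 0, 0, -1, 2, 0, 0, -1⟩, ⟨1, -2, 1, -2, 1, -2, 6, 3, 0, -3⟩,
     ⟨2, -4, -1, -1, 2, -1, 6, 0, 0, -3⟩, ⟨-1, 1, 0, 0, 0, 1, -2, 0, 0, 0⟩,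
     ⟨1, -2, 0, -1, 1, -1, 3, 1, 0, -2⟩, ⟨-1, 1, 0, 0, 0, 1, -2, -1, 0, 1⟩,
     ⟨-2, 1, -2, 1, 1, 4, -6, -3, 0, 0⟩, ⟨-1, -1, -1, -1, 2, 2, 0, 0, 0, -3⟩,
     ⟨2, -4, -1, -1, 2, -1, 6, 0, 0, -6⟩, ⟨0, -1, 0, 0, 0, 0, 1, 0, 0, -1⟩,
     ⟨-2, 1, 1, 1, 1, 1, -3, 0, -3, 0⟩]
  trees :=
    [⟨1, 5, 2, (1, ⟨-1, 0, 0, 0, 1, 1, -2, -1, 1, 0⟩), (1, ⟨0, 0, 0, 0, 0, 0, 0, 0, 0, 1⟩)⟩,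
     ⟨4, 3, 2, (3, ⟨-2, 1, 1, -2, 1, 1, -3, 0, 3, 3⟩), (3, ⟨1, -2, 1, 1, 1, -2, 3, 3, 0, -3⟩)⟩,
     ⟨3, 4, 2, (3, ⟨-2, 1, -2, 1, 1, 4, -6, -6, 3, 3⟩), (3, ⟨1, -2, 1, 1, 1, -2, 3, 3, 0, -3⟩)⟩]

/-- The certificates for the four types. -/
def gluing : Fin 4 → Gluing := ![certα, certβ, certγ, certδ]

theorem gluing_ok : ∀ k, (gluing k).Ok := by
  decide +kernel

end Gluing

section Connectivity

/-- The type of the labels of an iterated sequence. -/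
def Lab.typ (τ : Lab) : Fin 4 :=
  let cl := fun x => if x = τ.j₂ then 2 else if x = τ.a ∨ x = τ.j₁ then 0 else 1
  if τ.i₁ = τ.j₂ then 2 else if τ.i₂ = τ.j₂ then 1 else if cl τ.i₁ = cl τ.i₂ then 0 else 3

/-- Words for all the permutations of `{1, 2, 3, 4}`, after moving a tree to one with `a = 5`. -/
def words : List (List ℕ) :=
  ([] :: toFive).flatMap fun l₀ => [[], [1]].flatMap fun l₁ => [[], [2], [2, 1]].flatMap fun l₂ =>
    [[], [3], [3, 2], [3, 2, 1]].map fun l₃ => l₀ ++ l₁ ++ l₂ ++ l₃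

/-- Labels whose initial ideals are equivalent to that of `g.lab`. -/
def Gluing.orbit (g : Gluing) : List Lab :=
  (g.lab :: g.trees.map g.tree).flatMap fun σ => words.map fun l => σ.act l

theorem Gluing.Ok.eqvGen {g : Gluing} (h : g.Ok) {τ : Lab} (hτ : τ ∈ g.orbit) :
    Relation.EqvGen StepRel (In g.lab) (In τ) := by
  have hw : ∀ l ∈ words, ∀ i ∈ l, 1 ≤ i ∧ i ≤ 5 := by decide +kernel
  obtain ⟨σ, hσ, hτ⟩ := List.mem_flatMap.1 hτ
  obtain ⟨l, hl, rfl⟩ := List.mem_map.1 hτ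
  have e : In σ = In g.lab := by
    rcases List.mem_cons.1 hσ with rfl | hσ
    · rfl
    · obtain ⟨T, hT, rfl⟩ := List.mem_map.1 hσ
      exact h.In_eq hT
  rw [← e]
  exact eqvGen_act (hw l hl) σ

theorem mem_orbit : ∀ τ ∈ labs, τ ∈ (gluing τ.typ).orbit := by
  decide +kernel

theorem eqvGen_of_typ_eq {τ τ' : Lab} (h : τ ∈ labs) (h' : τ' ∈ labs) (e : τ.typ = τ'.typ) :
    Relation.EqvGen StepRel (In τ) (In τ') := by
  have h1 := (gluing_ok _).eqvGen (mem_orbit τ h)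
  have h2 := (gluing_ok _).eqvGen (mem_orbit τ' h')
  rw [← e] at h2
  exact h1.symm.trans _ _ _ h2

end Connectivity

section Invariants

/-- The terms of `Rule.poly` have the same weight. -/
def Rule.Balanced (τ : Lab) (ρ : Rule) : Prop :=
  wt2 τ ρ.b ρ.c ρ.d ρ.e ρ.f ρ.g = wt2 τ ρ.b ρ.c ρ.e ρ.d ρ.f ρ.g

instance (τ : Lab) (ρ : Rule) : Decidable (ρ.Balanced τ) := inferInstanceAs (Decidable (_ = _))

/-- The variables in `Rule.poly` do not vanish. -/
def Rule.Distinct (ρ : Rule) : Prop :=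
  Distinct3 ρ.b ρ.c ρ.d ∧ Distinct3 ρ.b ρ.c ρ.e ∧ Distinct3 ρ.d ρ.f ρ.g ∧ Distinct3 ρ.e ρ.f ρ.g

instance (ρ : Rule) : Decidable ρ.Distinct := inferInstanceAs (Decidable (_ ∧ _ ∧ _ ∧ _))

theorem Toric.balanced {τ : Lab} (ht : Toric τ) {ρ : Rule} (h : ρ.Distinct)
    (hρ : ρ.poly ∈ In τ) : ρ.Balanced τ := by
  obtain ⟨h1, h2, h3, h4⟩ := h
  obtain ⟨K₁, ε₁, e1, p1, m1⟩ := P_eq_C_mul_X h1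
  obtain ⟨K₂, ε₂, e2, p2, m2⟩ := P_eq_C_mul_X h4
  obtain ⟨K₃, ε₃, e3, p3, m3⟩ := P_eq_C_mul_X h2
  obtain ⟨K₄, ε₄, e4, p4, m4⟩ := P_eq_C_mul_X h3
  have hW : ∀ K K' : MI 6, W τ (Finsupp.single K 1 + Finsupp.single K' 1) = wK τ K + wK τ K' := by
    intro K K'
    rw [map_add, W, Finsupp.weight_single, Finsupp.weight_single, one_smul, one_smul]
  have key : monomial (Finsupp.single K₁ 1 + Finsupp.single K₂ 1) (1 : ℂ) +
      monomial (Finsupp.single K₃ 1 + Finsupp.single K₄ 1) (-((ε₁ * ε₂)⁻¹ * (ε₃ * ε₄))) ∈ In τ := by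
    have := (In τ).mul_mem_left (C (ε₁ * ε₂)⁻¹) hρ
    have hm : ∀ (K K' : MI 6) (c : ℂ), monomial (Finsupp.single K 1 + Finsupp.single K' 1) c =
        C c * (X K * X K') := fun K K' c => by
      simp only [X, monomial_mul, C_mul_monomial, mul_one]
    have hC : (C (ε₁ * ε₂)⁻¹ * (C ε₁ * C ε₂) : PRing 6) = 1 := by
      rw [← C_mul, ← C_mul, inv_mul_cancel₀ (mul_ne_zero e1 e2), C_1]
    rw [Rule.poly, p1, p2, p3, p4] at this
    rw [hm, hm]
    convert this using 1
    rw [C_1, C_neg, C_mul, C_mul]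
    linear_combination (-(X K₁ * X K₂) : PRing 6) * hC
  have := ht.2 _ _ _ key
  rw [hW, hW, wt_tri τ m1, wt_tri τ m2, wt_tri τ m3, wt_tri τ m4] at this
  exact this

/-- Relabelling. -/
def Rule.map (f : ℕ → ℕ) (ρ : Rule) : Rule := ⟨f ρ.b, f ρ.c, f ρ.d, f ρ.e, f ρ.f, f ρ.g⟩

theorem sAuto_poly {i : ℕ} (h1 : 1 ≤ i) (h5 : i ≤ 5) (ρ : Rule) :
    sAuto i ρ.poly = (ρ.map (tr i)).poly := by
  simp only [Rule.poly, Rule.map, map_sub, map_mul, sAuto_P h1 h5]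

theorem Rule.Distinct.map {f : ℕ → ℕ} (hf : Function.Injective f)
    (hf' : ∀ x, 1 ≤ x ∧ x ≤ 6 → 1 ≤ f x ∧ f x ≤ 6) {ρ : Rule} (h : ρ.Distinct) :
    (ρ.map f).Distinct := by
  have key : ∀ {a b c}, Distinct3 a b c → Distinct3 (f a) (f b) (f c) := by
    rintro a b c ⟨ha, hb, hc, h1, h2, h3⟩
    exact ⟨hf' a ha, hf' b hb, hf' c hc, hf.ne h1, hf.ne h2, hf.ne h3⟩
  exact ⟨key h.1, key h.2.1, key h.2.2.1, key h.2.2.2⟩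

/-- The ideal contains the binomials of a pattern, after a suitable relabelling. -/
def Contains (Q : List Rule) (A : Ideal (PRing 6)) : Prop :=
  ∃ f : ℕ → ℕ, Function.Injective f ∧ (∀ x, 1 ≤ x ∧ x ≤ 6 → 1 ≤ f x ∧ f x ≤ 6) ∧
    ∀ ρ ∈ Q, (ρ.map f).poly ∈ A

theorem StepRel.contains {Q : List Rule} {A B : Ideal (PRing 6)} (h : StepRel A B) :
    Contains Q A ↔ Contains Q B := by
  obtain ⟨i, h1, h5, rfl⟩ := h
  have hr : ∀ x, 1 ≤ x ∧ x ≤ 6 → 1 ≤ tr i x ∧ tr i x ≤ 6 := fun x hx => by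
    unfold tr; split_ifs <;> omega
  constructor
  · rintro ⟨f, hf, hf', hQ⟩
    refine ⟨tr i ∘ f, (tr_injective i).comp hf, fun x hx => hr _ (hf' x hx), fun ρ hρ => ?_⟩
    rw [mem_map_sAuto h1 h5, sAuto_poly h1 h5]
    convert hQ ρ hρ using 2
    simp only [Rule.map, Function.comp_apply, tr_involutive]
  · rintro ⟨f, hf, hf', hQ⟩
    refine ⟨tr i ∘ f, (tr_injective i).comp hf, fun x hx => hr _ (hf' x hx), fun ρ hρ => ?_⟩
    have := hQ ρ hρ
    rw [mem_map_sAuto h1 h5, sAuto_poly h1 h5] at this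
    exact this

theorem contains_of_eqvGen {Q : List Rule} {A B : Ideal (PRing 6)}
    (h : Relation.EqvGen StepRel A B) : Contains Q A ↔ Contains Q B := by
  induction h with
  | rel _ _ h => exact h.contains
  | refl _ => exact Iff.rfl
  | symm _ _ _ ih => exact ih.symm
  | trans _ _ _ _ _ ih₁ ih₂ => exact ih₁.trans ih₂

/-- For each type, binomials in the initial ideal of that type which cannot be relabelled to
lie in one of a different type. -/
def pattern : Fin 4 → List Rule := ![
  [⟨1, 2, 5, 6, 4, 1⟩, ⟨1, 2, 3, 4, 6, 1⟩, ⟨2, 1, 4, 5, 6, 2⟩, ⟨3, 1, 2, 4, 5, 3⟩],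
  [⟨5, 1, 2, 3, 6, 5⟩, ⟨5, 1, 3, 4, 2, 5⟩, ⟨6, 1, 3, 5, 2, 6⟩, ⟨3, 2, 5, 6, 4, 3⟩],
  [⟨5, 1, 2, 6, 4, 5⟩, ⟨5, 1, 3, 4, 6, 5⟩, ⟨3, 1, 2, 4, 5, 3⟩, ⟨4, 2, 3, 5, 6, 4⟩],
  [⟨4, 2, 5, 6, 3, 4⟩, ⟨6, 2, 3, 4, 5, 6⟩, ⟨1, 3, 4, 5, 6, 1⟩]]

/-- The relabelling given by a list of the images of `1, …, 6`. -/
def relabel (p : List ℕ) (x : ℕ) : ℕ := p.getD (x - 1) 0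

theorem contains_pattern (k : Fin 4) : Contains (pattern k) (In (gluing k).lab) := by
  have : ∀ k, ∀ ρ ∈ pattern k, ρ.Ok (gluing k).lab := by decide +kernel
  exact ⟨id, Function.injective_id, fun x hx => hx, fun ρ hρ => (this k ρ hρ).mem_In⟩

theorem not_contains_pattern {k k' : Fin 4} (hk : k ≠ k') :
    ¬ Contains (pattern k) (In (gluing k').lab) := by
  rintro ⟨f, hf, hf', hQ⟩
  have h1 : ∀ k, ∀ p ∈ (List.range' 1 6).permutations', ∀ k', k ≠ k' →
      ∃ ρ ∈ pattern k, ¬ (ρ.map (relabel p)).Balanced (gluing k').lab := by decide +kernel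
  have h2 : ∀ k, ∀ ρ ∈ pattern k, ρ.Distinct := by decide +kernel
  let p := (List.range' 1 6).map f
  have hp : p ∈ (List.range' 1 6).permutations' := by
    rw [List.mem_permutations']
    refine List.Subperm.perm_of_length_le ?_ (by simp [p])
    refine List.subperm_of_subset ((List.nodup_map_iff hf).2 List.nodup_range') ?_
    intro y hy
    obtain ⟨x, hx, rfl⟩ := List.mem_map.1 hy
    rw [List.mem_range'_1] at hx ⊢
    have := hf' x (by omega)
    omega
  obtain ⟨ρ, hρ, hb⟩ := h1 k p hp k' hk
  apply hb
  have hr : ∀ x, 1 ≤ x ∧ x ≤ 6 → relabel p x = f x := by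
    rintro x ⟨hx, hx'⟩
    interval_cases x <;> rfl
  have hd := h2 k ρ hρ
  have e : ρ.map (relabel p) = ρ.map f := by
    obtain ⟨⟨hb, hc, hd, -⟩, ⟨-, -, he, -⟩, ⟨-, hf, hg, -⟩, -⟩ := hd
    simp only [Rule.map, hr _ hb, hr _ hc, hr _ hd, hr _ he, hr _ hf, hr _ hg]
  rw [e]
  exact (toric_of_mem_labs (gluing_ok k').1).balanced (hd.map hf hf') (hQ ρ hρ)

theorem typ_gluing (k : Fin 4) : (gluing k).lab.typ = k := by
  revert k; decide +kernel

theorem eqvGen_iff {τ τ' : Lab} (h : τ ∈ labs) (h' : τ' ∈ labs) :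
    Relation.EqvGen StepRel (In τ) (In τ') ↔ τ.typ = τ'.typ := by
  refine ⟨fun hE => ?_, eqvGen_of_typ_eq h h'⟩
  by_contra hne
  have e1 := eqvGen_of_typ_eq (gluing_ok τ.typ).1 h (typ_gluing _)
  have e2 := eqvGen_of_typ_eq h' (gluing_ok τ'.typ).1 (typ_gluing _).symm
  exact not_contains_pattern hne
    ((contains_of_eqvGen ((e1.trans _ _ _ hE).trans _ _ _ e2)).1 (contains_pattern _))

/-- Binomials which distinguish the initial ideals. -/
def separating : List Rule :=
  [⟨4, 1, 2, 3, 6, 4⟩, ⟨1, 2, 3, 6, 4, 1⟩, ⟨6, 1, 3, 4, 2, 6⟩, ⟨3, 1, 2, 5, 4, 3⟩,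
   ⟨2, 1, 4, 5, 3, 2⟩, ⟨6, 2, 3, 5, 4, 6⟩, ⟨5, 1, 4, 6, 2, 5⟩, ⟨4, 1, 3, 5, 2, 4⟩,
   ⟨5, 1, 2, 4, 3, 5⟩, ⟨6, 1, 2, 3, 5, 6⟩, ⟨3, 1, 5, 6, 2, 3⟩, ⟨5, 1, 2, 3, 4, 5⟩,
   ⟨4, 1, 5, 6, 3, 4⟩, ⟨6, 1, 2, 5, 4, 6⟩, ⟨1, 2, 4, 6, 5, 1⟩]

theorem In_injOn {τ τ' : Lab} (h : τ ∈ labs) (h' : τ' ∈ labs) (e : In τ = In τ') : τ = τ' := by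
  have h1 : ∀ τ ∈ labs, ∀ ρ ∈ separating, ρ.Balanced τ → ρ.Ok τ := by decide +kernel
  have h2 : ∀ ρ ∈ separating, ρ.Distinct := by decide +kernel
  have h3 : (labs.map fun τ => separating.map fun ρ => decide (ρ.Balanced τ)).Nodup := by
    decide +kernel
  refine List.inj_on_of_nodup_map h3 h h' (List.map_congr_left fun ρ hρ => ?_)
  rw [decide_eq_decide]
  constructor
  · intro hb
    exact (toric_of_mem_labs h').balanced (h2 ρ hρ) (e ▸ (h1 τ h ρ hρ hb).mem_In)
  · intro hb
    exact (toric_of_mem_labs h).balanced (h2 ρ hρ) (e ▸ (h1 τ' h' ρ hρ hb).mem_In)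

theorem mem_II36 {A : Ideal (PRing 6)} : A ∈ II36 ↔ ∃ τ ∈ labs, A = In τ := by
  constructor
  · rintro ⟨S, hS, rfl⟩
    obtain ⟨w, hw, rfl⟩ := isIter_six_iff.1 hS
    exact ⟨w.lab, mem_labs.2 ⟨w, hw, rfl⟩, hw.InIdeal_eq⟩
  · rintro ⟨τ, hτ, rfl⟩
    obtain ⟨w, hw, rfl⟩ := mem_labs.1 hτ
    exact ⟨w.list, isIter_six_iff.2 ⟨w, hw, rfl⟩, hw.InIdeal_eq.symm⟩

/-- The initial ideals of a given type. -/
def orbitClass (k : Fin 4) : Set (Ideal (PRing 6)) :=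
  In '' ((labs.filter fun τ => τ.typ = k).toFinset : Set Lab)

theorem mem_orbitClass {k : Fin 4} {A : Ideal (PRing 6)} :
    A ∈ orbitClass k ↔ ∃ τ ∈ labs, τ.typ = k ∧ A = In τ := by
  constructor
  · rintro ⟨τ, h, rfl⟩
    simp only [List.coe_toFinset, Set.mem_ofPred_eq, List.mem_filter, decide_eq_true_eq] at h
    exact ⟨τ, h.1, h.2, rfl⟩
  · rintro ⟨τ, h, h', rfl⟩
    exact ⟨τ, by simpa using ⟨h, h'⟩, rfl⟩

theorem ncard_orbitClass (k : Fin 4) :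
    (orbitClass k).ncard = (labs.filter fun τ => τ.typ = k).length := by
  have hn : labs.Nodup := by decide +kernel
  rw [orbitClass, Set.InjOn.ncard_image, Set.ncard_coe_finset,
    List.toFinset_card_of_nodup (hn.filter _)]
  intro τ hτ τ' hτ' e
  simp only [List.coe_toFinset, Set.mem_ofPred_eq, List.mem_filter] at hτ hτ'
  exact In_injOn hτ.1 hτ'.1 e

end Invariants

/-- Under the equivalence relation on `𝕀_{3,6}` induced by the group `G` generated by the
sign-twisted simple transpositions, `𝕀_{3,6}` decomposes into exactly 4 equivalence
classes, of cardinalities 48, 48, 48 and 96. -/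
theorem orbit_classification :
    ∃ C : Fin 4 → Set (Ideal (PRing 6)),
      (∀ a, C a ⊆ II36) ∧
      (∀ X ∈ II36, ∃ a, X ∈ C a) ∧
      (∀ a b, a ≠ b → Disjoint (C a) (C b)) ∧
      (∀ a, ∀ X ∈ C a, ∀ Y ∈ II36, (Relation.EqvGen StepRel X Y ↔ Y ∈ C a)) ∧
      (C 0).ncard = 48 ∧ (C 1).ncard = 48 ∧ (C 2).ncard = 48 ∧ (C 3).ncard = 96 := by
  refine ⟨orbitClass, fun k A hA => ?_, fun A hA => ?_, fun k k' hk => ?_, fun k A hA B hB => ?_,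
    ?_, ?_, ?_, ?_⟩
  · obtain ⟨τ, hτ, -, rfl⟩ := mem_orbitClass.1 hA
    exact mem_II36.2 ⟨τ, hτ, rfl⟩
  · obtain ⟨τ, hτ, rfl⟩ := mem_II36.1 hA
    exact ⟨τ.typ, mem_orbitClass.2 ⟨τ, hτ, rfl, rfl⟩⟩
  · rw [Set.disjoint_left]
    intro A hA hA'
    obtain ⟨τ, hτ, rfl, rfl⟩ := mem_orbitClass.1 hA
    obtain ⟨τ', hτ', rfl, e⟩ := mem_orbitClass.1 hA'
    exact hk (congrArg Lab.typ (In_injOn hτ hτ' e))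
  · obtain ⟨τ, hτ, rfl, rfl⟩ := mem_orbitClass.1 hA
    obtain ⟨τ', hτ', rfl⟩ := mem_II36.1 hB
    rw [eqvGen_iff hτ hτ', mem_orbitClass]
    constructor
    · exact fun e => ⟨τ', hτ', e.symm, rfl⟩
    · rintro ⟨τ'', hτ'', e, e'⟩
      rw [← e, In_injOn hτ' hτ'' e']
  all_goals
    rw [ncard_orbitClass]
    decide +kernel
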